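/- arXiv:1807.09485 — 3 statements merged into one kernel-verified Lean document; each statement's English description precedes it below -/
import Mathlib

section
/- If two 3-dimensional lattice polytopes P and P' in ℝ³ are Ehrhart-equivalent, then P and P' are GL(ℤ)-equidecomposable; moreover, the pieces of the equidecomposition can be taken to be relatively open half-unimodular simplices. -/
open Pointwise

/-- A unimodular transformation of `ℝ^n`: an affine map `x ↦ A·x + b` with
`A ∈ GL_n(ℤ)` and `b ∈ ℤ^n`. -/
def IsUnimodular {n : ℕ} (f : (Fin n → ℝ) → (Fin n → ℝ)) : Prop :=
  ∃ A : Matrix (Fin n) (Fin n) ℤ, IsUnit A.det ∧ ∃ b : Fin n → ℤ,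
    ∀ x, f x = (A.map (Int.cast : ℤ → ℝ)).mulVec x + fun i => (b i : ℝ)

/-- `conv(0, e_1, …, e_i)` in `ℝ^n`, where `e_1, …, e_n` is the standard basis. -/
def baseSimplex (n i : ℕ) : Set (Fin n → ℝ) :=
  convexHull ℝ (insert 0 ((fun j : Fin n => (Pi.single j 1 : Fin n → ℝ)) '' {j | (j : ℕ) < i}))

/-- A half-unimodular simplex: a set `Δ` such that `2Δ` is the image of some
`conv(0, e_1, …, e_i)` under a unimodular transformation. -/
def IsHalfUnimodular {n : ℕ} (Δ : Set (Fin n → ℝ)) : Prop :=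
  ∃ i ≤ n, ∃ f, IsUnimodular f ∧ (2 : ℝ) • Δ = f '' baseSimplex n i

/-- The number of lattice points in a subset of `ℝ^n`. -/
noncomputable def latticeCount {n : ℕ} (S : Set (Fin n → ℝ)) : ℕ :=
  Set.ncard {x : Fin n → ℤ | (fun i => (x i : ℝ)) ∈ S}

/-- A lattice polytope in `ℝ³`: the convex hull of a finite set of points of `ℤ³`. -/
def IsLatticePolytope3 (P : Set (Fin 3 → ℝ)) : Prop :=
  ∃ V : Finset (Fin 3 → ℤ),
    P = convexHull ℝ ((fun v : Fin 3 → ℤ => fun i => (v i : ℝ)) '' (V : Set (Fin 3 → ℤ)))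

theorem div_add_div_of_add_eq_mul {n x y k : ℕ} (hn : 0 < n) (hx : ¬ n ∣ x) (h : x + y = k * n) :
    x / n + y / n + 1 = k := by
  have h4 := Nat.div_add_mod x n
  have h5 : 0 < x % n := Nat.pos_of_ne_zero fun h0 => hx (Nat.dvd_of_mod_eq_zero h0)
  have h6 := Nat.mod_lt x hn
  have h7 := Nat.div_add_mod y n
  have h8 := Nat.mod_lt y hn
  generalize x / n = X at *
  generalize y / n = Y at *
  generalize x % n = u at *
  generalize y % n = v at *
  have e : u + v + n * (X + Y) = n * k := by rw [Nat.mul_add, Nat.mul_comm n k]; omega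
  have h9 : X + Y < k := by
    by_contra hcon
    have := Nat.mul_le_mul_left n (not_lt.1 hcon)
    omega
  have h10 : k < X + Y + 2 := by
    by_contra hcon
    have := Nat.mul_le_mul_left n (not_lt.1 hcon)
    rw [Nat.mul_add] at this
    omega
  omega

set_option maxHeartbeats 1000000 in
/-- Three sequences `⌊k a / n⌋`, `⌊k b / n⌋`, `⌊k c / n⌋` that together increase by exactly one at
every step cannot have all three slopes bigger than `1 / n`. -/
theorem no_three_jump_sequences (n a b c : ℕ) (hc : 2 ≤ c) (hcb : c ≤ b) (hba : b ≤ a)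
    (hsum : a + b + c = n + 1)
    (ha' : ∀ k, 1 ≤ k → k < n → ¬ n ∣ k * a) (hb' : ∀ k, 1 ≤ k → k < n → ¬ n ∣ k * b)
    (h : ∀ k, 1 ≤ k → k < n → k * a / n + k * b / n + k * c / n + 1 = k) : False := by
  have hn : 0 < n := by omega
  obtain ⟨α, hα⟩ : ∃ α, α + a = n := ⟨n - a, by omega⟩
  have hαbc : α + 1 = b + c := by omega
  -- the sequence with slope `α / n` is the sum of the two slower ones
  have hF : ∀ k, k < n → k * α / n = k * b / n + k * c / n := by
    intro k hk2
    rcases Nat.eq_zero_or_pos k with rfl | hk1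
    · simp
    have h1 := h k hk1 hk2
    have h2 := div_add_div_of_add_eq_mul hn (ha' k hk1 hk2)
      (show k * a + k * α = k * n by rw [← Nat.mul_add, add_comm, hα])
    generalize k * a / n = A at h1 h2
    generalize k * α / n = A' at h2 ⊢
    generalize k * b / n = B at h1 ⊢
    generalize k * c / n = C at h1 ⊢
    omega
  have h2a : 2 * α < n := by
    have h2 := h 2 (by omega) (by omega)
    have h3 : 2 * b / n ≤ 2 * a / n := Nat.div_le_div_right (by omega)
    have h4 : 2 * c / n ≤ 2 * b / n := Nat.div_le_div_right (by omega)
    have h5 : 1 ≤ 2 * a / n := by omega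
    have h6 := (Nat.le_div_iff_mul_le hn).1 h5
    have h7 : 2 * a ≠ n := fun h8 => ha' 2 (by omega) (by omega) (h8 ▸ dvd_rfl)
    omega
  have lt_of_div : ∀ x j, x / n ≤ j → x < (j + 1) * n := fun x j hx =>
    (Nat.div_lt_iff_lt_mul hn).1 (Nat.lt_succ_of_le hx)
  -- first jump of the slowest sequence
  have hexs : ∃ s, n ≤ s * c := ⟨n, by nlinarith⟩
  obtain ⟨s, hs1, hs2⟩ : ∃ s, n ≤ (s + 1) * c ∧ s * c < n := by
    have hpos : Nat.find hexs ≠ 0 := by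
      intro h0
      have := Nat.find_spec hexs
      rw [h0] at this
      omega
    obtain ⟨s, hs⟩ := Nat.exists_eq_succ_of_ne_zero hpos
    refine ⟨s, by have := Nat.find_spec hexs; rwa [hs] at this, ?_⟩
    exact not_le.1 (Nat.find_min hexs (by omega))
  have hexm : ∃ m, n ≤ m * b := ⟨n, by nlinarith⟩
  have first : ∀ t, 0 < t → ∃ m, t * n ≤ (m + 1) * b ∧ m * b < t * n := by
    intro t ht
    have hex : ∃ m, t * n ≤ m * b := ⟨t * n, by nlinarith [Nat.zero_le (t * n)]⟩
    have hpos : Nat.find hex ≠ 0 := by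
      intro h0
      have := Nat.find_spec hex
      rw [h0] at this
      have := Nat.mul_pos ht hn
      omega
    obtain ⟨s, hs⟩ := Nat.exists_eq_succ_of_ne_zero hpos
    refine ⟨s, by have := Nat.find_spec hex; rwa [hs] at this, ?_⟩
    exact not_le.1 (Nat.find_min hex (by omega))
  have hsn : s + 1 < n := by
    by_contra hcon
    have : n - 1 ≤ s := by omega
    have : (n - 1) * 2 ≤ s * c := Nat.mul_le_mul this hc
    omega
  have hs0 : 1 ≤ s := by
    by_contra hcon
    have : s = 0 := by omega
    subst this
    omega
  have hCs : (s + 1) * c / n = 1 := by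
    apply le_antisymm
    · apply Nat.le_of_lt_succ
      rw [Nat.div_lt_iff_lt_mul hn]
      nlinarith
    · rw [Nat.le_div_iff_mul_le hn]; omega
  have hC0 : ∀ k, k ≤ s → k * c / n = 0 := fun k hk =>
    Nat.div_eq_of_lt (lt_of_le_of_lt (Nat.mul_le_mul_right c hk) hs2)
  obtain ⟨j, hj⟩ : ∃ j, (s + 1) * b / n = j := ⟨_, rfl⟩
  have hj1 : 1 ≤ j := by
    rw [← hj, Nat.le_div_iff_mul_le hn]
    nlinarith
  have hsα : (j + 1) * n ≤ (s + 1) * α := by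
    have := hF (s + 1) hsn
    rw [hCs, hj] at this
    exact (Nat.le_div_iff_mul_le hn).1 this.ge
  have hsb : j * n ≤ s * b := by
    have h1 := hF s (by omega)
    rw [hC0 s le_rfl, add_zero] at h1
    rw [← Nat.le_div_iff_mul_le hn, ← h1, Nat.le_div_iff_mul_le hn]
    nlinarith
  have hsb' : (s + 1) * b < (j + 1) * n := lt_of_div _ _ hj.le
  obtain ⟨m, hm1, hm2⟩ := first 1 one_pos
  rw [one_mul] at hm1 hm2
  have hms : m ≤ s := by
    by_contra hcon
    have : (s + 1) * b ≤ m * b := Nat.mul_le_mul_right b (by omega)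
    nlinarith
  have hmα : m * α < n := by
    have h1 := hF m (by omega)
    rw [hC0 m hms, Nat.div_eq_of_lt hm2] at h1
    simpa using lt_of_div _ 0 h1.le
  obtain ⟨r, hr1, hr2⟩ := first j hj1
  have hrs : r < s := by
    by_contra hcon
    have : s * b ≤ r * b := Nat.mul_le_mul_right b (by omega)
    omega
  have hrα : r * α < j * n := by
    have h1 := hF r (by omega)
    rw [hC0 r (by omega), add_zero] at h1
    have h2 : r * b / n < j := (Nat.div_lt_iff_lt_mul hn).2 hr2
    exact (Nat.div_lt_iff_lt_mul hn).1 (h1 ▸ h2)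
  have hjb : j + 2 ≤ b := by
    by_contra hcon
    obtain ⟨t, ht⟩ : ∃ t, t + s = n := ⟨n - s, by omega⟩
    have h1 : t * b + s * b = n * b := by rw [← Nat.add_mul, ht]
    have h2 : t * c + s * c = n * c := by rw [← Nat.add_mul, ht]
    have h3 : (b - 1) * n ≤ j * n := Nat.mul_le_mul_right n (by omega)
    have h4 : (b - 1) * n + n = n * b := by
      obtain ⟨b', rfl⟩ : ∃ b', b = b' + 1 := ⟨b - 1, by omega⟩
      simp; ring
    have h5 : t * b ≠ n := fun h6 => hb' t (by omega) (by omega) (h6 ▸ dvd_rfl)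
    have h6 : t * c ≤ t * b := Nat.mul_le_mul_left t hcb
    have h7 : n * 2 ≤ n * c := Nat.mul_le_mul_left n hc
    omega
  obtain ⟨r', hr'1, hr'2⟩ := first (j + 1) (by omega)
  have hr's : s + 1 ≤ r' := by
    by_contra hcon
    have : (r' + 1) * b ≤ (s + 1) * b := Nat.mul_le_mul_right b (by omega)
    omega
  have hr'n : r' + 1 < n := by
    by_contra hcon
    have h1 : (n - 1) * b ≤ r' * b := Nat.mul_le_mul_right b (by omega)
    have h2 : (j + 1) * n ≤ (b - 1) * n := Nat.mul_le_mul_right n (by omega)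
    obtain ⟨b', rfl⟩ : ∃ b', b = b' + 1 := ⟨b - 1, by omega⟩
    obtain ⟨n', rfl⟩ : ∃ n', n = n' + 1 := ⟨n - 1, by omega⟩
    simp only [Nat.add_sub_cancel] at h1 h2
    nlinarith
  have hr'α : (j + 2) * n ≤ (r' + 1) * α := by
    have h1 := hF (r' + 1) hr'n
    have h2 : j + 1 ≤ (r' + 1) * b / n := (Nat.le_div_iff_mul_le hn).2 hr'1
    have h3 : 1 ≤ (r' + 1) * c / n := by
      rw [← hCs]
      exact Nat.div_le_div_right (Nat.mul_le_mul_right c (by omega))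
    exact (Nat.le_div_iff_mul_le hn).1 (by omega)
  have hgap : r' ≤ r + 1 + m := by
    by_contra hcon
    have h1 : (r + 1 + (m + 1)) * b ≤ r' * b := Nat.mul_le_mul_right b (by omega)
    nlinarith
  have h1 : (r' + 1) * α ≤ (r + 2 + m) * α := Nat.mul_le_mul_right α (by omega)
  nlinarith

set_option maxHeartbeats 1000000 in
/-- An arithmetic form of White's theorem on empty lattice tetrahedra. -/
theorem white_arithmetic (p q r : ℤ) (hq : 0 < q)
    (hempty : ∀ x y z : ℤ, 0 < y → y < q → 0 ≤ q * x - p * y → 0 ≤ q * z - r * y →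
      ¬ (q * x - p * y) + (q * z - r * y) + y ≤ q) :
    q ∣ p - 1 ∨ q ∣ r - 1 ∨ q ∣ p + r := by
  -- residues `a ≡ k p`, `b ≡ k r`, `c ≡ k (1 - p - r)` add up to `q + k`
  have key : ∀ k a b c : ℤ, 0 < k → k < q → 0 ≤ a → a < q → 0 ≤ b → b < q → 0 ≤ c → c < q →
      q ∣ a - k * p → q ∣ b - k * r → q ∣ c - k * (1 - p - r) →
      a + b + c = q + k ∧ a ≠ 0 ∧ b ≠ 0 ∧ c ≠ 0 := by
    rintro k a b c hk hkq ha haq hb hbq hc hcq ⟨a', ha'⟩ ⟨b', hb'⟩ ⟨c', hc'⟩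
    have hsum : a + b + c = k + q * (a' + b' + c') := by linear_combination ha' + hb' + hc'
    have neg : ∀ u v w : ℤ, 0 ≤ u → 0 ≤ v → 0 ≤ w → u + v + w + k = q → q ∣ u + a → q ∣ v + b →
        False := by
      rintro u v w hu hv hw huvw ⟨u', hu'⟩ ⟨v', hv'⟩
      refine hempty (u' - a') k (v' - b') hk hkq ?_ ?_ ?_
      · nlinarith
      · nlinarith
      · nlinarith
    have pos : a + b + c ≠ k := by
      intro h
      refine hempty (a' + p) (q - k) (b' + r) (by omega) (by omega) ?_ ?_ ?_
      · nlinarith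
      · nlinarith
      · nlinarith
    have hs1 : a' + b' + c' < 3 := by
      by_contra hcon
      nlinarith
    have hs0 : 0 ≤ a' + b' + c' := by
      by_contra hcon
      nlinarith
    have h2 : a + b + c ≠ k + q * 2 := by
      intro h
      exact neg (q - a) (q - b) (q - c) (by omega) (by omega) (by omega) (by omega)
        ⟨1, by ring⟩ ⟨1, by ring⟩
    have hs : a + b + c = q + k := by
      have : a' + b' + c' = 0 ∨ a' + b' + c' = 1 ∨ a' + b' + c' = 2 := by omega
      rcases this with h | h | h <;> rw [h] at hsum
      · exact absurd hsum (by omega)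
      · omega
      · exact absurd hsum h2
    refine ⟨hs, ?_, ?_, ?_⟩
    · rintro rfl
      exact neg 0 (q - b) (q - c) (by omega) (by omega) (by omega) (by omega)
        ⟨0, by ring⟩ ⟨1, by ring⟩
    · rintro rfl
      exact neg (q - a) 0 (q - c) (by omega) (by omega) (by omega) (by omega)
        ⟨1, by ring⟩ ⟨0, by ring⟩
    · rintro rfl
      exact neg (q - a) (q - b) 0 (by omega) (by omega) (by omega) (by omega)
        ⟨1, by ring⟩ ⟨1, by ring⟩
  by_cases hq1 : q = 1
  · subst hq1; left; exact one_dvd _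
  obtain ⟨n, hn⟩ : ∃ n : ℕ, (n : ℤ) = q := ⟨q.toNat, by omega⟩
  have res : ∀ t : ℤ, ∃ a : ℕ, (a : ℤ) = t % q := fun t =>
    ⟨(t % q).toNat, by have := Int.emod_nonneg t hq.ne'; omega⟩
  obtain ⟨a, ha⟩ := res p
  obtain ⟨b, hb⟩ := res r
  obtain ⟨c, hc⟩ := res (1 - p - r)
  have kmod : ∀ (x k : ℕ) (t : ℤ), (x : ℤ) = t % q → q ∣ ((k * x % n : ℕ) : ℤ) - k * t := by
    intro x k t hx
    rw [Int.natCast_mod, hn, Nat.cast_mul, hx]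
    apply Int.ModEq.dvd
    exact ((Int.mod_modEq _ _).trans ((Int.mod_modEq t q).mul_left _)).symm
  have hn0 : 0 < n := by omega
  have step : ∀ k : ℕ, 1 ≤ k → k < n →
      k * a % n + k * b % n + k * c % n = n + k ∧ k * a % n ≠ 0 ∧ k * b % n ≠ 0 ∧
        k * c % n ≠ 0 := by
    intro k hk hkn
    have := key k ((k * a % n : ℕ)) ((k * b % n : ℕ)) ((k * c % n : ℕ)) (by omega) (by omega)
      (by positivity) (by have := Nat.mod_lt (k * a) hn0; omega)
      (by positivity) (by have := Nat.mod_lt (k * b) hn0; omega)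
      (by positivity) (by have := Nat.mod_lt (k * c) hn0; omega)
      (kmod a k p ha) (kmod b k r hb) (kmod c k _ hc)
    omega
  have lt : ∀ (x : ℕ) (t : ℤ), (x : ℤ) = t % q → x < n := by
    intro x t hx
    have := Int.emod_lt_of_pos t hq
    omega
  have ha_lt := lt a _ ha
  have hb_lt := lt b _ hb
  have hc_lt := lt c _ hc
  obtain ⟨hs, ha0, hb0, hc0⟩ := step 1 le_rfl (by omega)
  simp only [one_mul, Nat.mod_eq_of_lt ha_lt, Nat.mod_eq_of_lt hb_lt, Nat.mod_eq_of_lt hc_lt]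
    at hs ha0 hb0 hc0
  have one : ∀ (x : ℕ) (t : ℤ), (x : ℤ) = t % q → x = 1 → q ∣ t - 1 := by
    rintro x t hx rfl
    apply Int.ModEq.dvd
    unfold Int.ModEq
    rw [← hx, Int.emod_eq_of_lt] <;> omega
  by_cases h1 : a = 1
  · exact Or.inl (one a p ha h1)
  by_cases h2 : b = 1
  · exact Or.inr (Or.inl (one b r hb h2))
  by_cases h3 : c = 1
  · right; right
    have := one c _ hc h3
    rw [show p + r = -(1 - p - r - 1) by ring]
    exact (dvd_neg).2 this
  exfalso
  have dvd : ∀ x k : ℕ, k * x % n ≠ 0 → ¬ n ∣ k * x := fun x k h h' => h (Nat.mod_eq_zero_of_dvd h')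
  have hA : ∀ k, 1 ≤ k → k < n → ¬ n ∣ k * a := fun k hk hkn => dvd _ _ (step k hk hkn).2.1
  have hB : ∀ k, 1 ≤ k → k < n → ¬ n ∣ k * b := fun k hk hkn => dvd _ _ (step k hk hkn).2.2.1
  have hC : ∀ k, 1 ≤ k → k < n → ¬ n ∣ k * c := fun k hk hkn => dvd _ _ (step k hk hkn).2.2.2
  have hdiv : ∀ k, 1 ≤ k → k < n → k * a / n + k * b / n + k * c / n + 1 = k := by
    intro k hk hkn
    have e := (step k hk hkn).1
    have ea := Nat.div_add_mod (k * a) n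
    have eb := Nat.div_add_mod (k * b) n
    have ec := Nat.div_add_mod (k * c) n
    have e1 : n * (k * a / n + k * b / n + k * c / n + 1) = n * k := by
      have : k * a + k * b + k * c = n * k + k := by
        rw [← Nat.mul_add, ← Nat.mul_add, show a + b + c = n + 1 by omega]; ring
      simp only [Nat.mul_add]
      omega
    exact Nat.eq_of_mul_eq_mul_left hn0 e1
  have main := no_three_jump_sequences n
  rcases le_total a b with hab | hab <;> rcases le_total b c with hbc | hbc <;>
    rcases le_total a c with hac | hac
  · exact main c b a (by omega) hab hbc (by omega) hC hB fun k h1 h2 => by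
      have := hdiv k h1 h2; omega
  · exact main c b a (by omega) hab hbc (by omega) hC hB fun k h1 h2 => by
      have := hdiv k h1 h2; omega
  · exact main b c a (by omega) hac hbc (by omega) hB hC fun k h1 h2 => by
      have := hdiv k h1 h2; omega
  · exact main b a c (by omega) hac hab (by omega) hB hA fun k h1 h2 => by
      have := hdiv k h1 h2; omega
  · exact main c a b (by omega) hab hac (by omega) hC hA fun k h1 h2 => by
      have := hdiv k h1 h2; omega
  · exact main a c b (by omega) hbc hac (by omega) hA hC fun k h1 h2 => by
      have := hdiv k h1 h2; omega
  · exact main a b c (by omega) hbc hab (by omega) hA hB fun k h1 h2 => by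
      have := hdiv k h1 h2; omega
  · exact main a b c (by omega) hbc hab (by omega) hA hB fun k h1 h2 => by
      have := hdiv k h1 h2; omega

theorem mem_convexHull_range_iff {E κ : Type*} [AddCommGroup E] [Module ℝ E] [Fintype κ]
    {v : κ → E} {x : E} : x ∈ convexHull ℝ (Set.range v) ↔
      ∃ μ : κ → ℝ, (∀ j, 0 ≤ μ j) ∧ ∑ j, μ j = 1 ∧ ∑ j, μ j • v j = x := by
  classical
  constructor
  · intro hx
    rw [convexHull_range_eq_exists_affineCombination] at hx
    obtain ⟨s, w, hw0, hw1, hwx⟩ := hx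
    rw [Finset.affineCombination_eq_linear_combination _ _ _ hw1] at hwx
    refine ⟨fun i => if i ∈ s then w i else 0, fun i => ?_, by simpa using hw1, ?_⟩
    · dsimp only; split_ifs with h
      · exact hw0 i h
      · exact le_rfl
    · simpa [ite_smul] using hwx
  · rintro ⟨μ, h0, h1, rfl⟩
    exact (convex_convexHull ℝ _).sum_mem (fun j _ => h0 j) h1
      fun j _ => subset_convexHull ℝ _ ⟨j, rfl⟩

section RegularDecomposition

variable {ι E : Type*} [Fintype ι]

/-- The set of all convex combinations with strictly positive weights of a finite family. -/
def openHull [AddCommGroup E] [Module ℝ E] (w : ι → E) : Set E :=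
  {x | ∃ μ : ι → ℝ, (∀ i, 0 < μ i) ∧ ∑ i, μ i = 1 ∧ ∑ i, μ i • w i = x}

/-- The set of all convex combinations of a finite family whose support is exactly `A`. -/
def cell [AddCommGroup E] [Module ℝ E] (v : ι → E) (A : Finset ι) : Set E :=
  {x | ∃ μ : ι → ℝ, (∀ i ∈ A, 0 < μ i) ∧ (∀ i ∉ A, μ i = 0) ∧ ∑ i, μ i = 1 ∧
    ∑ i, μ i • v i = x}

/-- The direction `δ` decreases the given costs lexicographically. -/
def Improves : List (ι → ℝ) → (ι → ℝ) → Prop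
  | [], _ => False
  | c :: L, δ => ∑ i, c i * δ i < 0 ∨ (∑ i, c i * δ i = 0 ∧ Improves L δ)

/-- The cell with support `A` belongs to the regular decomposition defined by the costs `L`: no
admissible direction starting in this cell decreases the costs. -/
def IsRegularSupport [AddCommGroup E] [Module ℝ E] (v : ι → E) (L : List (ι → ℝ)) (A : Finset ι) : Prop :=
  ∀ δ : ι → ℝ, ∑ i, δ i = 0 → ∑ i, δ i • v i = 0 → (∀ i ∉ A, 0 ≤ δ i) → ¬ Improves L δ

theorem Improves.smul {L : List (ι → ℝ)} {δ : ι → ℝ} (h : Improves L δ) {ε : ℝ} (hε : 0 < ε) :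
    Improves L (ε • δ) := by
  induction L with
  | nil => exact h
  | cons c L ih =>
    have e : ∑ i, c i * (ε • δ) i = ε * ∑ i, c i * δ i := by
      rw [Finset.mul_sum]; exact Finset.sum_congr rfl fun i _ => by simp; ring
    rcases h with h | ⟨h0, h⟩
    · left; rw [e]; exact mul_neg_of_pos_of_neg hε h
    · right; rw [e, h0]; exact ⟨mul_zero _, ih h⟩

theorem Improves.append {L L' : List (ι → ℝ)} {δ : ι → ℝ} (h : Improves L δ) :
    Improves (L ++ L') δ := by
  induction L with
  | nil => exact h.elim
  | cons c L ih =>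
    rcases h with h | ⟨h0, h⟩
    · exact Or.inl h
    · exact Or.inr ⟨h0, ih h⟩

theorem improves_or_neg_or_forall (L : List (ι → ℝ)) (δ : ι → ℝ) :
    Improves L δ ∨ Improves L (-δ) ∨ ∀ c ∈ L, ∑ i, c i * δ i = 0 := by
  induction L with
  | nil => simp
  | cons c L ih =>
    have e : ∑ i, c i * (-δ) i = - ∑ i, c i * δ i := by simp
    rcases lt_trichotomy (∑ i, c i * δ i) 0 with h | h | h
    · exact Or.inl (Or.inl h)
    · rcases ih with h' | h' | h'
      · exact Or.inl (Or.inr ⟨h, h'⟩)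
      · exact Or.inr (Or.inl (Or.inr ⟨by rw [e, h, neg_zero], h'⟩))
      · exact Or.inr (Or.inr (by simpa [h] using h'))
    · exact Or.inr (Or.inl (Or.inl (by rw [e]; linarith)))

theorem exists_forall_not_improves (L : List (ι → ℝ)) {K : Set (ι → ℝ)} (hK : IsCompact K)
    (hne : K.Nonempty) : ∃ μ ∈ K, ∀ ν ∈ K, ¬ Improves L (ν - μ) := by
  induction L generalizing K with
  | nil =>
    obtain ⟨μ, hμ⟩ := hne
    exact ⟨μ, hμ, fun _ _ h => h⟩
  | cons c L ih =>
    have hcont : Continuous fun μ : ι → ℝ => ∑ i, c i * μ i := by fun_prop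
    obtain ⟨μ₀, hμ₀, hmin⟩ := hK.exists_isMinOn hne hcont.continuousOn
    have hK' : IsCompact (K ∩ {μ | ∑ i, c i * μ i = ∑ i, c i * μ₀ i}) :=
      hK.inter_right (isClosed_eq hcont continuous_const)
    obtain ⟨μ, ⟨hμK, hμ⟩, h⟩ := ih hK' ⟨μ₀, hμ₀, rfl⟩
    refine ⟨μ, hμK, fun ν hν himp => ?_⟩
    have e : ∑ i, c i * (ν - μ) i = ∑ i, c i * ν i - ∑ i, c i * μ₀ i := by
      rw [← show _ = _ from hμ, ← Finset.sum_sub_distrib]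
      exact Finset.sum_congr rfl fun i _ => by simp [mul_sub]
    rcases himp with h1 | ⟨h1, h2⟩
    · have := hmin hν
      simp only [Set.mem_ofPred_eq] at this
      linarith
    · exact h ν ⟨hν, by simp only [Set.mem_ofPred_eq]; linarith⟩ h2

/-- The given costs, followed by all coordinates to break ties. -/
noncomputable def withTieBreak [DecidableEq ι] (L : List (ι → ℝ)) : List (ι → ℝ) :=
  L ++ (Finset.univ : Finset ι).toList.map fun i => Pi.single i 1

theorem improves_withTieBreak [DecidableEq ι] (L : List (ι → ℝ)) {δ : ι → ℝ} (hδ : δ ≠ 0) :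
    Improves (withTieBreak L) δ ∨ Improves (withTieBreak L) (-δ) := by
  rcases improves_or_neg_or_forall (withTieBreak L) δ with h | h | h
  · exact Or.inl h
  · exact Or.inr h
  · refine absurd (funext fun i => ?_) hδ
    have := h (Pi.single i 1) (by simp [withTieBreak])
    simpa [Pi.single_apply] using this

variable [NormedAddCommGroup E] [NormedSpace ℝ E]

theorem exists_regular_cell [DecidableEq ι] (v : ι → E) (L : List (ι → ℝ)) {x : E}
    (hx : x ∈ convexHull ℝ (Set.range v)) :
    ∃ A, IsRegularSupport v L A ∧ x ∈ cell v A := by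
  have hK : IsCompact (stdSimplex ℝ ι ∩ {μ | ∑ i, μ i • v i = x}) :=
    (isCompact_stdSimplex ℝ ι).inter_right (isClosed_eq (by fun_prop) continuous_const)
  have hne : (stdSimplex ℝ ι ∩ {μ | ∑ i, μ i • v i = x}).Nonempty := by
    obtain ⟨μ, h0, h1, h2⟩ := mem_convexHull_range_iff.1 hx
    exact ⟨μ, ⟨h0, h1⟩, h2⟩
  obtain ⟨μ, ⟨⟨hμ0, hμ1⟩, hμx⟩, hmin⟩ := exists_forall_not_improves L hK hne
  refine ⟨Finset.univ.filter fun i => 0 < μ i, ?_, μ, by simp, fun i hi => ?_, hμ1, hμx⟩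
  · intro δ h0 h1 hnn himp
    obtain ⟨ε, hε, hεle⟩ : ∃ ε : ℝ, 0 < ε ∧ ∀ i, 0 ≤ μ i + ε * δ i := by
      have : ∀ i, ∀ᶠ ε : ℝ in nhdsWithin 0 (Set.Ioi 0), 0 ≤ μ i + ε * δ i := by
        intro i
        by_cases hi : 0 < μ i
        · have : Filter.Tendsto (fun ε : ℝ => μ i + ε * δ i) (nhdsWithin 0 (Set.Ioi 0))
              (nhds (μ i + 0 * δ i)) :=
            ((continuous_const.add (continuous_id.mul continuous_const)).tendsto 0).mono_left
              nhdsWithin_le_nhds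
          rw [zero_mul, add_zero] at this
          exact (this.eventually (lt_mem_nhds hi)).mono fun _ h => h.le
        · filter_upwards [self_mem_nhdsWithin] with ε hε
          have := hnn i (by simpa using hi)
          have := hμ0 i
          have := mul_nonneg (le_of_lt hε) (hnn i (by simpa using hi))
          linarith
      obtain ⟨ε, h1, h2⟩ := ((Filter.eventually_all.2 this).and self_mem_nhdsWithin).exists
      exact ⟨ε, h2, h1⟩
    refine hmin (μ + ε • δ) ⟨⟨fun i => by simpa using hεle i, ?_⟩, ?_⟩ (by
      simpa using himp.smul hε)
    · simp [Finset.sum_add_distrib, hμ1, ← Finset.mul_sum, h0]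
    · simp only [Set.mem_ofPred_eq] at hμx
      simp [add_smul, Finset.sum_add_distrib, hμx, mul_smul, ← Finset.smul_sum, h1]
  · exact le_antisymm (by simpa using hi) (hμ0 i)

theorem IsRegularSupport.eq_zero [DecidableEq ι] {v : ι → E} {L : List (ι → ℝ)} {A : Finset ι}
    (h : IsRegularSupport v (withTieBreak L) A) {δ : ι → ℝ} (h0 : ∑ i, δ i = 0)
    (h1 : ∑ i, δ i • v i = 0) (hA : ∀ i ∉ A, δ i = 0) : δ = 0 := by
  by_contra hne
  rcases improves_withTieBreak L hne with himp | himp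
  · exact h δ h0 h1 (fun i hi => (hA i hi).ge) himp
  · exact h (-δ) (by simp [h0]) (by simp [h1]) (fun i hi => by simp [hA i hi]) himp

theorem IsRegularSupport.not_improves_sub [DecidableEq ι] {v : ι → E} {L : List (ι → ℝ)} {A : Finset ι}
    (h : IsRegularSupport v (withTieBreak L) A) {f g : ι → ℝ} (h0 : ∑ i, f i = ∑ i, g i)
    (h1 : ∑ i, f i • v i = ∑ i, g i • v i) (hf : ∀ i ∉ A, f i = 0) (hg : ∀ i, 0 ≤ g i) :
    ¬ Improves L (g - f) := fun himp =>
  h (g - f) (by simp [h0]) (by simp [sub_smul, h1]) (fun i hi => by simp [hf i hi, hg i])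
    himp.append

theorem regular_cells_unique [DecidableEq ι] {v : ι → E} {L : List (ι → ℝ)} {A B : Finset ι}
    (hA : IsRegularSupport v (withTieBreak L) A) (hB : IsRegularSupport v (withTieBreak L) B) {x : E}
    (hxA : x ∈ cell v A) (hxB : x ∈ cell v B) : A = B := by
  obtain ⟨μ, hμA, hμA', hμ1, hμx⟩ := hxA
  obtain ⟨ν, hνB, hνB', hν1, hνx⟩ := hxB
  have hμ : ∀ i, 0 ≤ μ i := fun i => by
    by_cases h : i ∈ A
    · exact (hμA i h).le
    · exact (hμA' i h).ge
  have hν : ∀ i, 0 ≤ ν i := fun i => by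
    by_cases h : i ∈ B
    · exact (hνB i h).le
    · exact (hνB' i h).ge
  have hμν : ν - μ = 0 := by
    by_contra hne
    rcases improves_withTieBreak L hne with himp | himp
    · exact hA (ν - μ) (by simp [hμ1, hν1]) (by simp [sub_smul, hμx, hνx])
        (fun i hi => by simpa [hμA' i hi] using hν i) himp
    · exact hB (-(ν - μ)) (by simp [hμ1, hν1]) (by simp [sub_smul, hμx, hνx])
        (fun i hi => by simpa [hνB' i hi] using hμ i) himp
  have heq : ν = μ := sub_eq_zero.1 hμν
  subst heq
  ext i
  constructor
  · intro h
    by_contra h'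
    exact (hμA i h).ne' (hνB' i h')
  · intro h
    by_contra h'
    exact (hνB i h).ne' (hμA' i h')

theorem cell_subset_convexHull (v : ι → E) (A : Finset ι) :
    cell v A ⊆ convexHull ℝ (v '' A) := by
  rintro x ⟨μ, hμA, hμA', hμ1, rfl⟩
  rw [← Finset.sum_subset (Finset.subset_univ A) (fun i _ hi => by rw [hμA' i hi, zero_smul])]
  rw [← Finset.sum_subset (Finset.subset_univ A) (fun i _ hi => hμA' i hi)] at hμ1
  exact (convex_convexHull ℝ _).sum_mem (fun i hi => (hμA i hi).le) hμ1
    fun i hi => subset_convexHull ℝ _ ⟨i, hi, rfl⟩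

theorem cell_image_eq_openHull {κ : Type*} [Fintype κ] [DecidableEq ι] (v : ι → E) (e : κ → ι)
    (he : Function.Injective e) : cell v (Finset.univ.image e) = openHull (v ∘ e) := by
  ext x
  constructor
  · rintro ⟨μ, hμA, hμA', hμ1, rfl⟩
    refine ⟨μ ∘ e, fun k => hμA _ (by simp), ?_, ?_⟩
    · rw [← hμ1, ← Finset.sum_subset (Finset.subset_univ (Finset.univ.image e))
        (fun i _ hi => hμA' i hi), Finset.sum_image he.injOn]
      rfl
    · rw [← Finset.sum_subset (Finset.subset_univ (Finset.univ.image e))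
        (fun i _ hi => by rw [hμA' i hi, zero_smul]), Finset.sum_image he.injOn]
      rfl
  · rintro ⟨μ, hμ0, hμ1, rfl⟩
    have hext : ∀ k, Function.extend e μ 0 (e k) = μ k := fun k => he.extend_apply _ _ _
    have hout : ∀ i ∉ Finset.univ.image e, Function.extend e μ 0 i = 0 := fun i hi => by
      rw [Function.extend_apply']
      · rfl
      · simpa using hi
    refine ⟨Function.extend e μ 0, ?_, hout, ?_, ?_⟩
    · intro i hi
      obtain ⟨k, -, rfl⟩ := Finset.mem_image.1 hi
      rw [hext]; exact hμ0 k
    · rw [← hμ1, ← Finset.sum_subset (Finset.subset_univ (Finset.univ.image e))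
        (fun i _ hi => hout i hi), Finset.sum_image he.injOn]
      simp [hext]
    · rw [← Finset.sum_subset (Finset.subset_univ (Finset.univ.image e))
        (fun i _ hi => by rw [hout i hi, zero_smul]), Finset.sum_image he.injOn]
      simp [hext]

end RegularDecomposition

section Unimodular

variable {n : ℕ}

/-- The real vector with the given integer coordinates. -/
def castVec (z : Fin n → ℤ) : Fin n → ℝ := fun i => (z i : ℝ)

theorem castVec_injective : Function.Injective (castVec (n := n)) := fun x y h =>
  funext fun i => by have := congrFun h i; simpa [castVec] using this

theorem castVec_mulVec (M : Matrix (Fin n) (Fin n) ℤ) (z : Fin n → ℤ) :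
    castVec (M.mulVec z) = (M.map (Int.cast : ℤ → ℝ)).mulVec (castVec z) := by
  ext i
  simp [castVec, Matrix.mulVec, dotProduct]

theorem castVec_add (x y : Fin n → ℤ) : castVec (x + y) = castVec x + castVec y := by
  ext i; simp [castVec]

theorem isUnimodular_mulVec_add (M : Matrix (Fin n) (Fin n) ℤ) (hM : IsUnit M.det)
    (b : Fin n → ℤ) :
    IsUnimodular fun x => (M.map (Int.cast : ℤ → ℝ)).mulVec x + castVec b :=
  ⟨M, hM, b, fun _ => rfl⟩

theorem map_intCast_mul (A B : Matrix (Fin n) (Fin n) ℤ) :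
    (A * B).map (Int.cast : ℤ → ℝ) = A.map Int.cast * B.map Int.cast :=
  Matrix.map_mul (f := Int.castRingHom ℝ)

theorem IsUnimodular.comp {f g : (Fin n → ℝ) → (Fin n → ℝ)} (hf : IsUnimodular f)
    (hg : IsUnimodular g) : IsUnimodular (f ∘ g) := by
  obtain ⟨A, hA, a, hfa⟩ := hf
  obtain ⟨B, hB, b, hgb⟩ := hg
  refine ⟨A * B, by simpa using hA.mul hB, A.mulVec b + a, fun x => ?_⟩
  have h : castVec (A.mulVec b + a) = (A.map (Int.cast : ℤ → ℝ)).mulVec (castVec b) + castVec a := by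
    rw [castVec_add, castVec_mulVec]
  change f (g x) = _ + castVec (A.mulVec b + a)
  rw [hfa, hgb, map_intCast_mul, Matrix.mulVec_add, Matrix.mulVec_mulVec, h]
  exact add_assoc _ _ _

theorem IsUnimodular.exists_inverse {f : (Fin n → ℝ) → (Fin n → ℝ)} (hf : IsUnimodular f) :
    ∃ g, IsUnimodular g ∧ Function.LeftInverse g f ∧ Function.RightInverse g f := by
  obtain ⟨A, hA, a, hfa⟩ := hf
  have h1 : A⁻¹.map (Int.cast : ℤ → ℝ) * A.map Int.cast = 1 := by
    rw [← map_intCast_mul, Matrix.nonsing_inv_mul _ hA]; simp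
  have h2 : A.map (Int.cast : ℤ → ℝ) * A⁻¹.map Int.cast = 1 := by
    rw [← map_intCast_mul, Matrix.mul_nonsing_inv _ hA]; simp
  refine ⟨_, isUnimodular_mulVec_add A⁻¹ (Matrix.isUnit_nonsing_inv_det _ hA)
    (-(A⁻¹.mulVec a)), fun x => ?_, fun x => ?_⟩
  · have h3 : castVec (-(A⁻¹.mulVec a)) = -castVec (A⁻¹.mulVec a) := by ext; simp [castVec]
    beta_reduce
    rw [hfa, h3, castVec_mulVec, Matrix.mulVec_add, Matrix.mulVec_mulVec, h1, Matrix.one_mulVec]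
    exact add_neg_cancel_right _ _
  · have h3 : castVec (-(A⁻¹.mulVec a)) = -castVec (A⁻¹.mulVec a) := by ext; simp [castVec]
    rw [hfa, h3, castVec_mulVec, Matrix.mulVec_add, Matrix.mulVec_neg, Matrix.mulVec_mulVec,
      Matrix.mulVec_mulVec, h2, Matrix.one_mulVec, Matrix.one_mulVec]
    exact neg_add_cancel_right _ _

theorem IsUnimodular.injective {f : (Fin n → ℝ) → (Fin n → ℝ)} (hf : IsUnimodular f) :
    Function.Injective f := by
  obtain ⟨g, -, hg, -⟩ := hf.exists_inverse
  exact hg.injective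

theorem IsUnimodular.exists_affineEquiv {f : (Fin n → ℝ) → (Fin n → ℝ)} (hf : IsUnimodular f) :
    ∃ φ : (Fin n → ℝ) ≃ᵃ[ℝ] (Fin n → ℝ), ⇑φ = f := by
  obtain ⟨A, hA, a, hfa⟩ := hf
  have h1 : A⁻¹.map (Int.cast : ℤ → ℝ) * A.map Int.cast = 1 := by
    rw [← map_intCast_mul, Matrix.nonsing_inv_mul _ hA]; simp
  have h2 : A.map (Int.cast : ℤ → ℝ) * A⁻¹.map Int.cast = 1 := by
    rw [← map_intCast_mul, Matrix.mul_nonsing_inv _ hA]; simp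
  refine ⟨(Matrix.toLin'OfInv h1 h2).toAffineEquiv.trans
    (AffineEquiv.constVAdd ℝ _ (castVec a)), ?_⟩
  ext x i
  rw [hfa]
  exact add_comm (castVec a i) _

theorem IsUnimodular.exists_int {f : (Fin n → ℝ) → (Fin n → ℝ)} (hf : IsUnimodular f)
    (z : Fin n → ℤ) : ∃ z', f (castVec z) = castVec z' := by
  obtain ⟨A, hA, a, hfa⟩ := hf
  exact ⟨A.mulVec z + a, by rw [hfa, castVec_add, castVec_mulVec]; rfl⟩

theorem IsUnimodular.map_sum {f : (Fin n → ℝ) → (Fin n → ℝ)} (hf : IsUnimodular f)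
    {κ : Type*} [Fintype κ] {μ : κ → ℝ} (hμ : ∑ k, μ k = 1) (w : κ → Fin n → ℝ) :
    f (∑ k, μ k • w k) = ∑ k, μ k • f (w k) := by
  obtain ⟨A, hA, a, hfa⟩ := hf
  simp only [hfa, smul_add, Finset.sum_add_distrib, ← Finset.sum_smul, hμ, one_smul,
    Matrix.mulVec_sum, Matrix.mulVec_smul]

theorem IsUnimodular.image_openHull {f : (Fin n → ℝ) → (Fin n → ℝ)} (hf : IsUnimodular f)
    {κ : Type*} [Fintype κ] (w : κ → Fin n → ℝ) : f '' openHull w = openHull (f ∘ w) := by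
  ext x
  constructor
  · rintro ⟨_, ⟨μ, h0, h1, rfl⟩, rfl⟩
    exact ⟨μ, h0, h1, (hf.map_sum h1 w).symm⟩
  · rintro ⟨μ, h0, h1, rfl⟩
    exact ⟨_, ⟨μ, h0, h1, rfl⟩, hf.map_sum h1 w⟩

end Unimodular

section Good

/-- Twice the `j`-th vertex of the `k`-th standard half-unimodular simplex. Here `k / 2` is the
dimension, and the parity of `k` decides whether the simplex has a vertex in the lattice. -/
def stdVertex (k : ℕ) (j : Fin (k / 2 + 1)) : Fin 3 → ℤ := fun i =>
  (if (i : ℕ) + 1 = j then 1 else 0) + (if i = 2 then ((k % 2 : ℕ) : ℤ) else 0)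

/-- The `k`-th standard relatively open half-unimodular simplex. -/
def openStd (k : ℕ) : Set (Fin 3 → ℝ) :=
  openHull fun j : Fin (k / 2 + 1) => (1 / 2 : ℝ) • castVec (stdVertex k j)

/-- A set that is a finite disjoint union of unimodular copies of the first seven standard
relatively open half-unimodular simplices. -/
def Good (X : Set (Fin 3 → ℝ)) : Prop :=
  ∃ (ι : Type) (_ : Fintype ι) (k : ι → Fin 7) (f : ι → (Fin 3 → ℝ) → (Fin 3 → ℝ)),
    (∀ t, IsUnimodular (f t)) ∧
    Pairwise (Function.onFun Disjoint fun t => f t '' openStd (k t)) ∧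
    X = ⋃ t, f t '' openStd (k t)

theorem Good.iUnion {κ : Type} [Fintype κ] {X : κ → Set (Fin 3 → ℝ)} (h : ∀ a, Good (X a))
    (hd : Pairwise (Function.onFun Disjoint X)) : Good (⋃ a, X a) := by
  choose ι hι k f hf hdisj hX using h
  refine ⟨Σ a, ι a, inferInstance, fun t => k t.1 t.2, fun t => f t.1 t.2, fun t => hf _ _, ?_, ?_⟩
  · rintro ⟨a, s⟩ ⟨b, t⟩ hne
    by_cases hab : a = b
    · subst hab
      exact hdisj a fun hst => hne (congrArg _ hst)
    · refine (hd hab).mono ?_ ?_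
      · rw [hX a]; exact Set.subset_iUnion (fun t => f a t '' openStd (k a t)) s
      · rw [hX b]; exact Set.subset_iUnion (fun t => f b t '' openStd (k b t)) t
  · rw [Set.iUnion_sigma]
    exact Set.iUnion_congr hX

theorem Good.union {X Y : Set (Fin 3 → ℝ)} (hX : Good X) (hY : Good Y) (h : Disjoint X Y) :
    Good (X ∪ Y) := by
  rw [Set.union_eq_iUnion]
  refine Good.iUnion (fun b => by cases b <;> assumption) ?_
  rintro (_ | _) (_ | _) hne
  · exact absurd rfl hne
  · exact h.symm
  · exact h
  · exact absurd rfl hne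

theorem Good.image {X : Set (Fin 3 → ℝ)} (hX : Good X) {g : (Fin 3 → ℝ) → (Fin 3 → ℝ)}
    (hg : IsUnimodular g) : Good (g '' X) := by
  obtain ⟨ι, hι, k, f, hf, hd, rfl⟩ := hX
  refine ⟨ι, hι, k, fun t => g ∘ f t, fun t => hg.comp (hf t), fun s t hst => ?_, ?_⟩
  · simp only [Function.onFun, Set.image_comp]
    exact (Set.disjoint_image_iff hg.injective).2 (hd hst)
  · simp only [Set.image_iUnion, Set.image_comp]

theorem Good.of_image {X : Set (Fin 3 → ℝ)} {g : (Fin 3 → ℝ) → (Fin 3 → ℝ)}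
    (hg : IsUnimodular g) (hX : Good (g '' X)) : Good X := by
  obtain ⟨h, hh, hl, -⟩ := hg.exists_inverse
  have := hX.image hh
  rwa [← Set.image_comp, hl.comp_eq_id, Set.image_id] at this

theorem good_openStd_image (k : Fin 7) {f : (Fin 3 → ℝ) → (Fin 3 → ℝ)} (hf : IsUnimodular f) :
    Good (f '' openStd k) :=
  ⟨Unit, inferInstance, fun _ => k, fun _ => f, fun _ => hf, fun _ _ h => absurd rfl h,
    (Set.iUnion_const _).symm⟩

theorem good_openHull_of_matrix (k : Fin 7) (z : Fin ((k : ℕ) / 2 + 1) → Fin 3 → ℤ)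
    (M : Matrix (Fin 3) (Fin 3) ℤ) (hM : IsUnit M.det) (b : Fin 3 → ℤ)
    (h : ∀ j, z j = M.mulVec (stdVertex k j) + 2 • b) :
    Good (openHull fun j => (1 / 2 : ℝ) • castVec (z j)) := by
  have hf := isUnimodular_mulVec_add M hM b
  have := good_openStd_image k hf
  rw [openStd, hf.image_openHull] at this
  convert this using 3 with j
  have hb : castVec (2 • b) = (2 : ℝ) • castVec b := by ext i; simp [castVec]
  simp only [Function.comp_apply, h, castVec_add, castVec_mulVec, Matrix.mulVec_smul, smul_add, hb,
    smul_smul]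
  norm_num

/-- A set that is a union of cells of a regular decomposition is good if all these cells are. -/
theorem good_of_regular_cells {ι : Type} [Fintype ι] [DecidableEq ι] (v : ι → Fin 3 → ℝ)
    (L : List (ι → ℝ)) {X : Set (Fin 3 → ℝ)} (Q : Finset ι → Prop)
    (hX : X ⊆ convexHull ℝ (Set.range v))
    (hQ : ∀ A, ∀ x ∈ cell v A, x ∈ X ↔ Q A)
    (hgood : ∀ A, A.Nonempty → IsRegularSupport v (withTieBreak L) A → Q A → Good (cell v A)) :
    Good X := by
  classical
  have hne : ∀ A, ∀ x ∈ cell v A, A.Nonempty := by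
    rintro A x ⟨μ, -, h2, h3, -⟩
    by_contra hA
    rw [Finset.not_nonempty_iff_eq_empty] at hA
    subst hA
    simp [h2] at h3
  have hXeq : X = ⋃ A : {A : Finset ι // A.Nonempty ∧ IsRegularSupport v (withTieBreak L) A ∧ Q A},
      cell v A.1 := by
    ext x
    rw [Set.mem_iUnion]
    constructor
    · intro hx
      obtain ⟨A, hA, hxA⟩ := exists_regular_cell v (withTieBreak L) (hX hx)
      exact ⟨⟨A, hne A x hxA, hA, (hQ A x hxA).1 hx⟩, hxA⟩
    · rintro ⟨⟨A, _, _, hA⟩, hxA⟩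
      exact (hQ A x hxA).2 hA
  rw [hXeq]
  refine Good.iUnion (fun A => hgood _ A.2.1 A.2.2.1 A.2.2.2) fun A B hAB => ?_
  refine Set.disjoint_left.2 fun x hxA hxB => hAB (Subtype.ext ?_)
  exact regular_cells_unique A.2.2.1 B.2.2.1 hxA hxB

end Good

section Standard

theorem good_typeA {n : ℕ} (hn : n ≤ 3) (z : Fin (n + 1) → Fin 3 → ℤ) (m : Fin 3 → Fin 3 → ℤ)
    (hm : IsUnit (Matrix.det (Matrix.of m))) (b : Fin 3 → ℤ) (h0 : z 0 = 2 • b)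
    (h : ∀ j : Fin n, z j.succ = z 0 + m (j.castLE hn)) :
    Good (openHull fun j => (1 / 2 : ℝ) • castVec (z j)) := by
  rw [← Matrix.det_transpose] at hm
  interval_cases n
  · refine good_openHull_of_matrix 0 z _ hm b fun j => ?_
    fin_cases j
    · ext i; simp [h0, stdVertex, Matrix.mulVec, dotProduct]
  · refine good_openHull_of_matrix 2 z _ hm b fun j => ?_
    fin_cases j
    · ext i; simp [h0, stdVertex, Matrix.mulVec, dotProduct]
    · ext i; have := h 0; simp at this
      simp [this, h0, stdVertex, Matrix.mulVec, dotProduct]; ring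
  · refine good_openHull_of_matrix 4 z _ hm b fun j => ?_
    fin_cases j
    · ext i; simp [h0, stdVertex, Matrix.mulVec, dotProduct]
    · ext i; have := h 0; simp at this
      simp [this, h0, stdVertex, Matrix.mulVec, dotProduct]; ring
    · ext i; have := h 1; simp at this
      simp [this, h0, stdVertex, Matrix.mulVec, dotProduct, Fin.sum_univ_three]; ring
  · refine good_openHull_of_matrix 6 z _ hm b fun j => ?_
    fin_cases j
    · ext i; simp [h0, stdVertex, Matrix.mulVec, dotProduct]
    · ext i; have := h 0; simp at this
      simp [this, h0, stdVertex, Matrix.mulVec, dotProduct]; ring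
    · ext i; have := h 1; simp at this
      simp [this, h0, stdVertex, Matrix.mulVec, dotProduct, Fin.sum_univ_three]; ring
    · ext i; have := h 2; simp at this
      simp [this, h0, stdVertex, Matrix.mulVec, dotProduct, Fin.sum_univ_three]; ring

theorem good_typeN {n : ℕ} (hn : n ≤ 2) (z : Fin (n + 1) → Fin 3 → ℤ) (m : Fin 3 → Fin 3 → ℤ)
    (hm : IsUnit (Matrix.det (Matrix.of m))) (b : Fin 3 → ℤ) (h0 : z 0 = m 2 + 2 • b)
    (h : ∀ j : Fin n, z j.succ = z 0 + m (j.castLE (hn.trans (by norm_num)))) :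
    Good (openHull fun j => (1 / 2 : ℝ) • castVec (z j)) := by
  rw [← Matrix.det_transpose] at hm
  interval_cases n
  · refine good_openHull_of_matrix 1 z _ hm b fun j => ?_
    fin_cases j
    · ext i; simp [h0, stdVertex, Matrix.mulVec, dotProduct]
  · refine good_openHull_of_matrix 3 z _ hm b fun j => ?_
    fin_cases j
    · ext i; simp [h0, stdVertex, Matrix.mulVec, dotProduct]
    · ext i; have := h 0; simp at this
      simp [this, h0, stdVertex, Matrix.mulVec, dotProduct, Fin.sum_univ_three]; ring
  · refine good_openHull_of_matrix 5 z _ hm b fun j => ?_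
    fin_cases j
    · ext i; simp [h0, stdVertex, Matrix.mulVec, dotProduct]
    · ext i; have := h 0; simp at this
      simp [this, h0, stdVertex, Matrix.mulVec, dotProduct, Fin.sum_univ_three]; ring
    · ext i; have := h 1; simp at this
      simp [this, h0, stdVertex, Matrix.mulVec, dotProduct, Fin.sum_univ_three]; ring

end Standard

section Exchange

variable {S : Set (Fin 3 → ℤ)}

/-- A list of numbers whose first nonzero entry is negative. -/
def LexNeg : List ℝ → Prop
  | [] => False
  | a :: l => a < 0 ∨ (a = 0 ∧ LexNeg l)

/-- The lattice points of `S`, scaled by `1 / 2`. -/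
noncomputable def halfPoints (S : Set (Fin 3 → ℤ)) (z : S) : Fin 3 → ℝ := (1 / 2 : ℝ) • castVec z.1

theorem sum_pushforward {κ ι : Type*} [Fintype κ] [Fintype ι] [DecidableEq ι] {E : Type*}
    [AddCommGroup E] [Module ℝ E] (a : κ → ι) (α : κ → ℝ) (F : ι → E) :
    ∑ i, (∑ k, if a k = i then α k else 0) • F i = ∑ k, α k • F (a k) := by
  simp only [Finset.sum_smul, ite_smul, zero_smul]
  rw [Finset.sum_comm]
  simp

theorem sum_halfPoints {κ : Type*} [Fintype κ] (a : κ → S) (α : κ → ℝ) (i : Fin 3) :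
    (∑ k, α k • halfPoints S (a k)) i = (1 / 2) * ∑ k, α k * ((a k).1 i : ℝ) := by
  simp only [halfPoints, castVec, Finset.sum_apply, Pi.smul_apply, smul_eq_mul, Finset.mul_sum]
  exact Finset.sum_congr rfl fun k _ => by ring

variable [Fintype S]

/-- The sign of a nonnegative affine functional on a cell can be read off from its support. -/
theorem pos_on_cell_iff (c : Fin 3 → ℝ) (d : ℝ)
    (hc : ∀ z ∈ S, 0 ≤ ∑ i, c i * (z i : ℝ) + d) {A : Finset S} {x : Fin 3 → ℝ}
    (hx : x ∈ cell (halfPoints S) A) :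
    0 < ∑ i, c i * (2 * x i) + d ↔ ∃ a ∈ A, 0 < ∑ i, c i * (a.1 i : ℝ) + d := by
  obtain ⟨μ, h1, h2, h3, rfl⟩ := hx
  have e : ∑ i, c i * (2 * (∑ k, μ k • halfPoints S k) i) + d =
      ∑ k, μ k * (∑ i, c i * (k.1 i : ℝ) + d) := by
    simp only [sum_halfPoints, mul_add, Finset.sum_add_distrib, ← Finset.sum_mul, h3, one_mul]
    congr 1
    simp only [Finset.mul_sum]
    rw [Finset.sum_comm]
    exact Finset.sum_congr rfl fun k _ => Finset.sum_congr rfl fun i _ => by ring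
  have hμ : ∀ k, 0 ≤ μ k := fun k => by
    by_cases h : k ∈ A
    · exact (h1 k h).le
    · exact (h2 k h).ge
  have hn : ∀ k ∈ Finset.univ, 0 ≤ μ k * (∑ i, c i * (k.1 i : ℝ) + d) := fun k _ =>
    mul_nonneg (hμ k) (hc _ k.2)
  rw [e]
  constructor
  · intro hpos
    by_contra! hcon
    refine hpos.ne' (Finset.sum_eq_zero fun k _ => ?_)
    by_cases h : k ∈ A
    · rw [le_antisymm (hcon k h) (hc _ k.2), mul_zero]
    · rw [h2 k h, zero_mul]
  · rintro ⟨a, ha, hpos⟩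
    exact Finset.sum_pos' hn ⟨a, Finset.mem_univ _, mul_pos (h1 a ha) hpos⟩

variable [DecidableEq S]

theorem IsRegularSupport.exchange {L : List (S → ℝ)} {A : Finset S}
    (h : IsRegularSupport (halfPoints S) (withTieBreak L) A)
    {κ κ' : Type*} [Fintype κ] [Fintype κ'] (a : κ → S) (α : κ → ℝ) (b : κ' → S) (β : κ' → ℝ)
    (ha : ∀ k, a k ∈ A) (hβ : ∀ k, 0 ≤ β k) (h0 : ∑ k, α k = ∑ k, β k)
    (h1 : ∀ i, ∑ k, α k * ((a k).1 i : ℝ) = ∑ k, β k * ((b k).1 i : ℝ)) :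
    ¬ LexNeg (L.map fun c => ∑ k, β k * c (b k) - ∑ k, α k * c (a k)) := by
  have key := h.not_improves_sub (f := fun i => ∑ k, if a k = i then α k else 0)
    (g := fun i => ∑ k, if b k = i then β k else 0) ?_ ?_ ?_ ?_
  · intro hneg
    apply key
    clear h key
    induction L with
    | nil => exact hneg
    | cons c L ih =>
      have e : ∑ i, c i * ((fun i => ∑ k, if b k = i then β k else 0) -
          (fun i => ∑ k, if a k = i then α k else 0)) i =
          ∑ k, β k * c (b k) - ∑ k, α k * c (a k) := by
        have e1 := sum_pushforward a α c
        have e2 := sum_pushforward b β c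
        simp only [smul_eq_mul] at e1 e2
        rw [← e1, ← e2, ← Finset.sum_sub_distrib]
        exact Finset.sum_congr rfl fun i _ => by simp only [Pi.sub_apply]; ring
      rcases hneg with hneg | ⟨hz, hneg⟩
      · exact Or.inl (e ▸ hneg)
      · exact Or.inr ⟨e ▸ hz, ih hneg⟩
  · have e1 := sum_pushforward a α (fun _ => (1 : ℝ))
    have e2 := sum_pushforward b β (fun _ => (1 : ℝ))
    simp only [smul_eq_mul, mul_one] at e1 e2
    rw [e1, e2, h0]
  · rw [sum_pushforward, sum_pushforward]
    ext i
    rw [sum_halfPoints, sum_halfPoints, h1]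
  · intro i hi
    refine Finset.sum_eq_zero fun k _ => if_neg ?_
    rintro rfl
    exact hi (ha k)
  · intro i
    exact Finset.sum_nonneg fun k _ => by split_ifs; exacts [hβ k, le_rfl]

theorem IsRegularSupport.independent {L : List (S → ℝ)} {A : Finset S}
    (h : IsRegularSupport (halfPoints S) (withTieBreak L) A)
    {κ : Type*} [Fintype κ] (a : κ → S) (ha : ∀ k, a k ∈ A) (hinj : Function.Injective a)
    (μ : κ → ℝ) (h0 : ∑ k, μ k = 0) (h1 : ∀ i, ∑ k, μ k * ((a k).1 i : ℝ) = 0) : μ = 0 := by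
  classical
  have key := h.eq_zero (δ := fun i => ∑ k, if a k = i then μ k else 0) ?_ ?_ ?_
  · ext k
    have := congrFun key (a k)
    simpa [hinj.eq_iff] using this
  · have e1 := sum_pushforward a μ (fun _ => (1 : ℝ))
    simp only [smul_eq_mul, mul_one] at e1
    rw [e1, h0]
  · rw [sum_pushforward]
    ext i
    rw [sum_halfPoints, h1]
    simp
  · intro i hi
    refine Finset.sum_eq_zero fun k _ => if_neg ?_
    rintro rfl
    exact hi (ha k)

end Exchange

section LowerHalf

variable {p q : ℤ}

/-- The lattice points in the lower half of the second dilate of the tetrahedron with vertices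
`0`, `e₁`, `e₃` and `(p, q, 1)`. -/
def lowerPoints (p q : ℤ) : Set (Fin 3 → ℤ) :=
  {z | 0 ≤ z 1 ∧ z 1 ≤ q * z 2 ∧ 0 ≤ q * z 0 - p * z 1 ∧ q * z 0 - p * z 1 ≤ q * (2 - z 2) ∧
    0 ≤ z 2 ∧ z 2 ≤ 1}

theorem finite_lowerPoints (hq : 0 < q) : (lowerPoints p q).Finite := by
  refine (Set.finite_Icc (![-|p|, 0, 0] : Fin 3 → ℤ) ![|p| + 2, q, 1]).subset ?_
  rintro z ⟨h1, h2, h3, h4, h5, h6⟩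
  have hz1 : z 1 ≤ q := by nlinarith
  have ha := neg_abs_le p
  have hb := le_abs_self p
  have hc := abs_nonneg p
  have h7 : -|p| ≤ z 0 := by
    by_contra! h
    nlinarith [mul_nonneg h1 (by linarith : 0 ≤ |p| + p), mul_nonneg hc (by linarith : 0 ≤ q - z 1)]
  have h8 : z 0 ≤ |p| + 2 := by
    by_contra! h
    nlinarith [mul_nonneg h1 (by linarith : 0 ≤ |p| - p), mul_nonneg hc (by linarith : 0 ≤ q - z 1)]
  constructor <;> intro i <;> fin_cases i <;> simp <;> linarith

/-- The costs defining the decomposition of the lower half. -/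
noncomputable def lowerCosts (p q : ℤ) : List (lowerPoints p q → ℝ) :=
  [fun z => (z.1 1 : ℝ) ^ 2,
   fun z => if z.1 2 = 1 ∧ q * z.1 0 - p * z.1 1 = q then 1 else 0,
   fun z => if z.1 2 = 0 ∧ z.1 0 ≠ 1 then 1 else 0]

/-- A lattice point at the bottom of the lower half. -/
def bottomPoint (hq : 0 < q) (x : ℤ) (h0 : 0 ≤ x) (h2 : x ≤ 2) : lowerPoints p q :=
  ⟨![x, 0, 0], by
    refine ⟨by simp, by simp, by simp; positivity, ?_, by simp, by simp⟩
    simp; nlinarith⟩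

@[simp]
theorem bottomPoint_zero (hq : 0 < q) (x : ℤ) (h0 : 0 ≤ x) (h2 : x ≤ 2) :
    (bottomPoint (p := p) hq x h0 h2).1 0 = x := rfl

@[simp]
theorem bottomPoint_one (hq : 0 < q) (x : ℤ) (h0 : 0 ≤ x) (h2 : x ≤ 2) :
    (bottomPoint (p := p) hq x h0 h2).1 1 = 0 := rfl

@[simp]
theorem bottomPoint_two (hq : 0 < q) (x : ℤ) (h0 : 0 ≤ x) (h2 : x ≤ 2) :
    (bottomPoint (p := p) hq x h0 h2).1 2 = 0 := rfl

theorem eq_bottomPoint (hq : 0 < q) (z : lowerPoints p q) (hz : z.1 2 = 0) :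
    ∃ h0 h2, z = bottomPoint hq (z.1 0) h0 h2 := by
  obtain ⟨z, h1, h2, h3, h4, h5, h6⟩ := z
  simp only at hz
  rw [hz] at h2 h4
  have h7 : z 1 = 0 := by linarith
  rw [h7] at h3 h4
  refine ⟨by simp; nlinarith, by simp; nlinarith, ?_⟩
  apply Subtype.ext
  ext i
  fin_cases i <;> simp [bottomPoint, h7, hz]

theorem top_row_diff (hq : 0 < q) {u v : lowerPoints p q} (hu : u.1 2 = 1)
    (huv : u.1 1 = v.1 1) : u.1 0 - v.1 0 ≤ 1 := by
  have h1 := u.2.2.2.2.1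
  have h2 := v.2.2.2.1
  rw [hu, huv] at h1
  by_contra! h
  nlinarith

theorem exists_top_point (hq : 0 < q) (y : ℤ) (h0 : 0 ≤ y) (h1 : y ≤ q) :
    ∃ z : lowerPoints p q, z.1 2 = 1 ∧ z.1 1 = y := by
  have ha := Int.emod_nonneg (-(p * y)) hq.ne'
  have hb := Int.emod_lt_of_pos (-(p * y)) hq
  have hc := Int.mul_ediv_add_emod (-(p * y)) q
  refine ⟨⟨![-(-(p * y) / q), y, 1], ?_⟩, rfl, rfl⟩
  refine ⟨h0, by simpa using h1, ?_, ?_, by simp, by simp⟩ <;> simp <;> linarith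

variable {A : Finset (lowerPoints p q)} [Fintype (lowerPoints p q)] [DecidableEq (lowerPoints p q)]

theorem lower_not_both (hq : 0 < q)
    (hA : IsRegularSupport (halfPoints _) (withTieBreak (lowerCosts p q)) A)
    (h0 : bottomPoint hq 0 (by norm_num) (by norm_num) ∈ A)
    (h2 : bottomPoint hq 2 (by norm_num) (by norm_num) ∈ A) : False := by
  refine hA.exchange (κ := Fin 2) (κ' := Unit) ![bottomPoint hq 0 (by norm_num) (by norm_num),
    bottomPoint hq 2 (by norm_num) (by norm_num)] ![1, 1]
    (fun _ => bottomPoint hq 1 (by norm_num) (by norm_num)) (fun _ => 2) ?_ ?_ ?_ ?_ ?_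
  · intro k; fin_cases k <;> assumption
  · intro k; norm_num
  · norm_num
  · intro i; fin_cases i <;> norm_num [bottomPoint]
  · norm_num [lowerCosts, LexNeg]

theorem lower_no_row_pair (hq : 0 < q)
    (hA : IsRegularSupport (halfPoints _) (withTieBreak (lowerCosts p q)) A)
    (hb : bottomPoint hq 1 (by norm_num) (by norm_num) ∈ A) {u v : lowerPoints p q}
    (hu : u ∈ A) (hv : v ∈ A) (hu1 : u.1 2 = 1) (hv1 : v.1 2 = 1) (huv : u.1 1 = v.1 1) :
    u = v := by
  wlog hle : u.1 0 ≤ v.1 0 generalizing u v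
  · exact (this hv hu hv1 hu1 huv.symm (not_le.1 hle).le).symm
  by_contra hne
  have hlt : u.1 0 < v.1 0 := by
    refine lt_of_le_of_ne hle fun h => hne (Subtype.ext (funext fun i => ?_))
    fin_cases i
    exacts [h, huv, hu1.trans hv1.symm]
  have h1 := top_row_diff hq hv1 huv.symm
  have h01 : v.1 0 = u.1 0 + 1 := by omega
  have hu3 := u.2.2.2.1
  have hv4 := v.2.2.2.2.1
  rw [hv1, ← huv, h01] at hv4
  have hw : q * u.1 0 - p * u.1 1 = 0 := by linarith
  have hw' : q * v.1 0 - p * u.1 1 = q := by rw [h01]; linarith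
  refine hA.exchange (κ := Fin 2) (κ' := Fin 2) ![v, bottomPoint hq 1 (by norm_num) (by norm_num)]
    ![1, 1] ![u, bottomPoint hq 2 (by norm_num) (by norm_num)] ![1, 1] ?_ ?_ ?_ ?_ ?_
  · intro k; fin_cases k <;> assumption
  · intro k; fin_cases k <;> norm_num
  · norm_num
  · intro i; fin_cases i
    · simp [bottomPoint, h01]; ring
    · simp [bottomPoint, huv]
    · simp [bottomPoint, hu1, hv1]
  · norm_num [lowerCosts, LexNeg, hw, hw', ← huv, hu1, hv1, hq.ne, hq.ne']

theorem lower_height_diff (hq : 0 < q)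
    (hA : IsRegularSupport (halfPoints _) (withTieBreak (lowerCosts p q)) A)
    (hb : bottomPoint hq 1 (by norm_num) (by norm_num) ∈ A) {u v : lowerPoints p q}
    (hu : u ∈ A) (hv : v ∈ A) (hu1 : u.1 2 = 1) (hv1 : v.1 2 = 1) :
    v.1 1 - u.1 1 ≤ 1 := by
  by_contra! hlt
  have hu0 := u.2.1
  have hv0 := v.2.2.1
  rw [hv1] at hv0
  obtain ⟨s, hs2, hs1⟩ := exists_top_point (p := p) hq (u.1 1 + 1) (by omega) (by omega)
  obtain ⟨t, ht2, ht1⟩ := exists_top_point (p := p) hq (v.1 1 - 1) (by omega) (by omega)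
  have hlt' : (1 : ℝ) < v.1 1 - u.1 1 := by exact_mod_cast hlt
  obtain ⟨n, hn⟩ : ∃ n, n = s.1 0 + t.1 0 - u.1 0 - v.1 0 := ⟨_, rfl⟩
  have hs0 : (s.1 0 : ℝ) = n + u.1 0 + v.1 0 - t.1 0 := by
    have : s.1 0 = n + u.1 0 + v.1 0 - t.1 0 := by omega
    exact_mod_cast this
  rcases le_or_gt 0 n with h | h
  · have h' : (0 : ℝ) ≤ n := by exact_mod_cast h
    refine hA.exchange (κ := Fin 3) (κ' := Fin 3)
      ![u, v, bottomPoint hq 1 (by norm_num) (by norm_num)] ![1, 1, n]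
      ![s, t, bottomPoint hq 0 (by norm_num) (by norm_num)] ![1, 1, n] ?_ ?_ ?_ ?_ ?_
    · intro k; fin_cases k <;> assumption
    · intro k; fin_cases k <;> simp [h']
    · rfl
    · intro i; fin_cases i
      · simp [bottomPoint, Fin.sum_univ_three, hs0]; ring
      · simp [bottomPoint, Fin.sum_univ_three, hs1, ht1]
      · simp [bottomPoint, Fin.sum_univ_three, hu1, hv1, hs2, ht2]
    · left
      simp [Fin.sum_univ_three, bottomPoint, hs1, ht1]
      nlinarith
  · have h' : (0 : ℝ) ≤ -n := by exact_mod_cast (by omega : 0 ≤ -n)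
    refine hA.exchange (κ := Fin 3) (κ' := Fin 3)
      ![u, v, bottomPoint hq 1 (by norm_num) (by norm_num)] ![1, 1, -n]
      ![s, t, bottomPoint hq 2 (by norm_num) (by norm_num)] ![1, 1, -n] ?_ ?_ ?_ ?_ ?_
    · intro k; fin_cases k <;> assumption
    · intro k; fin_cases k
      · norm_num
      · norm_num
      · exact h'
    · rfl
    · intro i; fin_cases i
      · simp [bottomPoint, Fin.sum_univ_three, hs0]; ring
      · simp [bottomPoint, Fin.sum_univ_three, hs1, ht1]
      · simp [bottomPoint, Fin.sum_univ_three, hu1, hv1, hs2, ht2]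
    · left
      simp [Fin.sum_univ_three, bottomPoint, hs1, ht1]
      nlinarith

/-- If a convex combination of three points at the top of a regular cell is a lattice point, then
all points with nonzero coefficient lie in the same row. -/
theorem top_jensen
    (hA : IsRegularSupport (halfPoints _) (withTieBreak (lowerCosts p q)) A)
    {c : Fin 3 → lowerPoints p q} (hc : ∀ i, c i ∈ A) (hc1 : ∀ i, (c i).1 2 = 1) {α : Fin 3 → ℤ}
    (hα : ∀ i, 0 ≤ α i) {D x y : ℤ} (hD : 0 < D) (hαD : α 0 + α 1 + α 2 = D)
    (hx : D * x = α 0 * (c 0).1 0 + α 1 * (c 1).1 0 + α 2 * (c 2).1 0)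
    (hy : D * y = α 0 * (c 0).1 1 + α 1 * (c 1).1 1 + α 2 * (c 2).1 1) (i j : Fin 3) :
    α i * α j * ((c i).1 1 - (c j).1 1) ^ 2 = 0 := by
  have hmem : ![x, y, 1] ∈ lowerPoints p q := by
    have h := fun i => (c i).2
    simp only [lowerPoints, Set.mem_ofPred_eq, hc1] at h
    have hcomb : ∀ f : Fin 3 → ℤ, (∀ i, 0 ≤ f i) → 0 ≤ α 0 * f 0 + α 1 * f 1 + α 2 * f 2 :=
      fun f hf => add_nonneg (add_nonneg (mul_nonneg (hα _) (hf _)) (mul_nonneg (hα _) (hf _)))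
        (mul_nonneg (hα _) (hf _))
    have h1 := hcomb _ fun i => (h i).1
    have h2 := hcomb (fun i => q * 1 - (c i).1 1) fun i => sub_nonneg.2 (h i).2.1
    have h3 := hcomb _ fun i => (h i).2.2.1
    have h4 := hcomb (fun i => q * (2 - 1) - (q * (c i).1 0 - p * (c i).1 1))
      fun i => sub_nonneg.2 (h i).2.2.2.1
    refine ⟨?_, ?_, ?_, ?_, by simp, by simp⟩ <;> simp
    · exact nonneg_of_mul_nonneg_right (by rw [hy]; exact h1) hD
    · refine sub_nonneg.1 (nonneg_of_mul_nonneg_right (a := D) ?_ hD)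
      rw [mul_sub, hy, ← hαD]; linarith
    · refine sub_nonneg.1 (nonneg_of_mul_nonneg_right (a := D) ?_ hD)
      have : D * (q * x - p * y) = q * (D * x) - p * (D * y) := by ring
      rw [this, hx, hy]; linarith
    · have : 0 ≤ D * (q + p * y - q * x) := by
        have : D * (q + p * y - q * x) = D * q + p * (D * y) - q * (D * x) := by ring
        rw [this, hx, hy, ← hαD]; linarith
      have := nonneg_of_mul_nonneg_right this hD
      linarith
  have key := hA.exchange c (fun i => (α i : ℝ)) (fun _ : Unit => ⟨_, hmem⟩) (fun _ => (D : ℝ)) hc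
    (fun _ => by exact_mod_cast hD.le) (by simp [Fin.sum_univ_three, ← hαD]) ?_
  swap
  · intro i; fin_cases i
    · have : (D * x : ℝ) = α 0 * (c 0).1 0 + α 1 * (c 1).1 0 + α 2 * (c 2).1 0 := by
        exact_mod_cast hx
      simp [Fin.sum_univ_three, this]
    · have : (D * y : ℝ) = α 0 * (c 0).1 1 + α 1 * (c 1).1 1 + α 2 * (c 2).1 1 := by
        exact_mod_cast hy
      simp [Fin.sum_univ_three, this]
    · simp [Fin.sum_univ_three, hc1, ← hαD]
  have h1 : α 0 * (c 0).1 1 ^ 2 + α 1 * (c 1).1 1 ^ 2 + α 2 * (c 2).1 1 ^ 2 ≤ D * y ^ 2 := by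
    by_contra! hlt
    have hlt' : (D * y ^ 2 : ℝ) <
        α 0 * (c 0).1 1 ^ 2 + α 1 * (c 1).1 1 ^ 2 + α 2 * (c 2).1 1 ^ 2 := by exact_mod_cast hlt
    refine key (Or.inl ?_)
    simp [Fin.sum_univ_three]
    linarith
  have hs : ∀ i j, 0 ≤ α i * α j * ((c i).1 1 - (c j).1 1) ^ 2 := fun i j =>
    mul_nonneg (mul_nonneg (hα i) (hα j)) (sq_nonneg _)
  have h2 : α 0 * α 1 * ((c 0).1 1 - (c 1).1 1) ^ 2 + α 0 * α 2 * ((c 0).1 1 - (c 2).1 1) ^ 2 +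
      α 1 * α 2 * ((c 1).1 1 - (c 2).1 1) ^ 2 ≤ 0 := by
    have h3 := mul_le_mul_of_nonneg_left h1 hD.le
    have h4 : D * (D * y ^ 2) = (D * y) ^ 2 := by ring
    rw [h4, hy, ← hαD] at h3
    linarith
  have h01 := hs 0 1
  have h02 := hs 0 2
  have h12 := hs 1 2
  fin_cases i <;> fin_cases j <;> simp only [Fin.zero_eta, Fin.mk_one, Fin.reduceFinMk,
    sub_self, ne_eq, OfNat.ofNat_ne_zero, not_false_eq_true, zero_pow, mul_zero] <;> linarith

end LowerHalf

section LowerCells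

variable {p q : ℤ} {A : Finset (lowerPoints p q)} [Fintype (lowerPoints p q)]
  [DecidableEq (lowerPoints p q)]

theorem top_pair_coprime (hq : 0 < q)
    (hA : IsRegularSupport (halfPoints _) (withTieBreak (lowerCosts p q)) A)
    {u v : lowerPoints p q} (hu : u ∈ A) (hv : v ∈ A) (hu1 : u.1 2 = 1) (hv1 : v.1 2 = 1)
    (hne : u ≠ v) : IsCoprime (v.1 0 - u.1 0) (v.1 1 - u.1 1) := by
  have hne' : ¬ (v.1 0 - u.1 0 = 0 ∧ v.1 1 - u.1 1 = 0) := by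
    rintro ⟨h0, h1⟩
    refine hne (Subtype.ext (funext fun i => ?_))
    fin_cases i
    exacts [(sub_eq_zero.1 h0).symm, (sub_eq_zero.1 h1).symm, hu1.trans hv1.symm]
  rw [Int.isCoprime_iff_gcd_eq_one]
  obtain ⟨g, hg⟩ : ∃ g, Int.gcd (v.1 0 - u.1 0) (v.1 1 - u.1 1) = g := ⟨_, rfl⟩
  obtain ⟨x, hx⟩ : (g : ℤ) ∣ v.1 0 - u.1 0 := hg ▸ Int.gcd_dvd_left _ _
  obtain ⟨y, hy⟩ : (g : ℤ) ∣ v.1 1 - u.1 1 := hg ▸ Int.gcd_dvd_right _ _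
  rw [hg]
  by_contra hg1
  have hg0 : g ≠ 0 := by
    rintro rfl
    exact hne' (by simpa using Int.gcd_eq_zero_iff.1 hg)
  have hg2 : (2 : ℤ) ≤ g := by omega
  have := top_jensen hA (c := ![u, v, u]) (by intro i; fin_cases i <;> assumption)
    (by intro i; fin_cases i <;> assumption) (α := ![g - 1, 1, 0])
    (by intro i; fin_cases i <;> simp; omega) (D := g) (x := u.1 0 + x) (y := u.1 1 + y)
    (by omega) (by simp) (by simp; linarith) (by simp; linarith) 0 1
  simp at this
  rcases this with h | h
  · omega
  · have huv : u.1 1 = v.1 1 := sub_eq_zero.1 h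
    have h1 := top_row_diff hq hu1 huv
    have h2 := top_row_diff hq hv1 huv.symm
    refine hne' ⟨Int.eq_zero_of_abs_lt_dvd ⟨x, hx⟩ ?_, by rw [huv, sub_self]⟩
    rw [abs_lt]
    constructor <;> omega

theorem top_triangle_det_le (hq : 0 < q)
    (hA : IsRegularSupport (halfPoints _) (withTieBreak (lowerCosts p q)) A)
    {c : Fin 3 → lowerPoints p q} (hc : ∀ i, c i ∈ A) (hc1 : ∀ i, (c i).1 2 = 1)
    (hne : c 0 ≠ c 1) :
    ((c 1).1 0 - (c 0).1 0) * ((c 2).1 1 - (c 0).1 1) -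
      ((c 1).1 1 - (c 0).1 1) * ((c 2).1 0 - (c 0).1 0) ≤ 1 := by
  obtain ⟨s, t, hst⟩ := top_pair_coprime hq hA (hc 0) (hc 1) (hc1 0) (hc1 1) hne
  obtain ⟨D, hD⟩ : ∃ D, D = ((c 1).1 0 - (c 0).1 0) * ((c 2).1 1 - (c 0).1 1) -
      ((c 1).1 1 - (c 0).1 1) * ((c 2).1 0 - (c 0).1 0) := ⟨_, rfl⟩
  rw [← hD]
  by_contra! hD2
  have hrow : ∀ i j, (c i).1 1 = (c j).1 1 → (c i).1 0 - (c j).1 0 ≤ 1 := fun i j =>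
    top_row_diff hq (hc1 i)
  obtain ⟨u0, hu0⟩ : ∃ u0, u0 = (c 1).1 0 - (c 0).1 0 := ⟨_, rfl⟩
  obtain ⟨u1, hu1⟩ : ∃ u1, u1 = (c 1).1 1 - (c 0).1 1 := ⟨_, rfl⟩
  obtain ⟨v0, hv0⟩ : ∃ v0, v0 = (c 2).1 0 - (c 0).1 0 := ⟨_, rfl⟩
  obtain ⟨v1, hv1⟩ : ∃ v1, v1 = (c 2).1 1 - (c 0).1 1 := ⟨_, rfl⟩
  rw [← hu0, ← hu1, ← hv0, ← hv1] at hD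
  rw [← hu0, ← hu1] at hst
  obtain ⟨a, ha⟩ : ∃ a, a = s * v0 + t * v1 := ⟨_, rfl⟩
  have e0 : v0 = a * u0 - D * t := by rw [ha, hD]; linear_combination (-v0) * hst
  have e1 : v1 = a * u1 + D * s := by rw [ha, hD]; linear_combination (-v1) * hst
  have hb0 := Int.emod_nonneg (-a) (by omega : D ≠ 0)
  have hb1 := Int.emod_lt_of_pos (-a) (by omega : 0 < D)
  have hb := Int.mul_ediv_add_emod (-a) D
  obtain ⟨x, hx⟩ : ∃ x, x = -(-a / D) := ⟨_, rfl⟩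
  obtain ⟨b, hb'⟩ : ∃ b, b = -a % D := ⟨_, rfl⟩
  rw [← hb'] at hb0 hb1 hb
  have hxb : D * x = a + b := by rw [hx]; linear_combination -hb
  have key := top_jensen hA hc hc1 (α := ![D - 1 - b, b, 1])
    (by intro i; fin_cases i <;> simp <;> omega) (D := D) (x := (c 0).1 0 + x * u0 - t)
    (y := (c 0).1 1 + x * u1 + s) (by omega) (by simp)
    (by simp; linear_combination u0 * hxb - e0 + b * hu0 + hv0)
    (by simp; linear_combination u1 * hxb - e1 + b * hu1 + hv1)
  have k01 := key 0 1
  have k02 := key 0 2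
  have k12 := key 1 2
  simp [sub_eq_zero] at k01 k02 k12
  have nz : ∀ m, D ∣ m → -1 ≤ m → m ≤ 1 → m = 0 := fun m h1 h2 h3 =>
    Int.eq_zero_of_abs_lt_dvd h1 (abs_lt.2 (by omega))
  rcases k02 with h02 | h02
  · have hbD : b = D - 1 := by omega
    have h12 : (c 1).1 1 = (c 2).1 1 := by
      rcases k12 with h | h
      · omega
      · exact h
    have r1 := hrow 1 2 h12
    have r2 := hrow 2 1 h12.symm
    have hdvd : D ∣ v0 - u0 := ⟨(x - 1) * u0 - t, by
      linear_combination e0 - u0 * hxb - u0 * hbD⟩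
    have h0 := nz _ hdvd (by omega) (by omega)
    have h1 : v1 = u1 := by omega
    have h2 : v0 = u0 := by omega
    rw [h1, h2] at hD
    linarith
  · have h1 : v1 = 0 := by omega
    rcases k12 with hb2 | h12
    · have r1 := hrow 0 2 h02
      have r2 := hrow 2 0 h02.symm
      have hdvd : D ∣ v0 := ⟨x * u0 - t, by linear_combination e0 - u0 * hxb - u0 * hb2⟩
      have h0 := nz _ hdvd (by omega) (by omega)
      rw [h1, h0] at hD
      omega
    · have h2 : u1 = 0 := by omega
      rw [h1, h2] at hD
      omega

/-- The points at the top of a regular cell are part of an affine lattice basis. -/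
theorem exists_top_basis (hq : 0 < q)
    (hA : IsRegularSupport (halfPoints _) (withTieBreak (lowerCosts p q)) A) {n : ℕ} (hn : n ≤ 2)
    {e : Fin (n + 1) → lowerPoints p q} (he : Function.Injective e) (heA : ∀ j, e j ∈ A)
    (he1 : ∀ j, (e j).1 2 = 1) :
    ∃ d : Fin 2 → Fin 3 → ℤ, (∀ i, d i 2 = 0) ∧ IsUnit (d 0 0 * d 1 1 - d 0 1 * d 1 0) ∧
      ∀ j : Fin n, (e j.succ).1 = (e 0).1 + d (j.castLE hn) := by
  interval_cases n
  · exact ⟨![![1, 0, 0], ![0, 1, 0]], fun i => by fin_cases i <;> rfl, by simp, fun j => j.elim0⟩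
  · obtain ⟨s, t, hst⟩ := top_pair_coprime hq hA (heA 0) (heA 1) (he1 0) (he1 1)
      (he.ne (by decide))
    refine ⟨![(e 1).1 - (e 0).1, ![-t, s, 0]], fun i => ?_, ?_, fun j => ?_⟩
    · fin_cases i <;> simp [he1]
    · rw [Int.isUnit_iff]; left; simp; linear_combination hst
    · fin_cases j; simp
  · refine ⟨![(e 1).1 - (e 0).1, (e 2).1 - (e 0).1], fun i => ?_, ?_, fun j => ?_⟩
    · fin_cases i <;> simp [he1]
    · have h1 := top_triangle_det_le hq hA heA he1 (he.ne (by decide))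
      have h2 := top_triangle_det_le hq hA (c := ![e 0, e 2, e 1])
        (by intro i; fin_cases i <;> apply heA) (by intro i; fin_cases i <;> apply he1)
        (he.ne (by decide))
      have h3 : ((e 1).1 0 - (e 0).1 0) * ((e 2).1 1 - (e 0).1 1) -
          ((e 1).1 1 - (e 0).1 1) * ((e 2).1 0 - (e 0).1 0) ≠ 0 := by
        intro h0
        obtain ⟨s, t, hst⟩ := top_pair_coprime hq hA (heA 0) (heA 1) (he1 0) (he1 1)
          (he.ne (by decide))
        have h0' : (((e 1).1 0 - (e 0).1 0) * ((e 2).1 1 - (e 0).1 1) -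
          ((e 1).1 1 - (e 0).1 1) * ((e 2).1 0 - (e 0).1 0) : ℝ) = 0 := by exact_mod_cast h0
        obtain ⟨a, ha⟩ : ∃ a : ℝ, a = s * ((e 2).1 0 - (e 0).1 0) + t * ((e 2).1 1 - (e 0).1 1) :=
          ⟨_, rfl⟩
        have hst' : (s * ((e 1).1 0 - (e 0).1 0) + t * ((e 1).1 1 - (e 0).1 1) : ℝ) = 1 := by
          exact_mod_cast hst
        have := hA.independent e heA he ![a - 1, -a, 1]
          (by simp [Fin.sum_univ_three]; ring) (by
          intro i
          fin_cases i <;> simp [Fin.sum_univ_three, he1]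
          · rw [ha]; linear_combination (-t) * h0' - ((e 2).1 0 - (e 0).1 0) * hst'
          · rw [ha]; linear_combination s * h0' - ((e 2).1 1 - (e 0).1 1) * hst'
          · ring)
        simpa using congrFun this 2
      have h4 : -1 ≤ ((e 1).1 0 - (e 0).1 0) * ((e 2).1 1 - (e 0).1 1) -
          ((e 1).1 1 - (e 0).1 1) * ((e 2).1 0 - (e 0).1 0) := by
        simp at h2
        linarith
      exact Int.isUnit_iff.2 (by simp; omega)
    · fin_cases j <;> simp

theorem card_top_le (hA : IsRegularSupport (halfPoints _) (withTieBreak (lowerCosts p q)) A) {n : ℕ}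
    {e : Fin n → lowerPoints p q} (he : Function.Injective e) (heA : ∀ j, e j ∈ A)
    (he1 : ∀ j, (e j).1 2 = 1) : n ≤ 3 := by
  by_contra! hn
  have hli : ¬ LinearIndependent ℝ fun j => castVec (e j).1 := fun h => by
    have := h.fintype_card_le_finrank
    simp at this
    omega
  rw [Fintype.not_linearIndependent_iff] at hli
  obtain ⟨μ, h0, j, hj⟩ := hli
  have h1 : ∀ i, ∑ k, μ k * ((e k).1 i : ℝ) = 0 := fun i => by
    simpa [castVec] using congrFun h0 i
  have := hA.independent e heA he μ (by simpa [he1] using h1 2) h1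
  exact hj (congrFun this j)

end LowerCells

section LowerGood

variable {p q : ℤ} {A : Finset (lowerPoints p q)} [Fintype (lowerPoints p q)]
  [DecidableEq (lowerPoints p q)]

theorem good_cell_of_enum {S : Set (Fin 3 → ℤ)} [Fintype S] [DecidableEq S] {A : Finset S} {n : ℕ}
    (f : Fin n → S) (hf : Function.Injective f) (hA : ∀ a, a ∈ A ↔ ∃ j, f j = a)
    (h : Good (openHull fun j => (1 / 2 : ℝ) • castVec (f j).1)) : Good (cell (halfPoints S) A) := by
  have : A = Finset.univ.image f := by ext a; simp [hA]
  rw [this, cell_image_eq_openHull _ _ hf]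
  exact h

theorem exists_cons_iff {ι : Type*} {n : ℕ} {b : ι} {e : Fin n → ι} {P : ι → Prop} :
    (∃ j, P ((Fin.cons b e : Fin (n + 1) → ι) j)) ↔ P b ∨ ∃ j, P (e j) := by
  rw [Fin.exists_fin_succ]; simp

theorem cons_injective {ι : Type*} {n : ℕ} {b : ι} {e : Fin n → ι} (he : Function.Injective e)
    (hb : ∀ j, e j ≠ b) : Function.Injective (Fin.cons b e : Fin (n + 1) → ι) :=
  Fin.cons_injective_iff.2 ⟨fun ⟨j, hj⟩ => hb j hj, he⟩

theorem good_lower_cell (hq : 0 < q)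
    (hA : IsRegularSupport (halfPoints _) (withTieBreak (lowerCosts p q)) A)
    (htop : ∃ a ∈ A, a.1 2 = 1) : Good (cell (halfPoints _) A) := by
  obtain ⟨n, e, he, heA, he1, hsurj⟩ : ∃ (n : ℕ) (e : Fin (n + 1) → lowerPoints p q),
      Function.Injective e ∧ (∀ j, e j ∈ A) ∧ (∀ j, (e j).1 2 = 1) ∧
      ∀ a ∈ A, a.1 2 = 1 → ∃ j, e j = a := by
    have hpos : 0 < (A.filter fun a => a.1 2 = 1).card :=
      Finset.card_pos.2 (htop.imp fun a h => Finset.mem_filter.2 h)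
    obtain ⟨n, hn⟩ := Nat.exists_eq_succ_of_ne_zero hpos.ne'
    have E := Finset.equivFinOfCardEq hn
    refine ⟨n, fun j => (E.symm j).1, Subtype.val_injective.comp E.symm.injective,
      fun j => (Finset.mem_filter.1 (E.symm j).2).1, fun j => (Finset.mem_filter.1 (E.symm j).2).2,
      fun a h1 h2 => ⟨E ⟨a, Finset.mem_filter.2 ⟨h1, h2⟩⟩, by simp⟩⟩
  have hn : n ≤ 2 := by have := card_top_le hA he heA he1; omega
  have hbot : ∀ a ∈ A, (∃ j, e j = a) ∨ ∃ x h0 h2, a = bottomPoint hq x h0 h2 := by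
    intro a ha
    have h5 := a.2.2.2.2.2.1
    have h6 := a.2.2.2.2.2.2
    rcases (by omega : a.1 2 = 1 ∨ a.1 2 = 0) with h | h
    · exact Or.inl (hsurj a ha h)
    · exact Or.inr ⟨_, eq_bottomPoint hq a h⟩
  have hne : ∀ x h0 h2 j, e j ≠ bottomPoint hq x h0 h2 := fun x h0 h2 j h => by
    have := he1 j
    rw [h] at this
    simp at this
  have hside : ∃ ε : ℤ, (ε = 0 ∨ ε = 1) ∧ ∃ h0 h2, ∀ x h0' h2', bottomPoint hq x h0' h2' ∈ A →
      x = 1 ∨ bottomPoint (p := p) hq x h0' h2' = bottomPoint hq (2 * ε) h0 h2 := by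
    by_cases hb0 : bottomPoint hq 0 (by norm_num) (by norm_num) ∈ A
    · refine ⟨0, Or.inl rfl, by norm_num, by norm_num, fun x h0 h2 hx => ?_⟩
      obtain rfl | rfl | rfl : x = 0 ∨ x = 1 ∨ x = 2 := by omega
      · exact Or.inr rfl
      · exact Or.inl rfl
      · exact (lower_not_both hq hA hb0 hx).elim
    · refine ⟨1, Or.inr rfl, by norm_num, by norm_num, fun x h0 h2 hx => ?_⟩
      obtain rfl | rfl | rfl : x = 0 ∨ x = 1 ∨ x = 2 := by omega
      · exact (hb0 hx).elim
      · exact Or.inl rfl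
      · exact Or.inr rfl
  obtain ⟨ε, hε, h0, h2, hside⟩ := hside
  have hσ : IsUnit (1 - 2 * ε) := by rcases hε with rfl | rfl <;> simp
  have hε2 : (![2 * ε, 0, 0] : Fin 3 → ℤ) = 2 • ![ε, 0, 0] := by ext i; fin_cases i <;> simp
  obtain ⟨be, hbe⟩ : ∃ be, be = bottomPoint (p := p) hq (2 * ε) h0 h2 := ⟨_, rfl⟩
  obtain ⟨b1, hb1⟩ : ∃ b1, b1 = bottomPoint (p := p) hq 1 (by norm_num) (by norm_num) := ⟨_, rfl⟩
  have hbe' : be.1 = ![2 * ε, 0, 0] := by rw [hbe]; rfl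
  have hb1' : b1.1 = ![1, 0, 0] := by rw [hb1]; rfl
  have hbe0 : be.1 0 = 2 * ε := by rw [hbe']; rfl
  have hbe1 : be.1 1 = 0 := by rw [hbe']; rfl
  have hbe2 : be.1 2 = 0 := by rw [hbe']; rfl
  have hb10 : b1.1 0 = 1 := by rw [hb1']; rfl
  have hb11 : b1.1 1 = 0 := by rw [hb1']; rfl
  have hb12 : b1.1 2 = 0 := by rw [hb1']; rfl
  have hcases : ∀ a ∈ A, a = be ∨ a = b1 ∨ ∃ j, e j = a := by
    intro a ha
    rcases hbot a ha with h | ⟨x, h0', h2', rfl⟩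
    · exact Or.inr (Or.inr h)
    · rcases hside x h0' h2' ha with rfl | h
      · exact Or.inr (Or.inl hb1.symm)
      · exact Or.inl (h.trans hbe.symm)
  have hneb : ∀ j, e j ≠ b1 := fun j => hb1 ▸ hne _ _ _ j
  have hnee : ∀ j, e j ≠ be := fun j => hbe ▸ hne _ _ _ j
  have hbeb : b1 ≠ be := by
    intro h
    have h' := congrArg (fun z => z.1 0) h
    simp [hbe', hb1'] at h'
    omega
  by_cases hb1A : b1 ∈ A
  · have hn1 : n ≤ 1 ∧ ∃ d : Fin 3 → ℤ, d 2 = 0 ∧ IsUnit (d 1) ∧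
        ∀ j : Fin (n + 1), (j : ℕ) = 1 → (e j).1 = (e 0).1 + d := by
      have hdiff : ∀ i j, i ≠ j → (e i).1 1 - (e j).1 1 = 1 ∨ (e j).1 1 - (e i).1 1 = 1 := by
        intro i j hij
        have g1 := lower_height_diff hq hA (hb1 ▸ hb1A) (heA i) (heA j) (he1 i) (he1 j)
        have g2 := lower_height_diff hq hA (hb1 ▸ hb1A) (heA j) (heA i) (he1 j) (he1 i)
        have g3 : (e i).1 1 ≠ (e j).1 1 := fun h => hij <| he <|
          lower_no_row_pair hq hA (hb1 ▸ hb1A) (heA i) (heA j) (he1 i) (he1 j) h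
        omega
      interval_cases n
      · exact ⟨by norm_num, ![0, 1, 0], rfl, by simp, fun j hj => by omega⟩
      · refine ⟨le_rfl, (e 1).1 - (e 0).1, by simp [he1], ?_, fun j hj => ?_⟩
        · rw [Int.isUnit_iff]
          have := hdiff 0 1 (by decide)
          simp only [Pi.sub_apply]
          omega
        · obtain rfl : j = 1 := Fin.ext hj
          simp
      · have g1 := hdiff 0 1 (by decide)
        have g2 := hdiff 0 2 (by decide)
        have g3 := hdiff 1 2 (by decide)
        omega
    obtain ⟨hn1, d, hd2, hd1, hd⟩ := hn1
    by_cases hbeA : be ∈ A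
    · refine good_cell_of_enum (Fin.cons be (Fin.cons b1 e)) (cons_injective (cons_injective he hneb)
        ?_) ?_ ?_
      · intro j
        refine Fin.cases ?_ (fun j => ?_) j
        · simpa using hbeb
        · simpa using hnee j
      · intro a
        rw [exists_cons_iff (P := fun x => x = a), exists_cons_iff (P := fun x => x = a)]
        refine ⟨fun ha => (hcases a ha).imp Eq.symm (Or.imp_left Eq.symm), ?_⟩
        rintro (rfl | rfl | ⟨j, rfl⟩)
        exacts [hbeA, hb1A, heA j]
      · refine good_typeA (by omega) _ ![b1.1 - be.1, (e 0).1 - be.1,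
          (e 0).1 + d - be.1] ?_ ![ε, 0, 0] ?_ ?_
        · have : Matrix.det (Matrix.of ![b1.1 - be.1, (e 0).1 - be.1,
              (e 0).1 + d - be.1]) = (1 - 2 * ε) * (-d 1) := by
            rw [Matrix.det_fin_three]; simp [he1, hd2, hbe0, hbe1, hbe2, hb10, hb11, hb12]; ring
          rw [this]
          exact hσ.mul hd1.neg
        · simp only [Fin.cons_zero]
          rw [hbe', hε2]
        · intro j
          refine Fin.cases ?_ (fun j => ?_) j
          · exact (add_sub_cancel _ _).symm
          · refine Fin.cases ?_ (fun j => ?_) j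
            · exact (add_sub_cancel _ _).symm
            · have hj : (j : ℕ) = 0 := by omega
              have h1 := hd j.succ (by simp [hj])
              have h2 : (Fin.castLE (by omega) j.succ.succ : Fin 3) = 2 := by ext; simp
              rw [h2]
              simp only [Fin.cons_succ, Fin.cons_zero, h1]
              exact (add_sub_cancel _ _).symm
    · refine good_cell_of_enum (Fin.cons b1 e) (cons_injective he hneb) ?_ ?_
      · intro a
        rw [exists_cons_iff (P := fun x => x = a)]
        constructor
        · intro ha
          rcases hcases a ha with rfl | h | h
          exacts [(hbeA ha).elim, Or.inl h.symm, Or.inr h]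
        · rintro (rfl | ⟨j, rfl⟩)
          exacts [hb1A, heA j]
      · refine good_typeN (by omega) _ ![(e 0).1 - b1.1, (e 0).1 + d - b1.1,
          b1.1] ?_ 0 ?_ ?_
        · have : Matrix.det (Matrix.of ![(e 0).1 - b1.1, (e 0).1 + d - b1.1,
              b1.1]) = -d 1 := by
            rw [Matrix.det_fin_three]; simp [he1, hd2, hb10, hb11, hb12]
          rw [this]
          exact hd1.neg
        · simp
        · intro j
          refine Fin.cases ?_ (fun j => ?_) j
          · exact (add_sub_cancel _ _).symm
          · have hj : (j : ℕ) = 0 := by omega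
            have h1 := hd j.succ (by simp [hj])
            have h2 : (Fin.castLE (by omega) j.succ : Fin 3) = 1 := by ext; simp [hj]
            rw [h2]
            simp only [Fin.cons_succ, Fin.cons_zero, h1]
            exact (add_sub_cancel _ _).symm
  · obtain ⟨d, hd2, hdu, hd⟩ := exists_top_basis hq hA hn he heA he1
    by_cases hbeA : be ∈ A
    · refine good_cell_of_enum (Fin.cons be e) (cons_injective he hnee) ?_ ?_
      · intro a
        rw [exists_cons_iff (P := fun x => x = a)]
        constructor
        · intro ha
          rcases hcases a ha with h | rfl | h
          exacts [Or.inl h.symm, (hb1A ha).elim, Or.inr h]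
        · rintro (rfl | ⟨j, rfl⟩)
          exacts [hbeA, heA j]
      · refine good_typeA (by omega) _ ![(e 0).1 - be.1, (e 0).1 + d 0 - be.1,
          (e 0).1 + d 1 - be.1] ?_ ![ε, 0, 0] ?_ ?_
        · have : Matrix.det (Matrix.of ![(e 0).1 - be.1, (e 0).1 + d 0 - be.1,
              (e 0).1 + d 1 - be.1]) = d 0 0 * d 1 1 - d 0 1 * d 1 0 := by
            rw [Matrix.det_fin_three]; simp [he1, hd2, hbe0, hbe1, hbe2]; ring
          rw [this]
          exact hdu
        · simp only [Fin.cons_zero]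
          rw [hbe', hε2]
        · intro j
          refine Fin.cases ?_ (fun j => ?_) j
          · exact (add_sub_cancel _ _).symm
          · have h1 := hd j
            simp only [Fin.cons_succ, Fin.cons_zero]
            rw [h1]
            have hj : (j : ℕ) = 0 ∨ (j : ℕ) = 1 := by omega
            rcases hj with hj | hj
            · have h2 : (Fin.castLE (by omega) j.succ : Fin 3) = 1 := by ext; simp [hj]
              have h3 : (Fin.castLE hn j : Fin 2) = 0 := by ext; simp [hj]
              rw [h2, h3]
              exact (add_sub_cancel _ _).symm
            · have h2 : (Fin.castLE (by omega) j.succ : Fin 3) = 2 := by ext; simp [hj]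
              have h3 : (Fin.castLE hn j : Fin 2) = 1 := by ext; simp [hj]
              rw [h2, h3]
              exact (add_sub_cancel _ _).symm
    · refine good_cell_of_enum e he ?_ ?_
      · intro a
        constructor
        · intro ha
          rcases hcases a ha with rfl | rfl | h
          exacts [(hbeA ha).elim, (hb1A ha).elim, h]
        · rintro ⟨j, rfl⟩
          exact heA j
      · refine good_typeN hn _ ![d 0, d 1, (e 0).1] ?_ 0 (by simp) ?_
        · have : Matrix.det (Matrix.of ![d 0, d 1, (e 0).1]) = d 0 0 * d 1 1 - d 0 1 * d 1 0 := by
            rw [Matrix.det_fin_three]; simp [he1, hd2]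
          rw [this]
          exact hdu
        · intro j
          rw [hd j]
          have hj : (j : ℕ) = 0 ∨ (j : ℕ) = 1 := by omega
          rcases hj with hj | hj
          · have h2 : (Fin.castLE (by omega) j : Fin 3) = 0 := by ext; simp [hj]
            have h3 : (Fin.castLE hn j : Fin 2) = 0 := by ext; simp [hj]
            rw [h2, h3]; rfl
          · have h2 : (Fin.castLE (by omega) j : Fin 3) = 1 := by ext; simp [hj]
            have h3 : (Fin.castLE hn j : Fin 2) = 1 := by ext; simp [hj]
            rw [h2, h3]; rfl

end LowerGood

theorem IsUnimodular.surjective {n : ℕ} {f : (Fin n → ℝ) → (Fin n → ℝ)} (hf : IsUnimodular f) :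
    Function.Surjective f := by
  obtain ⟨g, -, -, hg⟩ := hf.exists_inverse
  exact hg.surjective

theorem Good.preimage {X : Set (Fin 3 → ℝ)} (hX : Good X) {g : (Fin 3 → ℝ) → (Fin 3 → ℝ)}
    (hg : IsUnimodular g) : Good (g ⁻¹' X) := by
  refine Good.of_image hg ?_
  rwa [Set.image_preimage_eq _ hg.surjective]

section Tetrahedron

/-- The open tetrahedron with vertices `0`, `e₁`, `e₃` and `(p, q, 1)`. -/
def openTet (p q : ℤ) : Set (Fin 3 → ℝ) :=
  {x | 0 < x 1 ∧ x 1 < q * x 2 ∧ 0 < q * x 0 - p * x 1 ∧ q * x 0 - p * x 1 < q * (1 - x 2)}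

variable {p q : ℤ}

theorem mem_convexHull_lowerPoints (hq : 0 < q) {x : Fin 3 → ℝ} (hx : x ∈ openTet p q)
    (hz : 2 * x 2 ≤ 1) : x ∈ convexHull ℝ (Set.range (halfPoints (lowerPoints p q))) := by
  obtain ⟨h1, h2, h3, h4⟩ := hx
  have hqr : (0 : ℝ) < q := by exact_mod_cast hq
  have h5 : 0 < x 2 := by nlinarith
  set C := convexHull ℝ (Set.range (halfPoints (lowerPoints p q))) with hC
  have hconv : Convex ℝ C := convex_convexHull ℝ _
  have hmem : ∀ z ∈ lowerPoints p q, (1 / 2 : ℝ) • castVec z ∈ C := fun z hz =>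
    subset_convexHull ℝ _ ⟨⟨z, hz⟩, rfl⟩
  have hbot : ∀ j : ℤ, 0 ≤ j → j ≤ 1 → (1 / 2 : ℝ) • castVec ![2 * j, 0, 0] ∈ C := fun j h0 h1 =>
    hmem _ (bottomPoint hq (2 * j) (by omega) (by omega)).2
  have htop : ∀ i j : ℤ, 0 ≤ i → i ≤ 1 → 0 ≤ j → j ≤ 1 →
      (1 / 2 : ℝ) • castVec ![i * p + j, i * q, 1] ∈ C := by
    intro i j hi0 hi1 hj0 hj1
    refine hmem _ ⟨?_, ?_, ?_, ?_, ?_, ?_⟩ <;> simp <;> nlinarith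
  obtain ⟨t, ht⟩ : ∃ t, t = 2 * x 2 := ⟨_, rfl⟩
  obtain ⟨η, hη⟩ : ∃ η, η = 2 * x 1 / (q * t) := ⟨_, rfl⟩
  obtain ⟨ω, hω⟩ : ∃ ω, ω = 2 * (q * x 0 - p * x 1) / (q * (2 - t)) := ⟨_, rfl⟩
  have ht0 : 0 < t := by linarith
  have ht2 : 0 < 2 - t := by linarith
  have hη0 : 0 ≤ η := by rw [hη]; positivity
  have hη1 : 0 ≤ 1 - η := by
    rw [hη, sub_nonneg, div_le_one (by positivity)]; rw [ht]; linarith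
  have hω0 : 0 ≤ ω := by rw [hω]; positivity
  have hω1 : 0 ≤ 1 - ω := by
    rw [hω, sub_nonneg, div_le_one (by positivity)]; rw [ht]; linarith
  have hP : ∀ j : ℤ, 0 ≤ j → j ≤ 1 → (1 - t) • ((1 / 2 : ℝ) • castVec ![2 * j, 0, 0]) +
      t • ((1 - η) • ((1 / 2 : ℝ) • castVec ![0 * p + j, 0 * q, 1]) +
        η • ((1 / 2 : ℝ) • castVec ![1 * p + j, 1 * q, 1])) ∈ C := fun j h0 h1 =>
    hconv (hbot j h0 h1) (hconv (htop 0 j le_rfl zero_le_one h0 h1)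
      (htop 1 j zero_le_one le_rfl h0 h1) hη1 hη0 (by ring)) (by linarith) ht0.le (by ring)
  have key := hconv (hP 0 le_rfl zero_le_one) (hP 1 zero_le_one le_rfl) hω1 hω0 (by ring)
  have e1 : q * t * η = 2 * x 1 := by rw [hη]; field_simp
  have e2 : q * (2 - t) * ω = 2 * (q * x 0 - p * x 1) := by rw [hω]; field_simp
  convert key using 1
  ext i
  fin_cases i
  · simp [castVec]
    apply mul_left_cancel₀ hqr.ne'
    linear_combination -(1 / 2) * e2 - (p / 2) * e1
  · simp [castVec]
    linear_combination -(1 / 2) * e1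
  · simp [castVec]
    linear_combination -(1 / 2) * ht

theorem mem_openTet_iff_of_cell [Fintype (lowerPoints p q)]
    {A : Finset (lowerPoints p q)} {x : Fin 3 → ℝ} (hx : x ∈ cell (halfPoints _) A) :
    x ∈ openTet p q ↔ (∃ a ∈ A, 0 < a.1 1) ∧ (∃ a ∈ A, a.1 1 < q * a.1 2) ∧
      (∃ a ∈ A, 0 < q * a.1 0 - p * a.1 1) ∧
      ∃ a ∈ A, q * a.1 0 - p * a.1 1 < q * (2 - a.1 2) := by
  have hc : ∀ a b c d : ℤ, (∀ z ∈ lowerPoints p q, 0 ≤ a * z 0 + b * z 1 + c * z 2 + d) →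
      (0 < a * (2 * x 0) + b * (2 * x 1) + c * (2 * x 2) + d ↔
        ∃ z ∈ A, 0 < a * z.1 0 + b * z.1 1 + c * z.1 2 + d) := by
    intro a b c d h
    have := pos_on_cell_iff ![(a : ℝ), b, c] d (fun z hz => by
      simp only [Fin.sum_univ_three]; simp; exact_mod_cast h z hz) hx
    simp only [Fin.sum_univ_three] at this
    simp [-Subtype.exists] at this
    exact_mod_cast this
  have h1 := hc 0 1 0 0 fun z ⟨a1, a2, a3, a4, a5, a6⟩ => by linarith
  have h2 := hc 0 (-1) q 0 fun z ⟨a1, a2, a3, a4, a5, a6⟩ => by linarith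
  have h3 := hc q (-p) 0 0 fun z ⟨a1, a2, a3, a4, a5, a6⟩ => by linarith
  have h4 := hc (-q) p (-q) (2 * q) fun z ⟨a1, a2, a3, a4, a5, a6⟩ => by linarith
  refine and_congr ?_ (and_congr ?_ (and_congr ?_ ?_))
  · refine Iff.trans ?_ (h1.trans (exists_congr fun z => and_congr_right fun _ => ?_))
    · push_cast; constructor <;> intro h <;> linarith
    · constructor <;> intro h <;> linarith
  · refine Iff.trans ?_ (h2.trans (exists_congr fun z => and_congr_right fun _ => ?_))
    · push_cast; constructor <;> intro h <;> linarith
    · constructor <;> intro h <;> linarith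
  · refine Iff.trans ?_ (h3.trans (exists_congr fun z => and_congr_right fun _ => ?_))
    · push_cast; constructor <;> intro h <;> linarith
    · constructor <;> intro h <;> linarith
  · refine Iff.trans ?_ (h4.trans (exists_congr fun z => and_congr_right fun _ => ?_))
    · push_cast; constructor <;> intro h <;> linarith
    · constructor <;> intro h <;> linarith

theorem lt_one_iff_of_cell [Fintype (lowerPoints p q)]
    {A : Finset (lowerPoints p q)} {x : Fin 3 → ℝ} (hx : x ∈ cell (halfPoints _) A) :
    2 * x 2 < 1 ↔ ∃ a ∈ A, a.1 2 < 1 := by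
  have := pos_on_cell_iff ![(0 : ℝ), 0, -1] 1 (fun z hz => by
    simp only [Fin.sum_univ_three]; simp; exact_mod_cast hz.2.2.2.2.2) hx
  simp only [Fin.sum_univ_three] at this
  simp [-Subtype.exists] at this
  exact_mod_cast this

theorem le_one_of_cell [Fintype (lowerPoints p q)]
    {A : Finset (lowerPoints p q)} {x : Fin 3 → ℝ} (hx : x ∈ cell (halfPoints _) A) :
    2 * x 2 ≤ 1 := by
  have hC : Convex ℝ {y : Fin 3 → ℝ | y 2 ≤ 1 / 2} :=
    convex_halfSpace_le (LinearMap.proj (R := ℝ) (φ := fun _ : Fin 3 => ℝ) 2).isLinear _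
  have := convexHull_min ?_ hC (cell_subset_convexHull _ _ hx)
  · have : x 2 ≤ 1 / 2 := this
    linarith
  · rintro _ ⟨a, -, rfl⟩
    have : (a.1 2 : ℝ) ≤ 1 := by exact_mod_cast a.2.2.2.2.2.2
    simp [halfPoints, castVec]
    linarith

theorem good_lower_openTet (hq : 0 < q) : Good (openTet p q ∩ {x | 2 * x 2 ≤ 1}) := by
  classical
  have := (finite_lowerPoints (p := p) hq).fintype
  refine good_of_regular_cells (halfPoints (lowerPoints p q)) (lowerCosts p q) _
    (fun x hx => mem_convexHull_lowerPoints hq hx.1 hx.2)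
    (fun A x hx => (and_iff_left (le_one_of_cell hx)).trans (mem_openTet_iff_of_cell hx))
    fun A _ hA ⟨⟨a, haA, ha⟩, _⟩ => good_lower_cell hq hA ⟨a, haA, ?_⟩
  obtain ⟨h1, h2, h3, h4, h5, h6⟩ := a.2
  nlinarith

theorem good_lower_openTet' (hq : 0 < q) : Good (openTet p q ∩ {x | 2 * x 2 < 1}) := by
  classical
  have := (finite_lowerPoints (p := p) hq).fintype
  refine good_of_regular_cells (halfPoints (lowerPoints p q)) (lowerCosts p q) _
    (fun x hx => mem_convexHull_lowerPoints hq hx.1 hx.2.le)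
    (fun A x hx => and_congr (mem_openTet_iff_of_cell hx) (lt_one_iff_of_cell hx))
    fun A _ hA ⟨⟨⟨a, haA, ha⟩, _⟩, _⟩ => good_lower_cell hq hA ⟨a, haA, ?_⟩
  obtain ⟨h1, h2, h3, h4, h5, h6⟩ := a.2
  nlinarith

theorem good_openTet (hq : 0 < q) (hpq : IsCoprime p q) : Good (openTet p q) := by
  obtain ⟨s, t, hst⟩ := hpq
  have hu := isUnimodular_mulVec_add !![s, t, 0; q, -p, 0; 0, 0, -1]
    (by rw [Matrix.det_fin_three]; simp; rw [show s * p + t * q = 1 from hst]; exact isUnit_one) ![0, 0, 1]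
  have hup := (good_lower_openTet' (p := s) hq).preimage hu
  have hst' : (s * p + t * q : ℝ) = 1 := by exact_mod_cast hst
  have heq : openTet p q = (openTet p q ∩ {x | 2 * x 2 ≤ 1}) ∪
      (fun x => (!![s, t, 0; q, -p, 0; 0, 0, -1].map (Int.cast : ℤ → ℝ)).mulVec x +
        castVec ![0, 0, 1]) ⁻¹' (openTet s q ∩ {x | 2 * x 2 < 1}) := by
    ext x
    have e1 : (q : ℝ) * (s * x 0 + t * x 1) - s * (q * x 0 - p * x 1) = x 1 := by
      linear_combination x 1 * hst'
    simp [openTet, castVec, Matrix.mulVec, dotProduct, Fin.sum_univ_three]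
    have e2 : (q : ℝ) * (s * x 0 + t * x 1) - s * (q * x 0 + -(p * x 1)) = x 1 := by
      linear_combination e1
    rw [e2]
    constructor
    · rintro ⟨h1, h2, h3, h4⟩
      rcases le_or_gt (2 * x 2) 1 with h | h
      · exact Or.inl ⟨⟨h1, h2, h3, h4⟩, h⟩
      · exact Or.inr ⟨⟨h3, by linarith, by linarith, h2⟩, by linarith⟩
    · rintro (h | ⟨⟨h1, h2, h3, h4⟩, h⟩)
      · exact h.1
      · exact ⟨by linarith, h4, h1, by linarith⟩
  rw [heq]
  refine (good_lower_openTet hq).union hup ?_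
  rw [Set.disjoint_left]
  rintro x ⟨-, h⟩ ⟨-, h'⟩
  simp [castVec, Matrix.mulVec, dotProduct, Fin.sum_univ_three] at h h'
  linarith

end Tetrahedron

section Split

variable {E : Type*} [AddCommGroup E] [Module ℝ E] {n : ℕ}

theorem openHull_comp_equiv {κ κ' : Type*} [Fintype κ] [Fintype κ'] (e : κ ≃ κ') (w : κ' → E) :
    openHull (w ∘ e) = openHull w := by
  ext x
  constructor
  · rintro ⟨μ, h0, h1, h2⟩
    refine ⟨μ ∘ e.symm, fun i => h0 _, ?_, ?_⟩
    · rw [← h1]; exact e.symm.sum_comp μ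
    · rw [← h2, ← e.sum_comp]; simp
  · rintro ⟨μ, h0, h1, h2⟩
    refine ⟨μ ∘ e, fun i => h0 _, ?_, ?_⟩
    · rw [← h1]; exact e.sum_comp μ
    · rw [← h2, ← e.sum_comp]; simp

theorem mem_openHull_cons {a : E} {r : Fin n → E} {x : E} :
    x ∈ openHull (Fin.cons a r : Fin (n + 1) → E) ↔
      ∃ (α : ℝ) (ν : Fin n → ℝ), 0 < α ∧ (∀ i, 0 < ν i) ∧ α + ∑ i, ν i = 1 ∧
        α • a + ∑ i, ν i • r i = x := by
  constructor
  · rintro ⟨μ, h0, h1, h2⟩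
    rw [Fin.sum_univ_succ] at h1 h2
    exact ⟨μ 0, fun i => μ i.succ, h0 _, fun i => h0 _, h1, by simpa using h2⟩
  · rintro ⟨α, ν, hα, hν, h1, h2⟩
    refine ⟨Fin.cons α ν, fun i => ?_, ?_, ?_⟩
    · refine Fin.cases ?_ (fun i => ?_) i
      · simpa using hα
      · simpa using hν i
    · rw [Fin.sum_univ_succ]; simpa using h1
    · rw [Fin.sum_univ_succ]; simpa using h2

theorem mem_openHull_cons_cons {a b : E} {r : Fin n → E} {x : E} :
    x ∈ openHull (Fin.cons a (Fin.cons b r : Fin (n + 1) → E) : Fin (n + 2) → E) ↔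
      ∃ (α β : ℝ) (ν : Fin n → ℝ), 0 < α ∧ 0 < β ∧ (∀ i, 0 < ν i) ∧ α + β + ∑ i, ν i = 1 ∧
        α • a + β • b + ∑ i, ν i • r i = x := by
  constructor
  · rintro ⟨μ, h0, h1, h2⟩
    rw [Fin.sum_univ_succ, Fin.sum_univ_succ, ← add_assoc] at h1 h2
    exact ⟨μ 0, μ 1, fun i => μ i.succ.succ, h0 _, h0 _, fun i => h0 _, h1, by simpa using h2⟩
  · rintro ⟨α, β, ν, hα, hβ, hν, h1, h2⟩
    refine mem_openHull_cons.2 ⟨α, Fin.cons β ν, hα, fun i => ?_, ?_, ?_⟩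
    · refine Fin.cases ?_ (fun i => ?_) i
      · simpa using hβ
      · simpa using hν i
    · rw [Fin.sum_univ_succ, ← add_assoc]; simpa using h1
    · rw [Fin.sum_univ_succ, ← add_assoc]; simpa using h2

theorem Good.congr_openHull {κ : Type*} [Fintype κ] {w w' : κ → Fin 3 → ℝ} (h : Good (openHull w))
    (e : ∀ j, w j = w' j) : Good (openHull w') := by
  rwa [← funext e]

/-- Cutting an open simplex at the midpoint of one of its edges. -/
theorem Good.split {a b m : Fin 3 → ℝ} {r : Fin n → Fin 3 → ℝ} (hm : m = (1 / 2 : ℝ) • (a + b))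
    (φ : (Fin 3 → ℝ) →ₗ[ℝ] ℝ) (d : ℝ) (ha : φ a = d + 1) (hb : φ b = d - 1) (hr : ∀ i, φ (r i) = d)
    (h1 : Good (openHull (Fin.cons a (Fin.cons m r : Fin (n + 1) → _) : Fin (n + 2) → _)))
    (h2 : Good (openHull (Fin.cons b (Fin.cons m r : Fin (n + 1) → _) : Fin (n + 2) → _)))
    (h3 : Good (openHull (Fin.cons m r : Fin (n + 1) → _))) :
    Good (openHull (Fin.cons a (Fin.cons b r : Fin (n + 1) → _) : Fin (n + 2) → _)) := by
  have hmd : φ m = d := by rw [hm, map_smul, map_add, ha, hb]; simp; ring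
  have p1 : ∀ x ∈ openHull (Fin.cons a (Fin.cons m r : Fin (n + 1) → _) : Fin (n + 2) → _),
      d < φ x := by
    intro x hx
    obtain ⟨α, β, ν, hα, hβ, hν, e1, rfl⟩ := mem_openHull_cons_cons.1 hx
    simp only [map_add, map_sum, map_smul, ha, hmd, hr, smul_eq_mul, ← Finset.sum_mul]
    linear_combination hα - d * e1
  have p2 : ∀ x ∈ openHull (Fin.cons b (Fin.cons m r : Fin (n + 1) → _) : Fin (n + 2) → _),
      φ x < d := by
    intro x hx
    obtain ⟨α, β, ν, hα, hβ, hν, e1, rfl⟩ := mem_openHull_cons_cons.1 hx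
    simp only [map_add, map_sum, map_smul, hb, hmd, hr, smul_eq_mul, ← Finset.sum_mul]
    linear_combination hα + d * e1
  have p3 : ∀ x ∈ openHull (Fin.cons m r : Fin (n + 1) → _), φ x = d := by
    intro x hx
    obtain ⟨α, ν, hα, hν, e1, rfl⟩ := mem_openHull_cons.1 hx
    simp only [map_add, map_sum, map_smul, hmd, hr, smul_eq_mul, ← Finset.sum_mul]
    linear_combination d * e1
  have heq : openHull (Fin.cons a (Fin.cons b r : Fin (n + 1) → _) : Fin (n + 2) → _) =
      openHull (Fin.cons a (Fin.cons m r : Fin (n + 1) → _) : Fin (n + 2) → _) ∪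
        openHull (Fin.cons b (Fin.cons m r : Fin (n + 1) → _) : Fin (n + 2) → _) ∪
        openHull (Fin.cons m r : Fin (n + 1) → _) := by
    ext x
    rw [Set.mem_union, Set.mem_union, mem_openHull_cons_cons, mem_openHull_cons_cons,
      mem_openHull_cons_cons, mem_openHull_cons]
    constructor
    · rintro ⟨α, β, ν, hα, hβ, hν, e1, rfl⟩
      rcases lt_trichotomy α β with h | h | h
      · refine Or.inl (Or.inr ⟨β - α, 2 * α, ν, by linarith, by linarith, hν, by linarith, ?_⟩)
        rw [hm]; module
      · refine Or.inr ⟨2 * α, ν, by linarith, hν, by linarith, ?_⟩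
        rw [hm, h]; module
      · refine Or.inl (Or.inl ⟨α - β, 2 * β, ν, by linarith, by linarith, hν, by linarith, ?_⟩)
        rw [hm]; module
    · rintro ((⟨α, β, ν, hα, hβ, hν, e1, rfl⟩ | ⟨α, β, ν, hα, hβ, hν, e1, rfl⟩) |
        ⟨α, ν, hα, hν, e1, rfl⟩)
      · refine ⟨α + β / 2, β / 2, ν, by linarith, by linarith, hν, by linarith, ?_⟩
        rw [hm]; module
      · refine ⟨β / 2, α + β / 2, ν, by linarith, by linarith, hν, by linarith, ?_⟩
        rw [hm]; module
      · refine ⟨α / 2, α / 2, ν, by linarith, by linarith, hν, by linarith, ?_⟩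
        rw [hm]; module
  rw [heq]
  refine (h1.union h2 ?_).union h3 ?_
  · exact Set.disjoint_left.2 fun x hx hx' => lt_asymm (p1 x hx) (p2 x hx')
  · refine Set.disjoint_left.2 fun x hx hx' => ?_
    rcases hx with hx | hx
    · exact (p1 x hx).ne' (p3 x hx')
    · exact (p2 x hx).ne (p3 x hx')

end Split

section Standard

theorem good_open_segment : Good (openHull fun j => castVec ((![0, ![1, 0, 0]] :
    Fin 2 → Fin 3 → ℤ) j)) := by
  have h1 := good_typeA (n := 1) (by norm_num) ![0, ![1, 0, 0]] ![![1, 0, 0], ![0, 1, 0], ![0, 0, 1]]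
    (by simp [Matrix.det_fin_three]) 0 (by simp) (by intro j; fin_cases j; simp)
  have h2 := good_typeA (n := 1) (by norm_num) ![![2, 0, 0], ![1, 0, 0]]
    ![![-1, 0, 0], ![0, 1, 0], ![0, 0, 1]]
    (by simp [Matrix.det_fin_three]) ![1, 0, 0] (by simp) (by intro j; fin_cases j; simp)
  have h3 := good_typeN (n := 0) (by norm_num) ![![1, 0, 0]]
    ![![0, 1, 0], ![0, 0, 1], ![1, 0, 0]]
    (by simp [Matrix.det_fin_three]) 0 (by simp) (by intro j; exact j.elim0)
  refine (Good.split (n := 0) (a := 0) (b := castVec ![1, 0, 0])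
    (m := (1 / 2 : ℝ) • castVec ![1, 0, 0]) (r := ![]) (by simp) (-(2 : ℝ) • LinearMap.proj 0) (-1)
    (by simp) (by simp [castVec]; norm_num) (fun i => i.elim0) (h1.congr_openHull fun j => ?_)
    (h2.congr_openHull fun j => ?_) (h3.congr_openHull fun j => ?_)).congr_openHull fun j => ?_
  all_goals fin_cases j <;> ext i <;> fin_cases i <;> simp [castVec]

theorem good_open_triangle : Good (openHull fun j => castVec ((![0, ![1, 0, 0], ![0, 1, 0]] :
    Fin 3 → Fin 3 → ℤ) j)) := by
  have hd : ∀ a b c d : ℤ, IsUnit (a * d - b * c) →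
      IsUnit (Matrix.det (Matrix.of ![![a, b, 0], ![c, d, 0], ![0, 0, 1]])) := by
    intro a b c d h
    convert h using 1
    simp [Matrix.det_fin_three]
  have hd' : ∀ a b c d : ℤ, IsUnit (a * d - b * c) →
      IsUnit (Matrix.det (Matrix.of ![![a, b, 0], ![0, 0, 1], ![c, d, 0]])) := by
    intro a b c d h
    convert h.neg using 1
    simp [Matrix.det_fin_three]
    ring
  have h1 := good_typeA (n := 2) (by norm_num) ![0, ![0, 1, 0], ![1, 0, 0]] _
    (hd 0 1 1 0 (by decide)) 0 (by simp) (by intro j; fin_cases j <;> simp)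
  have h2 := good_typeA (n := 2) (by norm_num) ![![0, 2, 0], ![0, 1, 0], ![1, 0, 0]] _
    (hd 0 (-1) 1 (-2) (by decide)) ![0, 1, 0] (by simp) (by intro j; fin_cases j <;> simp)
  have h3 := good_typeN (n := 1) (by norm_num) ![![0, 1, 0], ![1, 0, 0]] _
    (hd' 1 (-1) 0 1 (by decide)) 0 (by simp) (by intro j; fin_cases j; simp)
  have h4 := good_typeA (n := 2) (by norm_num) ![![2, 0, 0], ![1, 1, 0], ![1, 0, 0]] _
    (hd (-1) 1 (-1) 0 (by decide)) ![1, 0, 0] (by simp) (by intro j; fin_cases j <;> simp)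
  have h5 := good_typeA (n := 2) (by norm_num) ![![0, 2, 0], ![1, 1, 0], ![1, 0, 0]] _
    (hd 1 (-1) 1 (-2) (by decide)) ![0, 1, 0] (by simp) (by intro j; fin_cases j <;> simp)
  have h6 := good_typeN (n := 1) (by norm_num) ![![1, 1, 0], ![1, 0, 0]] _
    (hd' 0 (-1) 1 1 (by decide)) 0 (by simp) (by intro j; fin_cases j; simp)
  have h7 := good_typeA (n := 1) (by norm_num) ![![0, 2, 0], ![1, 0, 0]] _
    (hd 1 (-2) 0 1 (by decide)) ![0, 1, 0] (by simp) (by intro j; fin_cases j; simp)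
  have t1 := Good.split (n := 1) (a := 0) (b := castVec ![0, 1, 0])
    (m := (1 / 2 : ℝ) • castVec ![0, 1, 0]) (r := ![(1 / 2 : ℝ) • castVec ![1, 0, 0]]) (by simp)
    (-(2 : ℝ) • LinearMap.proj 0 - (2 : ℝ) • LinearMap.proj 1) (-1) (by simp)
    (by simp [castVec]; norm_num) (fun i => by fin_cases i; simp [castVec])
    (h1.congr_openHull fun j => ?_) (h2.congr_openHull fun j => ?_)
    (h3.congr_openHull fun j => ?_)
  · have t2 := Good.split (n := 1) (a := castVec ![1, 0, 0]) (b := castVec ![0, 1, 0])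
      (m := (1 / 2 : ℝ) • castVec ![1, 1, 0]) (r := ![(1 / 2 : ℝ) • castVec ![1, 0, 0]])
      (by ext i; fin_cases i <;> simp [castVec]) ((2 : ℝ) • LinearMap.proj 0) 1
      (by simp [castVec]; norm_num) (by simp [castVec]) (fun i => by fin_cases i; simp [castVec])
      (h4.congr_openHull fun j => ?_) (h5.congr_openHull fun j => ?_)
      (h6.congr_openHull fun j => ?_)
    · rw [← openHull_comp_equiv (Equiv.swap 1 2)] at t1 t2
      rw [← openHull_comp_equiv (Equiv.swap 0 1)] at h7
      refine (Good.split (n := 1) (a := 0) (b := castVec ![1, 0, 0])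
        (m := (1 / 2 : ℝ) • castVec ![1, 0, 0]) (r := ![castVec ![0, 1, 0]]) (by simp)
        (-(2 : ℝ) • LinearMap.proj 0 - LinearMap.proj 1) (-1) (by simp)
        (by simp [castVec]; norm_num) (fun i => by fin_cases i; simp [castVec])
        (t1.congr_openHull fun j => ?_) (t2.congr_openHull fun j => ?_)
        (h7.congr_openHull fun j => ?_)).congr_openHull fun j => ?_
      all_goals fin_cases j <;> ext i <;> fin_cases i <;> simp [castVec, Equiv.swap_apply_def]
    all_goals fin_cases j <;> ext i <;> fin_cases i <;> simp [castVec]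
  all_goals fin_cases j <;> ext i <;> fin_cases i <;> simp [castVec]

end Standard

section EmptySimplex

variable {n : ℕ}

/-- Affinely independent lattice points whose convex hull contains no further lattice points. -/
structure IsEmptySimplex (w : Fin (n + 1) → Fin 3 → ℤ) : Prop where
  indep : ∀ μ : Fin (n + 1) → ℝ, ∑ j, μ j = 0 → ∑ j, μ j • castVec (w j) = 0 → μ = 0
  vertex : ∀ (z : Fin 3 → ℤ) (μ : Fin (n + 1) → ℝ), (∀ j, 0 ≤ μ j) → ∑ j, μ j = 1 →
    ∑ j, μ j • castVec (w j) = castVec z → ∃ j, z = w j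

/-- Two families of lattice points related by a unimodular transformation. -/
def UnimodularEquiv (w w' : Fin (n + 1) → Fin 3 → ℤ) : Prop :=
  ∃ M : Matrix (Fin 3) (Fin 3) ℤ, IsUnit M.det ∧ ∃ b, ∀ j, M.mulVec (w j) + b = w' j

variable {w w' w'' : Fin (n + 1) → Fin 3 → ℤ}

theorem UnimodularEquiv.trans (h : UnimodularEquiv w w') (h' : UnimodularEquiv w' w'') :
    UnimodularEquiv w w'' := by
  obtain ⟨M, hM, b, h⟩ := h
  obtain ⟨M', hM', b', h'⟩ := h'
  refine ⟨M' * M, by simpa using hM'.mul hM, M'.mulVec b + b', fun j => ?_⟩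
  rw [← h', ← h, Matrix.mulVec_add, Matrix.mulVec_mulVec, add_assoc]

theorem UnimodularEquiv.good (h : UnimodularEquiv w w')
    (hw : Good (openHull fun j => castVec (w' j))) : Good (openHull fun j => castVec (w j)) := by
  obtain ⟨M, hM, b, h⟩ := h
  have hu := isUnimodular_mulVec_add M hM b
  refine Good.of_image hu ?_
  rw [hu.image_openHull]
  refine hw.congr_openHull fun j => ?_
  simp only [Function.comp_apply, ← h, castVec_add, castVec_mulVec]

theorem IsEmptySimplex.of_unimodularEquiv (hw : IsEmptySimplex w) (h : UnimodularEquiv w w') :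
    IsEmptySimplex w' := by
  obtain ⟨M, hM, b, h⟩ := h
  have hu := isUnimodular_mulVec_add M hM b
  have hcast : ∀ z, castVec (M.mulVec z + b) =
      (M.map (Int.cast : ℤ → ℝ)).mulVec (castVec z) + castVec b := fun z => by
    rw [castVec_add, castVec_mulVec]
  constructor
  · intro μ h0 h1
    refine hw.indep μ h0 ?_
    have e1 : ∑ j, μ j • castVec (w' j) =
        (M.map (Int.cast : ℤ → ℝ)).mulVec (∑ j, μ j • castVec (w j)) := by
      simp only [← h, hcast, smul_add, Finset.sum_add_distrib, ← Finset.sum_smul, h0, zero_smul,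
        add_zero, Matrix.mulVec_sum, Matrix.mulVec_smul]
    rw [e1] at h1
    refine hu.injective ?_
    simp [h1]
  · intro z μ h0 h1 h2
    obtain ⟨y, hy⟩ : ∃ y, z = M.mulVec y + b := ⟨M⁻¹.mulVec (z - b), by
      rw [Matrix.mulVec_mulVec, Matrix.mul_nonsing_inv _ hM, Matrix.one_mulVec, sub_add_cancel]⟩
    obtain ⟨j, hj⟩ := hw.vertex y μ h0 h1 <| hu.injective <| by
      rw [hu.map_sum h1]
      simp only [← hcast, h]
      rw [h2, hy]
    exact ⟨j, by rw [hy, hj, h]⟩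

theorem IsEmptySimplex.castSucc {w : Fin (n + 2) → Fin 3 → ℤ} (hw : IsEmptySimplex w) :
    IsEmptySimplex fun j : Fin (n + 1) => w j.castSucc := by
  constructor
  · intro μ h0 h1
    have := hw.indep (Fin.snoc μ 0) (by rw [Fin.sum_univ_castSucc]; simpa using h0)
      (by rw [Fin.sum_univ_castSucc]; simpa using h1)
    ext j
    simpa using congrFun this j.castSucc
  · intro z μ h0 h1 h2
    obtain ⟨j, hj⟩ := hw.vertex z (Fin.snoc μ 0)
      (fun j => Fin.lastCases (by simp) (fun j => by simpa using h0 j) j)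
      (by rw [Fin.sum_univ_castSucc]; simpa using h1)
      (by rw [Fin.sum_univ_castSucc]; simpa using h2)
    by_cases hl : j = Fin.last _
    · subst hl
      have h3 : ∑ j, (Fin.snoc μ (-1) : Fin (n + 2) → ℝ) j • castVec (w j) = 0 := by
        rw [Fin.sum_univ_castSucc]
        simp [h2, hj]
      have := hw.indep _ (by rw [Fin.sum_univ_castSucc]; simp [h1]) h3
      have := congrFun this (Fin.last _)
      simp at this
    · exact ⟨j.castPred hl, by simpa using hj⟩

theorem exists_bezout (x y : ℤ) :
    ∃ a b c d : ℤ, a * d - b * c = 1 ∧ c * x + d * y = 0 ∧ 0 ≤ a * x + b * y := by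
  rcases eq_or_ne (Int.gcd x y) 0 with h | h
  · rw [Int.gcd_eq_zero_iff] at h
    exact ⟨1, 0, 0, 1, by simp [h.1, h.2]⟩
  · have hx := Int.mul_ediv_cancel' (Int.gcd_dvd_left (a := x) (b := y))
    have hy := Int.mul_ediv_cancel' (Int.gcd_dvd_right (a := x) (b := y))
    have hg := Int.gcd_eq_gcd_ab x y
    have hg0 : (Int.gcd x y : ℤ) ≠ 0 := by exact_mod_cast h
    refine ⟨Int.gcdA x y, Int.gcdB x y, -(y / Int.gcd x y), x / Int.gcd x y, ?_, ?_, ?_⟩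
    · refine mul_left_cancel₀ hg0 ?_
      linear_combination Int.gcdA x y * hx + Int.gcdB x y * hy - hg
    · refine mul_left_cancel₀ hg0 ?_
      linear_combination y * hx - x * hy
    · have : (0 : ℤ) ≤ Int.gcd x y := by positivity
      linarith

theorem IsEmptySimplex.edge {w : Fin 2 → Fin 3 → ℤ} (hw : IsEmptySimplex w) :
    UnimodularEquiv w ![0, ![1, 0, 0]] := by
  obtain ⟨a, b, c, d, h1, h2, -⟩ := exists_bezout ((w 1 - w 0) 1) ((w 1 - w 0) 2)
  obtain ⟨a', b', c', d', h1', h2', h3'⟩ := exists_bezout ((w 1 - w 0) 0)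
    (a * (w 1 - w 0) 1 + b * (w 1 - w 0) 2)
  obtain ⟨g, hg⟩ : ∃ g, g = a' * (w 1 - w 0) 0 + b' * (a * (w 1 - w 0) 1 + b * (w 1 - w 0) 2) :=
    ⟨_, rfl⟩
  have key : UnimodularEquiv w ![0, ![g, 0, 0]] := by
    have hdet : Matrix.det !![a', b' * a, b' * b; c', d' * a, d' * b; 0, c, d] = 1 := by
      rw [Matrix.det_fin_three]
      simp
      linear_combination (a * d - b * c) * h1' + h1
    refine ⟨!![a', b' * a, b' * b; c', d' * a, d' * b; 0, c, d], by rw [hdet]; exact isUnit_one,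
      -(!![a', b' * a, b' * b; c', d' * a, d' * b; 0, c, d].mulVec (w 0)), fun j => ?_⟩
    rw [← sub_eq_add_neg, ← Matrix.mulVec_sub]
    fin_cases j
    · simp
    · ext i
      fin_cases i
      · simp [Matrix.mulVec, dotProduct, Fin.sum_univ_three, hg]; ring
      · simp [Matrix.mulVec, dotProduct, Fin.sum_univ_three]
        simp at h2'
        linear_combination h2'
      · simp [Matrix.mulVec, dotProduct, Fin.sum_univ_three]
        simpa using h2
  have hw' := hw.of_unimodularEquiv key
  have hg0 : 0 < g := by
    refine lt_of_le_of_ne (hg ▸ h3') fun h => ?_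
    have := congrFun (hw'.indep ![1, -1] (by simp) (by rw [← h]; ext i; fin_cases i <;> simp [castVec])) 0
    simp at this
  have hgr : (1 : ℝ) ≤ g := by exact_mod_cast hg0
  obtain ⟨j, hj⟩ := hw'.vertex ![1, 0, 0] ![1 - 1 / g, 1 / g] (by
      intro j
      fin_cases j
      · simp; exact inv_le_one_of_one_le₀ hgr
      · simp; positivity) (by simp) (by
      ext i
      fin_cases i <;> simp [castVec]
      field_simp)
  have h0 := congrFun hj 0
  fin_cases j
  · simp at h0
  · simp at h0
    rwa [← h0] at key

theorem IsEmptySimplex.triangle {w : Fin 3 → Fin 3 → ℤ} (hw : IsEmptySimplex w) :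
    UnimodularEquiv w ![0, ![1, 0, 0], ![0, 1, 0]] := by
  obtain ⟨M, hM, b, h⟩ := hw.castSucc.edge
  obtain ⟨u, hu⟩ : ∃ u, u = M.mulVec (w 2) + b := ⟨_, rfl⟩
  have h1 : UnimodularEquiv w ![0, ![1, 0, 0], u] := by
    refine ⟨M, hM, b, fun j => ?_⟩
    fin_cases j
    exacts [h 0, h 1, hu.symm]
  obtain ⟨a, b, c, d, e1, e2, e3⟩ := exists_bezout (u 1) (u 2)
  obtain ⟨g, hg⟩ : ∃ g, g = a * u 1 + b * u 2 := ⟨_, rfl⟩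
  have h2 : UnimodularEquiv ![0, ![1, 0, 0], u] ![0, ![1, 0, 0], ![u 0, g, 0]] := by
    refine ⟨!![1, 0, 0; 0, a, b; 0, c, d], ?_, 0, fun j => ?_⟩
    · rw [Matrix.det_fin_three]; simp [e1]
    · fin_cases j <;> ext i <;> fin_cases i <;>
        simp [dotProduct, Fin.sum_univ_three, hg, e2]
  have key := h1.trans h2
  have hw' := hw.of_unimodularEquiv key
  have hg0 : 0 < g := by
    refine lt_of_le_of_ne (hg ▸ e3) fun h => ?_
    have := congrFun (hw'.indep ![(u 0 : ℝ) - 1, - u 0, 1] (by simp [Fin.sum_univ_three]; ring)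
      (by rw [← h]; ext i; fin_cases i <;> simp [castVec, Fin.sum_univ_three])) 2
    simp at this
  have hgr : (0 : ℝ) < g := by exact_mod_cast hg0
  obtain ⟨x, hx0, hx1⟩ : ∃ x, u 0 ≤ g * x ∧ g * x ≤ u 0 + g - 1 :=
    ⟨(u 0 + g - 1) / g, by
      have := Int.emod_add_mul_ediv (u 0 + g - 1) g
      have := Int.emod_lt_of_pos (u 0 + g - 1) hg0
      linarith, by
      have := Int.emod_add_mul_ediv (u 0 + g - 1) g
      have := Int.emod_nonneg (u 0 + g - 1) hg0.ne'
      linarith⟩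
  have hx0' : (u 0 : ℝ) ≤ g * x := by exact_mod_cast hx0
  have hx1' : (g * x : ℝ) ≤ u 0 + g - 1 := by exact_mod_cast hx1
  obtain ⟨j, hj⟩ := hw'.vertex ![x, 1, 0] ![(u 0 + g - 1 - g * x) / g, (g * x - u 0) / g, 1 / g] (by
      intro j
      fin_cases j
      · exact div_nonneg (by linarith) hgr.le
      · exact div_nonneg (by linarith) hgr.le
      · exact div_nonneg zero_le_one hgr.le) (by
      simp [Fin.sum_univ_three]
      field_simp
      ring) (by
      ext i
      fin_cases i <;> simp [castVec, Fin.sum_univ_three]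
      all_goals field_simp
      ring)
  have h0 := congrFun hj 1
  have hg1 : g = 1 := by
    fin_cases j
    · simp at h0
    · simp at h0
    · simpa using h0.symm
  rw [hg1] at key
  refine key.trans ⟨!![1, -u 0, 0; 0, 1, 0; 0, 0, 1], by simp [Matrix.det_fin_three], 0,
    fun j => ?_⟩
  fin_cases j <;> ext i <;> fin_cases i <;>
    simp

theorem IsEmptySimplex.tetrahedron {w : Fin 4 → Fin 3 → ℤ} (hw : IsEmptySimplex w) :
    ∃ p q r, 0 < q ∧ UnimodularEquiv w ![0, ![1, 0, 0], ![0, 0, 1], ![p, q, r]] := by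
  obtain ⟨M, hM, b, h⟩ := hw.castSucc.triangle
  obtain ⟨u, hu⟩ : ∃ u, u = M.mulVec (w 3) + b := ⟨_, rfl⟩
  have h1 : UnimodularEquiv w ![0, ![1, 0, 0], ![0, 1, 0], u] := by
    refine ⟨M, hM, b, fun j => ?_⟩
    fin_cases j
    exacts [h 0, h 1, h 2, hu.symm]
  have h2 : ∀ s : ℤ, IsUnit s → UnimodularEquiv ![0, ![1, 0, 0], ![0, 1, 0], u]
      ![0, ![1, 0, 0], ![0, 0, 1], ![u 0, s * u 2, u 1]] := by
    intro s hs
    refine ⟨!![1, 0, 0; 0, 0, s; 0, 1, 0], by simpa [Matrix.det_fin_three] using hs, 0, fun j => ?_⟩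
    fin_cases j <;> ext i <;> fin_cases i <;>
      simp [dotProduct, Fin.sum_univ_three]
  rcases lt_trichotomy (u 2) 0 with h3 | h3 | h3
  · exact ⟨u 0, -1 * u 2, u 1, by linarith, h1.trans (h2 (-1) (by simp))⟩
  · have hw' := hw.of_unimodularEquiv h1
    have := congrFun (hw'.indep ![u 0 + u 1 - 1, -u 0, -u 1, 1] (by simp [Fin.sum_univ_four]; ring)
      (by ext i; fin_cases i <;> simp [castVec, Fin.sum_univ_four, h3])) 3
    simp at this
  · exact ⟨u 0, 1 * u 2, u 1, by linarith, h1.trans (h2 1 (by simp))⟩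

end EmptySimplex

section EmptyTetrahedron

/-- The vertices of a lattice tetrahedron with an edge in each of two coordinate directions. -/
def tetVertex (p q r : ℤ) : Fin 4 → Fin 3 → ℤ := ![0, ![1, 0, 0], ![0, 0, 1], ![p, q, r]]

variable {p q r : ℤ}

theorem openHull_tetVertex (hq : 0 < q) :
    openHull (fun j => castVec (tetVertex p q 1 j)) = openTet p q := by
  have hqr : (0 : ℝ) < q := by exact_mod_cast hq
  ext x
  constructor
  · rintro ⟨μ, h0, h1, rfl⟩
    rw [Fin.sum_univ_four] at h1
    have p0 := h0 0
    have p1 := h0 1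
    have p2 := h0 2
    have p3 := h0 3
    simp only [openTet, Set.mem_ofPred_eq]
    simp [castVec, Fin.sum_univ_four, tetVertex]
    refine ⟨by positivity, ?_, ?_, ?_⟩
    · linear_combination (exp := 1) mul_pos hqr p2
    · linear_combination (exp := 1) mul_pos hqr p1
    · linear_combination (exp := 1) mul_pos hqr p0 + q * h1
  · rintro ⟨h1, h2, h3, h4⟩
    refine ⟨![(q * (1 - x 2) - (q * x 0 - p * x 1)) / q, (q * x 0 - p * x 1) / q,
      (q * x 2 - x 1) / q, x 1 / q], fun j => ?_, ?_, ?_⟩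
    · fin_cases j
      · exact div_pos (by linarith) hqr
      · exact div_pos (by linarith) hqr
      · exact div_pos (by linarith) hqr
      · exact div_pos (by linarith) hqr
    · simp [Fin.sum_univ_four]
      field_simp
      ring
    · ext i
      fin_cases i <;> simp [castVec, Fin.sum_univ_four, tetVertex]
      all_goals field_simp
      all_goals ring

theorem good_tet_of_dvd_sub_one (hq : 0 < q) (hpq : IsCoprime p q) (hr : q ∣ r - 1) :
    Good (openHull fun j => castVec (tetVertex p q r j)) := by
  obtain ⟨k, hk⟩ := hr
  refine UnimodularEquiv.good (w' := tetVertex p q 1) ⟨!![1, 0, 0; 0, 1, 0; 0, -k, 1],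
    by simp [Matrix.det_fin_three], 0, fun j => ?_⟩ ?_
  · fin_cases j <;> ext i <;> fin_cases i <;>
      simp [tetVertex]
    linear_combination hk
  · rw [openHull_tetVertex hq]
    exact good_openTet hq hpq

theorem good_tet_swap (h : Good (openHull fun j => castVec (tetVertex r q p j))) :
    Good (openHull fun j => castVec (tetVertex p q r j)) := by
  refine UnimodularEquiv.good (w' := tetVertex r q p ∘ Equiv.swap 1 2)
    ⟨!![0, 0, 1; 0, 1, 0; 1, 0, 0], by simp [Matrix.det_fin_three], 0, fun j => ?_⟩ ?_
  · fin_cases j <;> ext i <;> fin_cases i <;>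
      simp [tetVertex, Equiv.swap_apply_def]
  · rw [← openHull_comp_equiv (Equiv.swap 1 2)] at h
    exact h

theorem good_tet_reflect (h : Good (openHull fun j => castVec (tetVertex (1 - p - r) q r j))) :
    Good (openHull fun j => castVec (tetVertex p q r j)) := by
  refine UnimodularEquiv.good (w' := tetVertex (1 - p - r) q r ∘ Equiv.swap 0 1)
    ⟨!![-1, 0, -1; 0, 1, 0; 0, 0, 1], by simp [Matrix.det_fin_three], ![1, 0, 0], fun j => ?_⟩ ?_
  · fin_cases j <;> ext i <;> fin_cases i <;>
      simp [tetVertex, Equiv.swap_apply_def]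
    ring
  · rw [← openHull_comp_equiv (Equiv.swap 0 1)] at h
    exact h

theorem IsEmptySimplex.no_point (h : IsEmptySimplex (tetVertex p q r)) (hq : 0 < q) (x y z : ℤ)
    (hy0 : 0 < y) (hyq : y < q) (hx : 0 ≤ q * x - p * y) (hz : 0 ≤ q * z - r * y) :
    ¬ (q * x - p * y) + (q * z - r * y) + y ≤ q := by
  intro hs
  have hqr : (0 : ℝ) < q := by exact_mod_cast hq
  have hx' : (0 : ℝ) ≤ q * x - p * y := by exact_mod_cast hx
  have hz' : (0 : ℝ) ≤ q * z - r * y := by exact_mod_cast hz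
  have hy' : (0 : ℝ) ≤ y := by exact_mod_cast hy0.le
  have hs' : (q * x - p * y) + (q * z - r * y) + y ≤ (q : ℝ) := by exact_mod_cast hs
  obtain ⟨j, hj⟩ := h.vertex ![x, y, z] ![(q - ((q * x - p * y) + (q * z - r * y) + y)) / q,
    (q * x - p * y) / q, (q * z - r * y) / q, y / q] (fun j => by
      fin_cases j
      · exact div_nonneg (by linarith) hqr.le
      · exact div_nonneg (by linarith) hqr.le
      · exact div_nonneg (by linarith) hqr.le
      · exact div_nonneg (by linarith) hqr.le) (by
      simp [Fin.sum_univ_four]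
      field_simp
      ring) (by
      ext i
      fin_cases i <;> simp [castVec, Fin.sum_univ_four, tetVertex]
      all_goals field_simp
      all_goals ring)
  have := congrFun hj 1
  fin_cases j <;> simp [tetVertex] at this <;> omega

theorem isCoprime_of_no_point (hq : 0 < q) (h : ∀ x y z : ℤ, 0 < y → y < q → 0 ≤ q * x - p * y →
    0 ≤ q * z - r * y → ¬ (q * x - p * y) + (q * z - r * y) + y ≤ q) : IsCoprime p q := by
  rw [Int.isCoprime_iff_gcd_eq_one]
  by_contra hg
  obtain ⟨p', hp⟩ := Int.gcd_dvd_left (a := p) (b := q)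
  obtain ⟨q', hq'⟩ := Int.gcd_dvd_right (a := p) (b := q)
  have hg0 : 0 < Int.gcd p q := Int.gcd_pos_of_ne_zero_right _ hq.ne'
  obtain ⟨g, hgg⟩ : ∃ g : ℤ, g = Int.gcd p q := ⟨_, rfl⟩
  have hg2 : 2 ≤ g := by omega
  rw [← hgg] at hp hq'
  have hq'0 : 0 < q' := by nlinarith
  have e := Int.emod_add_mul_ediv (r + g - 1) g
  have e1 := Int.emod_lt_of_pos (r + g - 1) (by linarith : 0 < g)
  have e2 := Int.emod_nonneg (r + g - 1) (by linarith : g ≠ 0)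
  obtain ⟨z, hz⟩ : ∃ z, z = (r + g - 1) / g := ⟨_, rfl⟩
  rw [← hz] at e
  have f1 : q * p' - p * q' = 0 := by linear_combination p' * hq' - q' * hp
  have f2 : q * z - r * q' = q' * (g * z - r) := by linear_combination z * hq'
  refine h p' q' z hq'0 (by nlinarith) f1.ge ?_ ?_
  · rw [f2]; exact mul_nonneg hq'0.le (by linarith)
  · rw [f1, f2, hq']
    nlinarith

theorem IsEmptySimplex.good_tetrahedron (h : IsEmptySimplex (tetVertex p q r)) (hq : 0 < q) :
    Good (openHull fun j => castVec (tetVertex p q r j)) := by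
  have h1 := h.no_point hq
  have hp := isCoprime_of_no_point hq h1
  have hr : IsCoprime r q := isCoprime_of_no_point hq fun x y z a b c d e =>
    h1 z y x a b d c (by linarith)
  rcases white_arithmetic p q r hq h1 with h2 | h2 | h2
  · exact good_tet_swap (good_tet_of_dvd_sub_one hq hr h2)
  · exact good_tet_of_dvd_sub_one hq hp h2
  · refine good_tet_reflect (good_tet_swap (good_tet_of_dvd_sub_one hq hr ?_))
    have : 1 - p - r - 1 = -(p + r) := by ring
    rw [this]
    exact h2.neg_right

theorem IsEmptySimplex.good {n : ℕ} (hn : n ≤ 3) {w : Fin (n + 1) → Fin 3 → ℤ}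
    (hw : IsEmptySimplex w) : Good (openHull fun j => castVec (w j)) := by
  interval_cases n
  · refine (good_typeA (n := 0) (by norm_num) ![2 • w 0] (Matrix.of.symm 1) (by simp) (w 0) (by simp)
      (fun j => j.elim0)).congr_openHull fun j => ?_
    fin_cases j
    ext i
    simp [castVec]
  · exact hw.edge.good good_open_segment
  · exact hw.triangle.good good_open_triangle
  · obtain ⟨p, q, r, hq, h⟩ := hw.tetrahedron
    exact h.good ((hw.of_unimodularEquiv h).good_tetrahedron hq)

end EmptyTetrahedron

theorem finite_lattice_points {n : ℕ} {X : Set (Fin n → ℝ)} (hX : Bornology.IsBounded X) :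
    {y : Fin n → ℤ | castVec y ∈ X}.Finite := by
  obtain ⟨R, hR⟩ := hX.exists_norm_le
  refine (Set.finite_Icc (fun _ : Fin n => -⌈R⌉) fun _ => ⌈R⌉).subset fun y hy => ?_
  have h : ∀ i, |y i| ≤ ⌈R⌉ := fun i => by
    have h1 := (norm_le_pi_norm (castVec y) i).trans (hR _ hy)
    rw [Real.norm_eq_abs] at h1
    have h2 : ((|y i| : ℤ) : ℝ) ≤ ⌈R⌉ := by
      push_cast
      exact h1.trans (Int.le_ceil R)
    exact_mod_cast h2
  exact ⟨fun i => (abs_le.1 (h i)).1, fun i => (abs_le.1 (h i)).2⟩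

theorem IsLatticePolytope3.isBounded {P : Set (Fin 3 → ℝ)} (hP : IsLatticePolytope3 P) :
    Bornology.IsBounded P := by
  obtain ⟨V, rfl⟩ := hP
  exact isBounded_convexHull.2 (V.finite_toSet.image _).isBounded

theorem IsLatticePolytope3.convex {P : Set (Fin 3 → ℝ)} (hP : IsLatticePolytope3 P) :
    Convex ℝ P := by
  obtain ⟨V, rfl⟩ := hP
  exact convex_convexHull ℝ _

section Polytope

/-- The lattice points of a set, multiplied by `2`. -/
def doubledPoints (P : Set (Fin 3 → ℝ)) : Set (Fin 3 → ℤ) :=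
  {z | ∃ y, z = 2 • y ∧ castVec y ∈ P}

/-- The squared length as a cost. -/
def normCosts (S : Set (Fin 3 → ℤ)) : List (S → ℝ) := [fun z => ∑ i, (z.1 i : ℝ) ^ 2]

variable {P : Set (Fin 3 → ℝ)}

theorem finite_doubledPoints (hP : Bornology.IsBounded P) : (doubledPoints P).Finite := by
  refine ((finite_lattice_points hP).image fun y => 2 • y).subset ?_
  rintro _ ⟨y, rfl, hy⟩
  exact ⟨y, hy, rfl⟩

theorem half_castVec_two_smul {n : ℕ} (y : Fin n → ℤ) :
    (1 / 2 : ℝ) • castVec (2 • y) = castVec y := by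
  ext i; simp [castVec]

variable [Fintype (doubledPoints P)] [DecidableEq (doubledPoints P)] {A : Finset (doubledPoints P)}

theorem isEmptySimplex_of_regular (hP : Convex ℝ P)
    (hA : IsRegularSupport (halfPoints _) (withTieBreak (normCosts (doubledPoints P))) A) {n : ℕ}
    (f : Fin (n + 1) → doubledPoints P) (hf : Function.Injective f) (hfA : ∀ j, f j ∈ A)
    (w : Fin (n + 1) → Fin 3 → ℤ) (hw : ∀ j, (f j).1 = 2 • w j) : IsEmptySimplex w := by
  have hwP : ∀ j, castVec (w j) ∈ P := fun j => by
    obtain ⟨y, hy, hyP⟩ := (f j).2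
    rwa [smul_right_injective _ (two_ne_zero (α := ℕ)) ((hw j).symm.trans hy)]
  constructor
  · intro μ h0 h1
    refine hA.independent f hfA hf μ h0 fun i => ?_
    have := congrFun h1 i
    simp [castVec] at this
    simp only [hw]
    simp
    rw [← mul_zero (2 : ℝ), ← this, Finset.mul_sum]
    exact Finset.sum_congr rfl fun j _ => by ring
  · intro z μ h0 h1 h2
    by_contra! hz
    have hzP : castVec z ∈ P := by
      rw [← h2]
      exact hP.sum_mem (fun j _ => h0 j) h1 fun j _ => hwP j
    have hi : ∀ i, ∑ j, μ j * (w j i : ℝ) = z i := fun i => by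
      have := congrFun h2 i
      simpa [castVec] using this
    refine hA.exchange (κ' := Unit) f μ (fun _ => ⟨2 • z, z, rfl, hzP⟩) (fun _ => 1) hfA
      (fun _ => zero_le_one) (by simp [h1]) (fun i => ?_) ?_
    · simp only [hw]
      simp
      rw [← hi i, Finset.mul_sum]
      exact Finset.sum_congr rfl fun j _ => by ring
    · refine Or.inl ?_
      have hpos : 0 < ∑ j, μ j * ∑ i, ((w j i : ℝ) - z i) ^ 2 := by
        obtain ⟨j, -, hj⟩ := Finset.exists_ne_zero_of_sum_ne_zero (by rw [h1]; exact one_ne_zero :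
          ∑ j, μ j ≠ 0)
        have hj' : 0 < μ j := lt_of_le_of_ne (h0 j) hj.symm
        refine Finset.sum_pos' (fun k _ => mul_nonneg (h0 k) (by positivity))
          ⟨j, Finset.mem_univ _, mul_pos hj' ?_⟩
        obtain ⟨i, hne⟩ := Function.ne_iff.1 (hz j)
        refine Finset.sum_pos' (fun i _ => sq_nonneg _) ⟨i, Finset.mem_univ _, ?_⟩
        have : (w j i : ℝ) - z i ≠ 0 := sub_ne_zero.2 (by exact_mod_cast hne.symm)
        positivity
      have e : ∑ j, μ j * ∑ i, ((w j i : ℝ) - z i) ^ 2 =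
          ∑ j, μ j * ∑ i, (w j i : ℝ) ^ 2 - ∑ i, (z i : ℝ) ^ 2 := by
        have e1 : ∀ j, μ j * ∑ i, ((w j i : ℝ) - z i) ^ 2 = μ j * ∑ i, (w j i : ℝ) ^ 2 -
            2 * (μ j * w j 0 * z 0 + μ j * w j 1 * z 1 + μ j * w j 2 * z 2) +
            μ j * ∑ i, (z i : ℝ) ^ 2 := fun j => by
          simp only [Fin.sum_univ_three]; ring
        simp only [e1, Finset.sum_add_distrib, Finset.sum_sub_distrib, ← Finset.mul_sum,
          ← Finset.sum_mul, hi, h1]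
        simp only [Fin.sum_univ_three]; ring
      have e2 : ∀ y : Fin 3 → ℤ, ∑ i, (((2 • y) i : ℤ) : ℝ) ^ 2 = 4 * ∑ i, (y i : ℝ) ^ 2 := by
        intro y
        simp [Finset.mul_sum]
        exact Finset.sum_congr rfl fun i _ => by ring
      have e3 : ∑ j, μ j * (4 * ∑ i, (w j i : ℝ) ^ 2) = 4 * ∑ j, μ j * ∑ i, (w j i : ℝ) ^ 2 := by
        rw [Finset.mul_sum]
        exact Finset.sum_congr rfl fun j _ => by ring
      simp only [hw, e2, e3]
      simp
      linarith

theorem IsEmptySimplex.dim_le {n : ℕ} {w : Fin (n + 1) → Fin 3 → ℤ} (hw : IsEmptySimplex w) :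
    n ≤ 3 := by
  have hli : LinearIndependent ℝ fun j => (Fin.cons 1 (castVec (w j)) : Fin 4 → ℝ) := by
    rw [Fintype.linearIndependent_iff]
    intro μ hμ j
    refine congrFun (hw.indep μ ?_ ?_) j
    · simpa using congrFun hμ 0
    · ext i
      simpa using congrFun hμ i.succ
  have := hli.fintype_card_le_finrank
  simp at this
  omega

theorem good_cell_doubledPoints (hP : Convex ℝ P)
    (hA : IsRegularSupport (halfPoints _) (withTieBreak (normCosts (doubledPoints P))) A)
    (hne : A.Nonempty) : Good (cell (halfPoints _) A) := by
  obtain ⟨n, hn⟩ := Nat.exists_eq_succ_of_ne_zero (Finset.card_pos.2 hne).ne'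
  have E := Finset.equivFinOfCardEq hn
  have hf : Function.Injective fun j => (E.symm j).1 :=
    Subtype.val_injective.comp E.symm.injective
  choose w hw _ using fun j => (E.symm j).1.2
  have hemp := isEmptySimplex_of_regular hP hA _ hf (fun j => (E.symm j).2) w hw
  refine good_cell_of_enum _ hf (fun a => ⟨fun ha => ⟨E ⟨a, ha⟩, by simp⟩, ?_⟩)
    ((hemp.good hemp.dim_le).congr_openHull fun j => ?_)
  · rintro ⟨j, rfl⟩
    exact (E.symm j).2
  · simp only [hw]
    exact (half_castVec_two_smul _).symm

end Polytope

theorem IsLatticePolytope3.good {P : Set (Fin 3 → ℝ)} (hP : IsLatticePolytope3 P) : Good P := by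
  classical
  have := (finite_doubledPoints hP.isBounded).fintype
  refine good_of_regular_cells (halfPoints (doubledPoints P)) (normCosts _) (fun _ => True) ?_ ?_
    fun A hne hA _ => good_cell_doubledPoints hP.convex hA hne
  · obtain ⟨V, hV⟩ := id hP
    nth_rw 1 [hV]
    refine convexHull_mono ?_
    rintro _ ⟨y, hy, rfl⟩
    refine ⟨⟨2 • y, y, rfl, ?_⟩, half_castVec_two_smul y⟩
    rw [hV]
    exact subset_convexHull ℝ _ ⟨y, hy, rfl⟩
  · refine fun A x hx => iff_true_intro (convexHull_min ?_ hP.convex (cell_subset_convexHull _ _ hx))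
    rintro _ ⟨⟨_, y, rfl, hy⟩, -, rfl⟩
    simpa only [halfPoints, half_castVec_two_smul] using hy
section Counting

theorem mem_smul_openHull {n : ℕ} {κ : Type*} [Fintype κ] {w : κ → Fin n → ℝ} {c : ℝ} (hc : 0 < c)
    {x : Fin n → ℝ} :
    x ∈ c • openHull w ↔ ∃ ν : κ → ℝ, (∀ j, 0 < ν j) ∧ ∑ j, ν j = c ∧ ∑ j, ν j • w j = x := by
  rw [Set.mem_smul_set]
  constructor
  · rintro ⟨_, ⟨μ, h0, h1, rfl⟩, rfl⟩
    refine ⟨fun j => c * μ j, fun j => mul_pos hc (h0 j), ?_, ?_⟩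
    · rw [← Finset.mul_sum, h1, mul_one]
    · simp only [mul_smul, Finset.smul_sum]
  · rintro ⟨ν, h0, h1, rfl⟩
    refine ⟨_, ⟨fun j => c⁻¹ * ν j, fun j => mul_pos (inv_pos.2 hc) (h0 j), ?_, rfl⟩, ?_⟩
    · rw [← Finset.mul_sum, h1, inv_mul_cancel₀ hc.ne']
    · simp only [mul_smul, ← Finset.smul_sum, smul_inv_smul₀ hc.ne']

/-- The only lattice point of the `(k + 1)`-fold dilation of `openStd k`. -/
def stdPoint (k : ℕ) : Fin 3 → ℤ := fun i =>
  (if (i : ℕ) < k / 2 then 1 else 0) + (if i = 2 then ((k % 2 * ((k + 1) / 2) : ℕ) : ℤ) else 0)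

theorem castVec_mem_smul_openStd {k m : ℕ} (hm : 1 ≤ m) {y : Fin 3 → ℤ} :
    castVec y ∈ (m : ℝ) • openStd k ↔ ∃ ν : ℕ → ℝ, (∀ j < k / 2 + 1, 0 < ν j) ∧
      ∑ j ∈ Finset.range (k / 2 + 1), ν j = m ∧
      ∀ i : Fin 3, ∑ j ∈ Finset.range (k / 2 + 1), ν j * ((if (i : ℕ) + 1 = j then 1 else 0) +
        (if i = 2 then ((k % 2 : ℕ) : ℝ) else 0)) = 2 * (y i : ℝ) := by
  have key : ∀ ν : ℕ → ℝ, (∀ i : Fin 3, ∑ j ∈ Finset.range (k / 2 + 1), ν j *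
      ((if (i : ℕ) + 1 = j then 1 else 0) + (if i = 2 then ((k % 2 : ℕ) : ℝ) else 0)) =
        2 * (y i : ℝ)) ↔
      ∑ j : Fin (k / 2 + 1), ν j • (1 / 2 : ℝ) • castVec (stdVertex k j) = castVec y := fun ν => by
    rw [funext_iff]
    refine forall_congr' fun i => ?_
    have e : (∑ j : Fin (k / 2 + 1), ν j • (1 / 2 : ℝ) • castVec (stdVertex k j)) i =
        1 / 2 * ∑ j ∈ Finset.range (k / 2 + 1), ν j * ((if (i : ℕ) + 1 = j then 1 else 0) +
          (if i = 2 then ((k % 2 : ℕ) : ℝ) else 0)) := by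
      rw [Finset.sum_range, Finset.mul_sum, Finset.sum_apply]
      refine Finset.sum_congr rfl fun j _ => ?_
      simp only [castVec, stdVertex, Pi.smul_apply, smul_eq_mul, Int.cast_add, Int.cast_ite,
        Int.cast_one, Int.cast_zero, Int.cast_natCast]
      ring
    rw [e, castVec]
    constructor <;> intro h <;> linarith
  rw [openStd, mem_smul_openHull (by exact_mod_cast hm)]
  constructor
  · rintro ⟨ν, h0, h1, h2⟩
    have hν : ∀ j : Fin (k / 2 + 1),
        (fun j => if h : j < k / 2 + 1 then ν ⟨j, h⟩ else 0 : ℕ → ℝ) j = ν j := fun j =>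
      dif_pos j.2
    refine ⟨fun j => if h : j < k / 2 + 1 then ν ⟨j, h⟩ else 0, fun j hj => ?_, ?_, (key _).2 ?_⟩
    · simpa [hj] using h0 ⟨j, hj⟩
    · rw [Finset.sum_range, ← h1]
      exact Finset.sum_congr rfl fun j _ => hν j
    · rw [← h2]
      exact Finset.sum_congr rfl fun j _ => by rw [← hν j]
  · rintro ⟨ν, h0, h1, h2⟩
    exact ⟨fun j => ν j, fun j => h0 j j.2, by rw [← h1, Finset.sum_range], (key ν).1 h2⟩

theorem of_castVec_mem_smul_openStd {k m : ℕ} (hk : k < 7) (hm : 1 ≤ m) {y : Fin 3 → ℤ}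
    (hy : castVec y ∈ (m : ℝ) • openStd k) : k + 1 ≤ m ∧ (m = k + 1 → y = stdPoint k) := by
  obtain ⟨ν, h0, h1, h2⟩ := (castVec_mem_smul_openStd hm).1 hy
  have p0 := h0 0
  have p1 := h0 1
  have p2 := h0 2
  have p3 := h0 3
  have e0 := h2 0
  have e1 := h2 1
  have e2 := h2 2
  clear h0 h2 hy
  have hext : ∀ z : Fin 3 → ℤ, y 0 = z 0 → y 1 = z 1 → y 2 = z 2 → y = z := fun z a b c => by
    ext i; fin_cases i <;> assumption
  have cast_pos : ∀ a : ℤ, (0 : ℝ) < (a : ℝ) → 0 < a := fun a h => by exact_mod_cast h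
  have cast_lt : ∀ a : ℤ, 2 * (a : ℝ) < m → 2 * a < m := fun a h => by exact_mod_cast h
  have cast_eq : ∀ a : ℤ, 2 * (a : ℝ) = m → 2 * a = m := fun a h => by exact_mod_cast h
  have finish : k + 1 ≤ m ∧ (m = k + 1 → y 0 = stdPoint k 0 ∧ y 1 = stdPoint k 1 ∧
      y 2 = stdPoint k 2) → k + 1 ≤ m ∧ (m = k + 1 → y = stdPoint k) :=
    fun h => ⟨h.1, fun hmk => hext _ (h.2 hmk).1 (h.2 hmk).2.1 (h.2 hmk).2.2⟩
  refine finish ?_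
  clear finish hext
  interval_cases k <;>
    norm_num [Finset.sum_range_succ, Fin.ext_iff] at h1 e0 e1 e2 p0 p1 p2 p3 <;>
    norm_num [stdPoint, Fin.ext_iff]
  · omega
  · have := cast_eq (y 2) (by linarith)
    omega
  · have := cast_pos (y 0) (by linarith)
    have := cast_lt (y 0) (by linarith)
    omega
  · have := cast_eq (y 2) (by linarith)
    have := cast_pos (y 0) (by linarith)
    have := cast_lt (y 0) (by linarith)
    omega
  · have := cast_pos (y 0) (by linarith)
    have := cast_pos (y 1) (by linarith)
    have := cast_lt (y 0 + y 1) (by push_cast; linarith)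
    omega
  · have := cast_eq (y 2) (by linarith)
    have := cast_pos (y 0) (by linarith)
    have := cast_pos (y 1) (by linarith)
    have := cast_lt (y 0 + y 1) (by push_cast; linarith)
    omega
  · have := cast_pos (y 0) (by linarith)
    have := cast_pos (y 1) (by linarith)
    have := cast_pos (y 2) (by linarith)
    have := cast_lt (y 0 + y 1 + y 2) (by push_cast; linarith)
    omega

theorem stdPoint_mem {k : ℕ} (hk : k < 7) :
    castVec (stdPoint k) ∈ ((k + 1 : ℕ) : ℝ) • openStd k := by
  refine (castVec_mem_smul_openStd (Nat.succ_pos _)).2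
    ⟨fun j => if j = 0 then (1 + k % 2 : ℕ) else 2, fun j _ => ?_, ?_, fun i => ?_⟩
  · dsimp only
    split_ifs <;> positivity
  · interval_cases k <;> norm_num [Finset.sum_range_succ]
  · interval_cases k <;> fin_cases i <;>
      norm_num [Finset.sum_range_succ, stdPoint, Fin.ext_iff]

end Counting

section LatticeCount

theorem latticeCount_smul_openStd_of_le {k m : ℕ} (hk : k < 7) (hm : 1 ≤ m) (hmk : m ≤ k) :
    latticeCount ((m : ℝ) • openStd k) = 0 := by
  have h : {y : Fin 3 → ℤ | castVec y ∈ (m : ℝ) • openStd k} = ∅ :=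
    Set.eq_empty_of_forall_notMem fun y hy =>
      absurd (of_castVec_mem_smul_openStd hk hm hy).1 (by omega)
  exact (congrArg Set.ncard h).trans (Set.ncard_empty _)

theorem latticeCount_smul_openStd_succ {k : ℕ} (hk : k < 7) :
    latticeCount (((k + 1 : ℕ) : ℝ) • openStd k) = 1 := by
  have h : {y : Fin 3 → ℤ | castVec y ∈ ((k + 1 : ℕ) : ℝ) • openStd k} = {stdPoint k} :=
    Set.eq_singleton_iff_unique_mem.2 ⟨stdPoint_mem hk, fun y hy =>
      (of_castVec_mem_smul_openStd hk (Nat.succ_pos _) hy).2 rfl⟩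
  exact (congrArg Set.ncard h).trans (Set.ncard_singleton _)

variable {n : ℕ}

theorem IsUnimodular.latticeCount_image {g : (Fin n → ℝ) → (Fin n → ℝ)} (hg : IsUnimodular g)
    (X : Set (Fin n → ℝ)) : latticeCount (g '' X) = latticeCount X := by
  obtain ⟨h, hh, hl, hr⟩ := hg.exists_inverse
  choose G hG using hg.exists_int
  choose H hH using hh.exists_int
  have e : {y : Fin n → ℤ | castVec y ∈ g '' X} = G '' {y | castVec y ∈ X} := by
    ext y
    constructor
    · rintro ⟨x, hx, hxy⟩
      have hy : castVec (H y) = x := by rw [← hH, ← hxy, hl]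
      refine ⟨H y, (by rwa [← hy] at hx), castVec_injective ?_⟩
      rw [← hG, ← hH, hr]
    · rintro ⟨z, hz, rfl⟩
      exact ⟨_, hz, hG z⟩
  refine (congrArg Set.ncard e).trans (Set.ncard_image_of_injective _ fun x y hxy => ?_)
  exact castVec_injective (hg.injective (by rw [hG, hG, hxy]))

theorem IsUnimodular.exists_smul_image {f : (Fin n → ℝ) → (Fin n → ℝ)} (hf : IsUnimodular f)
    (m : ℕ) : ∃ g, IsUnimodular g ∧
      ∀ X : Set (Fin n → ℝ), (m : ℝ) • f '' X = g '' ((m : ℝ) • X) := by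
  obtain ⟨A, hA, b, hfb⟩ := hf
  refine ⟨_, isUnimodular_mulVec_add A hA (m • b), fun X => ?_⟩
  simp only [← Set.image_smul, Set.image_image]
  refine Set.image_congr fun x _ => ?_
  rw [hfb, smul_add, Matrix.mulVec_smul]
  congr 1
  ext i
  simp [castVec]

theorem IsUnimodular.latticeCount_smul_image {f : (Fin n → ℝ) → (Fin n → ℝ)}
    (hf : IsUnimodular f) (m : ℕ) (X : Set (Fin n → ℝ)) :
    latticeCount ((m : ℝ) • f '' X) = latticeCount ((m : ℝ) • X) := by
  obtain ⟨g, hg, h⟩ := hf.exists_smul_image m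
  rw [h, hg.latticeCount_image]

theorem latticeCount_smul_iUnion {ι : Type*} [Fintype ι] {X : ι → Set (Fin n → ℝ)}
    (hb : Bornology.IsBounded (⋃ t, X t)) (hd : Pairwise (Function.onFun Disjoint X)) {m : ℕ}
    (hm : 1 ≤ m) :
    latticeCount ((m : ℝ) • ⋃ t, X t) = ∑ t, latticeCount ((m : ℝ) • X t) := by
  have hm0 : (m : ℝ) ≠ 0 := by exact_mod_cast (Nat.pos_of_ne_zero (by omega)).ne'
  have e : {y : Fin n → ℤ | castVec y ∈ (m : ℝ) • ⋃ t, X t} =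
      ⋃ t, {y | castVec y ∈ (m : ℝ) • X t} := by
    ext y
    simp [Set.smul_set_iUnion]
  refine (congrArg Set.ncard e).trans ((Set.ncard_iUnion_of_finite (fun t => ?_) ?_).trans
    (finsum_eq_sum_of_fintype _))
  · exact finite_lattice_points ((hb.subset (Set.subset_iUnion X t)).smul₀ _)
  · intro s t hst
    refine Set.disjoint_left.2 fun y hs ht => ?_
    have hs' := (Set.mem_smul_set_iff_inv_smul_mem₀ hm0 _ _).1 hs
    have ht' := (Set.mem_smul_set_iff_inv_smul_mem₀ hm0 _ _).1 ht
    exact Set.disjoint_left.1 (hd hst) hs' ht'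

theorem latticeCount_smul_of_decomposition {ι : Type*} [Fintype ι] {k : ι → Fin 7}
    {f : ι → (Fin 3 → ℝ) → (Fin 3 → ℝ)} (hf : ∀ t, IsUnimodular (f t))
    (hd : Pairwise (Function.onFun Disjoint fun t => f t '' openStd (k t)))
    (hb : Bornology.IsBounded (⋃ t, f t '' openStd (k t))) {m : ℕ} (hm : 1 ≤ m) :
    latticeCount ((m : ℝ) • ⋃ t, f t '' openStd (k t)) =
      ∑ a, Fintype.card {t // k t = a} * latticeCount ((m : ℝ) • openStd (a : Fin 7)) := by
  rw [latticeCount_smul_iUnion hb hd hm]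
  simp only [(hf _).latticeCount_smul_image]
  rw [← Fintype.sum_fiberwise k]
  refine Finset.sum_congr rfl fun a _ => ?_
  rw [Finset.sum_congr rfl fun t _ => by rw [t.2], Finset.sum_const, Finset.card_univ, smul_eq_mul]

theorem eq_of_triangular {n : ℕ} {c c' : Fin n → ℕ} {M : Fin n → Fin n → ℕ}
    (hM : ∀ a b, a < b → M a b = 0) (hM1 : ∀ a, M a a = 1)
    (h : ∀ a, ∑ b, c b * M a b = ∑ b, c' b * M a b) : c = c' := by
  funext a
  induction a using WellFoundedLT.induction with
  | ind a ih =>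
    have ha := h a
    rw [← Finset.add_sum_erase _ _ (Finset.mem_univ a),
      ← Finset.add_sum_erase _ (fun b => c' b * M a b) (Finset.mem_univ a)] at ha
    have e : ∀ b ∈ Finset.univ.erase a, c b * M a b = c' b * M a b := fun b hb => by
      rcases lt_or_gt_of_ne (Finset.ne_of_mem_erase hb) with hlt | hlt
      · rw [ih b hlt]
      · rw [hM a b hlt, mul_zero, mul_zero]
    rw [Finset.sum_congr rfl e, hM1, mul_one, mul_one] at ha
    exact Nat.add_right_cancel ha

theorem exists_equiv_of_latticeCount_eq {ι ι' : Type*} [Fintype ι] [Fintype ι'] {k : ι → Fin 7}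
    {k' : ι' → Fin 7} {f : ι → (Fin 3 → ℝ) → (Fin 3 → ℝ)} {f' : ι' → (Fin 3 → ℝ) → (Fin 3 → ℝ)}
    (hf : ∀ t, IsUnimodular (f t)) (hf' : ∀ t, IsUnimodular (f' t))
    (hd : Pairwise (Function.onFun Disjoint fun t => f t '' openStd (k t)))
    (hd' : Pairwise (Function.onFun Disjoint fun t => f' t '' openStd (k' t)))
    (hb : Bornology.IsBounded (⋃ t, f t '' openStd (k t)))
    (hb' : Bornology.IsBounded (⋃ t, f' t '' openStd (k' t)))
    (h : ∀ m : ℕ, 1 ≤ m → latticeCount ((m : ℝ) • ⋃ t, f t '' openStd (k t)) =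
      latticeCount ((m : ℝ) • ⋃ t, f' t '' openStd (k' t))) :
    ∃ e : ι ≃ ι', ∀ t, k' (e t) = k t := by
  classical
  have hc : (fun a => Fintype.card {t // k t = a}) = fun a => Fintype.card {t // k' t = a} := by
    refine eq_of_triangular
      (M := fun a b => latticeCount (((a + 1 : ℕ) : ℝ) • openStd (b : Fin 7))) (fun a b hab => ?_)
      (fun a => latticeCount_smul_openStd_succ a.2) fun a => ?_
    · exact latticeCount_smul_openStd_of_le b.2 (Nat.succ_pos _) hab
    · have := h (a + 1) (Nat.succ_pos _)
      rwa [latticeCount_smul_of_decomposition hf hd hb (Nat.succ_pos _),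
        latticeCount_smul_of_decomposition hf' hd' hb' (Nat.succ_pos _)] at this
  exact ⟨Equiv.ofFiberEquiv fun a => Fintype.equivOfCardEq (congrFun hc a),
    Equiv.ofFiberEquiv_map _⟩

end LatticeCount

section ClosedSimplex

theorem intrinsicInterior_convexHull_range {n : ℕ} {κ : Type*} [Fintype κ] {v : κ → Fin n → ℝ}
    (hv : ∀ μ : κ → ℝ, ∑ j, μ j = 0 → ∑ j, μ j • v j = 0 → μ = 0) :
    intrinsicInterior ℝ (convexHull ℝ (Set.range v)) = openHull v := by
  classical
  let T : (κ → ℝ) →ₗ[ℝ] ℝ × (Fin n → ℝ) :=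
    { toFun := fun μ => (∑ j, μ j, ∑ j, μ j • v j)
      map_add' := fun μ ν => by simp [Finset.sum_add_distrib, add_smul]
      map_smul' := fun c μ => by simp [Finset.mul_sum, Finset.smul_sum, mul_smul] }
  have hT : LinearMap.ker T = ⊥ := (LinearMap.ker_eq_bot').2 fun μ hμ =>
    hv μ (congrArg Prod.fst hμ) (congrArg Prod.snd hμ)
  obtain ⟨L, hL⟩ := T.exists_leftInverse_of_injective hT
  have hcoord : ∀ μ : κ → ℝ, ∑ j, μ j = 1 → L (1, ∑ j, μ j • v j) = μ := fun μ h1 => by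
    have := LinearMap.congr_fun hL μ
    change L (∑ j, μ j, ∑ j, μ j • v j) = μ at this
    rwa [h1] at this
  have hcont : Continuous fun x : Fin n → ℝ => L (1, x) :=
    (LinearMap.continuous_of_finiteDimensional L).comp (by fun_prop)
  ext x
  rw [mem_intrinsicInterior]
  constructor
  · rintro ⟨y, hy, rfl⟩
    obtain ⟨μ, h0, h1, h2⟩ := mem_convexHull_range_iff.1
      (interior_subset hy : y ∈ Subtype.val ⁻¹' convexHull ℝ (Set.range v))
    refine ⟨μ, fun j => lt_of_le_of_ne (h0 j) fun hj => ?_, h1, h2⟩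
    have hvj : v j ∈ affineSpan ℝ (convexHull ℝ (Set.range v)) :=
      subset_affineSpan ℝ _ (subset_convexHull ℝ _ ⟨j, rfl⟩)
    let γ : ℝ → affineSpan ℝ (convexHull ℝ (Set.range v)) := fun t =>
      ⟨AffineMap.lineMap y.1 (v j) t, AffineMap.lineMap_mem t y.2 hvj⟩
    have hγ : Continuous γ := by
      refine Continuous.subtype_mk ?_ _
      exact AffineMap.lineMap_continuous
    have h3 : γ ⁻¹' interior (Subtype.val ⁻¹' convexHull ℝ (Set.range v)) ∈ nhds (0 : ℝ) := by
      refine (isOpen_interior.preimage hγ).mem_nhds ?_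
      have : γ 0 = y := Subtype.ext (AffineMap.lineMap_apply_zero _ _)
      rwa [Set.mem_preimage, this]
    obtain ⟨ε, hε, hball⟩ := Metric.mem_nhds_iff.1 h3
    have h4 := interior_subset (hball (show -(ε / 2) ∈ Metric.ball (0 : ℝ) ε by
      rw [mem_ball_zero_iff, norm_neg, Real.norm_of_nonneg (by positivity)]
      linarith))
    obtain ⟨ν, hν0, hν1, hν2⟩ := mem_convexHull_range_iff.1 h4
    have h5 : ν = fun l => (1 + ε / 2) * μ l - ε / 2 * (Pi.single j 1 : κ → ℝ) l := by
      have e : L (1, ∑ l, ν l • v l) = (1 + ε / 2) • L (1, y.1) - (ε / 2) • L (1, v j) := by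
        rw [← map_smul, ← map_smul, ← map_sub, hν2]
        congr 1
        ext
        · simp
        · simp [γ, AffineMap.lineMap_apply]
          ring
      have e1 : L (1, v j) = Pi.single j 1 := by
        rw [← hcoord (Pi.single j 1) (by simp)]
        simp [Pi.single_apply, ite_smul]
      rw [hcoord ν hν1, ← h2, hcoord μ h1, e1] at e
      rw [e]
      rfl
    have := hν0 j
    rw [h5] at this
    simp [← hj] at this
    linarith
  · rintro ⟨μ, h0, h1, rfl⟩
    have hx : ∑ j, μ j • v j ∈ convexHull ℝ (Set.range v) :=
      mem_convexHull_range_iff.2 ⟨μ, fun j => (h0 j).le, h1, rfl⟩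
    refine ⟨⟨_, subset_affineSpan ℝ _ hx⟩, ?_, rfl⟩
    rw [mem_interior]
    refine ⟨{y | ∀ j, 0 < L (1, y.1) j}, ?_, ?_, ?_⟩
    · rintro ⟨y, hy⟩ hpos
      rw [affineSpan_convexHull] at hy
      obtain ⟨w, hw1, hwy⟩ := eq_affineCombination_of_mem_affineSpan_of_fintype hy
      rw [Finset.affineCombination_eq_linear_combination _ _ _ hw1] at hwy
      refine mem_convexHull_range_iff.2 ⟨w, fun j => ?_, hw1, hwy.symm⟩
      rw [← hcoord w hw1, ← hwy]
      exact (hpos j).le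
    · simp only [Set.ofPred_forall]
      exact isOpen_iInter_of_finite fun j => isOpen_lt continuous_const (by fun_prop)
    · simpa [hcoord μ h1] using h0

/-- The `k`-th standard closed half-unimodular simplex. -/
def closedStd (k : ℕ) : Set (Fin 3 → ℝ) :=
  convexHull ℝ (Set.range fun j : Fin (k / 2 + 1) => (1 / 2 : ℝ) • castVec (stdVertex k j))

theorem intrinsicInterior_closedStd {k : ℕ} (hk : k < 7) :
    intrinsicInterior ℝ (closedStd k) = openStd k := by
  refine intrinsicInterior_convexHull_range fun μ h0 h1 => ?_
  have e : ∀ i : Fin 3, ∑ j, μ j * (if (i : ℕ) + 1 = j then 1 else 0) = 0 := fun i => by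
    have h := congrFun h1 i
    simp only [Finset.sum_apply, Pi.smul_apply, castVec, stdVertex, smul_eq_mul, Int.cast_add,
      Int.cast_ite, Int.cast_one, Int.cast_zero, Pi.zero_apply] at h
    have h' : ∑ j, μ j * (1 / 2 * ((if (i : ℕ) + 1 = j then (1 : ℝ) else 0) +
        if i = 2 then (((k % 2 : ℕ) : ℤ) : ℝ) else 0)) =
        1 / 2 * ∑ j, μ j * (if (i : ℕ) + 1 = j then 1 else 0) +
          1 / 2 * (if i = 2 then (((k % 2 : ℕ) : ℤ) : ℝ) else 0) * ∑ j, μ j := by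
      rw [Finset.mul_sum, Finset.mul_sum, ← Finset.sum_add_distrib]
      exact Finset.sum_congr rfl fun j _ => by ring
    rw [h', h0] at h
    linarith
  have hsucc : ∀ j : Fin (k / 2), μ j.succ = 0 := fun j => by
    have := e ⟨j, by omega⟩
    rwa [Finset.sum_eq_single j.succ (fun l _ hl => by
      rw [if_neg fun h => hl (Fin.ext h.symm), mul_zero]) (by simp),
      if_pos (Fin.val_succ j).symm, mul_one] at this
  rw [Fin.sum_univ_succ, Finset.sum_eq_zero fun j _ => hsucc j, add_zero] at h0
  exact funext (Fin.cases h0 hsucc)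

theorem two_smul_closedStd {k : ℕ} (hk : k < 7) :
    ∃ f, IsUnimodular f ∧ (2 : ℝ) • closedStd k = f '' baseSimplex 3 (k / 2) := by
  refine ⟨_, isUnimodular_mulVec_add 1 (by simp)
    fun i => if i = 2 then ((k % 2 : ℕ) : ℤ) else 0, ?_⟩
  obtain ⟨φ, hφ⟩ := (isUnimodular_mulVec_add (1 : Matrix (Fin 3) (Fin 3) ℤ) (by simp)
    fun i => if i = 2 then ((k % 2 : ℕ) : ℤ) else 0).exists_affineEquiv
  rw [← hφ, baseSimplex, closedStd, ← convexHull_smul]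
  refine Eq.trans ?_ (φ.toAffineMap.image_convexHull _).symm
  congr 1
  change _ = φ '' _
  rw [hφ]
  ext x
  constructor
  · rintro ⟨_, ⟨j, rfl⟩, rfl⟩
    induction j using Fin.cases with
    | zero =>
      refine ⟨0, Or.inl rfl, ?_⟩
      ext i
      simp [castVec, stdVertex]
    | succ j =>
      refine ⟨_, Or.inr ⟨⟨j, by omega⟩, j.2, rfl⟩, ?_⟩
      ext i
      simp [castVec, stdVertex, Matrix.one_apply, Fin.ext_iff]
  · rintro ⟨_, rfl | ⟨j, hj, rfl⟩, rfl⟩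
    · refine ⟨_, ⟨0, rfl⟩, ?_⟩
      ext i
      simp [castVec, stdVertex]
    · refine ⟨_, ⟨⟨j + 1, Nat.succ_lt_succ hj⟩, rfl⟩, ?_⟩
      ext i
      simp [castVec, stdVertex, Matrix.one_apply, Fin.ext_iff]

theorem IsUnimodular.isHalfUnimodular_image {f : (Fin 3 → ℝ) → (Fin 3 → ℝ)} (hf : IsUnimodular f)
    {k : ℕ} (hk : k < 7) : IsHalfUnimodular (f '' closedStd k) := by
  obtain ⟨g, hg, h⟩ := hf.exists_smul_image 2
  obtain ⟨g', hg', h'⟩ := two_smul_closedStd hk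
  refine ⟨k / 2, by omega, g ∘ g', hg.comp hg', ?_⟩
  rw [Set.image_comp, ← h']
  exact h _

theorem IsUnimodular.intrinsicInterior_image {f : (Fin 3 → ℝ) → (Fin 3 → ℝ)}
    (hf : IsUnimodular f) {k : ℕ} (hk : k < 7) :
    intrinsicInterior ℝ (f '' closedStd k) = f '' openStd k := by
  obtain ⟨φ, rfl⟩ := hf.exists_affineEquiv
  rw [φ.intrinsicInterior_image, intrinsicInterior_closedStd hk]

end ClosedSimplex

/-- Ehrhart-equivalent 3-dimensional lattice polytopes in `ℝ³` are
GL(ℤ)-equidecomposable into relatively open half-unimodular simplices. -/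
theorem ehrhart_equivalent_implies_equidecomposable
    (P P' : Set (Fin 3 → ℝ))
    (hP : IsLatticePolytope3 P) (hP' : IsLatticePolytope3 P')
    (hdim : affineSpan ℝ P = ⊤) (hdim' : affineSpan ℝ P' = ⊤)
    (hEhr : ∀ k : ℕ, 1 ≤ k → latticeCount ((k : ℝ) • P) = latticeCount ((k : ℝ) • P')) :
    ∃ (r : ℕ) (Δ : Fin r → Set (Fin 3 → ℝ)) (U : Fin r → (Fin 3 → ℝ) → (Fin 3 → ℝ)),
      (∀ t, IsHalfUnimodular (Δ t)) ∧ (∀ t, IsUnimodular (U t)) ∧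
      Pairwise (Function.onFun Disjoint fun t => intrinsicInterior ℝ (Δ t)) ∧
      P = ⋃ t, intrinsicInterior ℝ (Δ t) ∧
      Pairwise (Function.onFun Disjoint fun t => U t '' intrinsicInterior ℝ (Δ t)) ∧
      P' = ⋃ t, U t '' intrinsicInterior ℝ (Δ t) := by
  obtain ⟨ι, _, k, f, hf, hd, hPf⟩ := hP.good
  obtain ⟨ι', _, k', f', hf', hd', hPf'⟩ := hP'.good
  obtain ⟨e, he⟩ := exists_equiv_of_latticeCount_eq hf hf' hd hd' (hPf ▸ hP.isBounded)
    (hPf' ▸ hP'.isBounded) (hPf ▸ hPf' ▸ hEhr)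
  choose g hg hgl hgr using fun t => (hf t).exists_inverse
  let E := (Fintype.equivFin ι).symm
  have hU : ∀ t, (f' (e t) ∘ g t) '' (f t '' openStd (k t)) =
      f' (e t) '' openStd (k' (e t)) := fun t => by
    rw [Set.image_comp, (hgl t).image_image, he]
  refine ⟨Fintype.card ι, fun t => f (E t) '' closedStd (k (E t)), fun t => f' (e (E t)) ∘ g (E t),
    fun t => (hf _).isHalfUnimodular_image (k _).2, fun t => (hf' _).comp (hg _), ?_⟩
  simp only [(hf _).intrinsicInterior_image (k _).2, hU]
  refine ⟨hd.comp_of_injective E.injective, hPf.trans ?_,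
    hd'.comp_of_injective (E.trans e).injective, hPf'.trans ?_⟩
  · exact (E.surjective.iUnion_comp _).symm
  · exact ((E.trans e).surjective.iUnion_comp fun t => f' t '' openStd (k' t)).symm
end

section
/- Every half-unimodular simplex in ℝ³ is the image under a unimodular transformation of exactly one of the following nine simplices: Δ_0^1, Δ_1^1, Δ_2^1, Δ_3^1, Δ_0^0, Δ_1^0, Δ_2^0, Δ'_2, Δ'_3. -/
open Pointwise

/-- `Δ_i^1 = ½·conv(0, e_1, …, e_i)` in `ℝ^n`. -/
noncomputable def Δone (n i : ℕ) : Set (Fin n → ℝ) := (2⁻¹ : ℝ) • baseSimplex n i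

/-- `Δ_i^0 = ½·conv(e_1, …, e_{i+1})` in `ℝ^n`. -/
noncomputable def Δzero (n i : ℕ) : Set (Fin n → ℝ) :=
  (2⁻¹ : ℝ) •
    convexHull ℝ ((fun j : Fin n => (Pi.single j 1 : Fin n → ℝ)) '' {j | (j : ℕ) < i + 1})

/-- `Δ'_2 = (½,½,0) + ½·conv(0, e_1, e_2)` in `ℝ³`. -/
noncomputable def Δ'two : Set (Fin 3 → ℝ) := (![1/2, 1/2, 0] : Fin 3 → ℝ) +ᵥ Δone 3 2

/-- `Δ'_3 = (½,½,0) + ½·conv(0, e_1, e_2, e_3)` in `ℝ³`. -/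
noncomputable def Δ'three : Set (Fin 3 → ℝ) := (![1/2, 1/2, 0] : Fin 3 → ℝ) +ᵥ Δone 3 3

/-- The nine half-unimodular simplices `Δ_0^1, Δ_1^1, Δ_2^1, Δ_3^1, Δ_0^0, Δ_1^0, Δ_2^0, Δ'_2, Δ'_3`. -/
noncomputable def nineSimplices : Fin 9 → Set (Fin 3 → ℝ) :=
  ![Δone 3 0, Δone 3 1, Δone 3 2, Δone 3 3, Δzero 3 0, Δzero 3 1, Δzero 3 2, Δ'two, Δ'three]

/-- The integer affine map `v ↦ A·v + b`. -/
def intAffine (A : Matrix (Fin 3) (Fin 3) ℤ) (b v : Fin 3 → ℤ) : Fin 3 → ℤ :=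
  A.mulVec v + b

/-- The real affine map `x ↦ A·x + b` with integer coefficients. -/
noncomputable def realAffine (A : Matrix (Fin 3) (Fin 3) ℤ) (b : Fin 3 → ℤ) :
    (Fin 3 → ℝ) →ᵃ[ℝ] (Fin 3 → ℝ) :=
  (Matrix.mulVecLin (A.map (Int.cast : ℤ → ℝ))).toAffineMap +
    AffineMap.const ℝ _ fun k => (b k : ℝ)

/-- The inclusion `ℤ³ → ℝ³`. -/
def toReal (v : Fin 3 → ℤ) : Fin 3 → ℝ := fun k => (v k : ℝ)

/-- The lattice polytope in `ℝ³` spanned by finitely many integer points. -/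
def latticeHull (V : Finset (Fin 3 → ℤ)) : Set (Fin 3 → ℝ) :=
  convexHull ℝ (toReal '' (V : Set (Fin 3 → ℤ)))

/-- The vertices of `conv(0, e_1, …, e_i)`. -/
def baseVertices (i : ℕ) : Finset (Fin 3 → ℤ) :=
  insert 0 ((Finset.univ.filter fun j : Fin 3 => (j : ℕ) < i).image fun j => Pi.single j 1)

/-- The vertices of `conv(e_1, …, e_{i+1})`. -/
def facetVertices (i : ℕ) : Finset (Fin 3 → ℤ) :=
  (Finset.univ.filter fun j : Fin 3 => (j : ℕ) < i + 1).image fun j => Pi.single j 1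

/-- The vertices of the doubled simplices `2 • nineSimplices j`. -/
def nineVertices : Fin 9 → Finset (Fin 3 → ℤ) :=
  ![baseVertices 0, baseVertices 1, baseVertices 2, baseVertices 3,
    facetVertices 0, facetVertices 1, facetVertices 2,
    (baseVertices 2).image (![1, 1, 0] + ·), (baseVertices 3).image (![1, 1, 0] + ·)]

lemma toReal_injective : Function.Injective toReal := fun v w h => by
  ext k
  have := congrFun h k
  simpa [toReal] using this

lemma toReal_single (j : Fin 3) : toReal (Pi.single j 1) = Pi.single j 1 := by
  ext k
  by_cases h : k = j
  · subst h; simp [toReal]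
  · simp [toReal, h]

lemma realAffine_apply (A : Matrix (Fin 3) (Fin 3) ℤ) (b : Fin 3 → ℤ) (x : Fin 3 → ℝ) :
    realAffine A b x =
      (A.map (Int.cast : ℤ → ℝ)).mulVec x + fun k => (b k : ℝ) := rfl

lemma realAffine_toReal (A : Matrix (Fin 3) (Fin 3) ℤ) (b v : Fin 3 → ℤ) :
    realAffine A b (toReal v) = toReal (intAffine A b v) := by
  ext k
  simp [realAffine_apply, toReal, intAffine, Matrix.mulVec, dotProduct]

lemma isUnimodular_realAffine {A : Matrix (Fin 3) (Fin 3) ℤ} (hA : IsUnit A.det)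
    (b : Fin 3 → ℤ) : IsUnimodular (realAffine A b) :=
  ⟨A, hA, b, fun _ => rfl⟩

lemma IsUnimodular.exists_eq_realAffine {f : (Fin 3 → ℝ) → Fin 3 → ℝ} (hf : IsUnimodular f) :
    ∃ A : Matrix (Fin 3) (Fin 3) ℤ, IsUnit A.det ∧ ∃ b, f = realAffine A b := by
  obtain ⟨A, hA, b, h⟩ := hf
  exact ⟨A, hA, b, funext h⟩

lemma realAffine_image_latticeHull (A : Matrix (Fin 3) (Fin 3) ℤ) (b : Fin 3 → ℤ)
    (V : Finset (Fin 3 → ℤ)) :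
    realAffine A b '' latticeHull V = latticeHull (V.image (intAffine A b)) := by
  rw [latticeHull, AffineMap.image_convexHull, latticeHull, Finset.coe_image, Set.image_image,
    Set.image_image]
  simp only [realAffine_toReal]

lemma realAffine_image_half (A : Matrix (Fin 3) (Fin 3) ℤ) (b : Fin 3 → ℤ)
    (S : Set (Fin 3 → ℝ)) :
    realAffine A b '' ((2⁻¹ : ℝ) • S) = (2⁻¹ : ℝ) • (realAffine A (2 • b) '' S) := by
  simp only [← Set.image_smul, Set.image_image]
  refine Set.image_congr fun x _ => ?_
  ext k
  simp [realAffine_apply, Matrix.mulVec_smul, mul_add]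

lemma baseSimplex_eq_latticeHull (i : ℕ) : baseSimplex 3 i = latticeHull (baseVertices i) := by
  have h0 : toReal 0 = 0 := by ext; simp [toReal]
  simp [baseSimplex, latticeHull, baseVertices, Set.image_insert_eq, Set.image_image,
    toReal_single, h0]

lemma Δone_eq_half_latticeHull (i : ℕ) :
    Δone 3 i = (2⁻¹ : ℝ) • latticeHull (baseVertices i) := by
  rw [Δone, baseSimplex_eq_latticeHull]

lemma Δzero_eq_half_latticeHull (i : ℕ) :
    Δzero 3 i = (2⁻¹ : ℝ) • latticeHull (facetVertices i) := by
  simp [Δzero, latticeHull, facetVertices, Set.image_image, toReal_single]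

lemma vadd_Δone_eq_half_latticeHull (i : ℕ) :
    (![1/2, 1/2, 0] : Fin 3 → ℝ) +ᵥ Δone 3 i =
      (2⁻¹ : ℝ) • latticeHull ((baseVertices i).image (![1, 1, 0] + ·)) := by
  have h : (![1, 1, 0] + · : (Fin 3 → ℤ) → Fin 3 → ℤ) = intAffine 1 ![1, 1, 0] := by
    ext v : 1
    simp [intAffine, add_comm]
  rw [h, ← realAffine_image_latticeHull, Δone_eq_half_latticeHull]
  simp only [← Set.image_smul, ← Set.image_vadd, Set.image_image]
  refine Set.image_congr fun x _ => ?_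
  ext k
  fin_cases k <;> simp [realAffine_apply] <;> ring

lemma nineSimplices_eq_half_latticeHull (j : Fin 9) :
    nineSimplices j = (2⁻¹ : ℝ) • latticeHull (nineVertices j) := by
  fin_cases j
  · exact Δone_eq_half_latticeHull 0
  · exact Δone_eq_half_latticeHull 1
  · exact Δone_eq_half_latticeHull 2
  · exact Δone_eq_half_latticeHull 3
  · exact Δzero_eq_half_latticeHull 0
  · exact Δzero_eq_half_latticeHull 1
  · exact Δzero_eq_half_latticeHull 2
  · exact vadd_Δone_eq_half_latticeHull 2
  · exact vadd_Δone_eq_half_latticeHull 3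

lemma realAffine_image_nineSimplices (A : Matrix (Fin 3) (Fin 3) ℤ) (b : Fin 3 → ℤ) (j : Fin 9) :
    realAffine A b '' nineSimplices j =
      (2⁻¹ : ℝ) • latticeHull ((nineVertices j).image (intAffine A (2 • b))) := by
  rw [nineSimplices_eq_half_latticeHull, realAffine_image_half, realAffine_image_latticeHull]

lemma intAffine_intAffine (A U : Matrix (Fin 3) (Fin 3) ℤ) (b d v : Fin 3 → ℤ) :
    intAffine A b (intAffine U d v) = intAffine (A * U) (A.mulVec d + b) v := by
  simp [intAffine, Matrix.mulVec_add, Matrix.mulVec_mulVec, add_assoc]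

lemma intAffine_injective {A : Matrix (Fin 3) (Fin 3) ℤ} (hA : IsUnit A.det) (b : Fin 3 → ℤ) :
    Function.Injective (intAffine A b) := fun _ _ h =>
  Matrix.mulVec_injective_of_isUnit ((Matrix.isUnit_iff_isUnit_det A).2 hA) (add_right_cancel h)

/-! ### Existence -/

/-- Every translate of a base simplex by a `0/1` vector is equivalent to one of the nine. -/
lemma exists_nineVertices_of_translate : ∀ (i : Fin 4) (b : Fin 3 → Fin 2),
    ∃ p ∈ ([(1, 0),
      (!![0, 1, 0; 0, 0, 1; -1, -1, -1], ![0, 0, 1]),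
      (!![0, 1, 0; 0, 0, 1; -1, -1, -1], ![0, 0, 2]),
      (!![0, 1, 0; -1, -1, -1; 0, 0, 1], ![0, 1, 0]),
      (!![-1, -1, -1; 0, 1, 0; 0, 0, 1], ![1, 0, 0]),
      (!![-1, 0, -1; 0, 0, 1; -1, -1, -1], ![1, 0, 1]),
      (!![0, 1, 0; -1, -1, 0; -1, -1, -1], ![0, 1, 1]),
      (!![-1, 0, -1; -1, -1, 0; -1, -1, -1], ![1, 1, 1]),
      (!![-1, 0, 0; -1, -1, 0; 0, 0, -1], ![1, 1, 0]),
      (!![0, 0, 1; 0, 1, 0; 1, 0, 0], ![0, 0, 0]),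
      (!![-1, -1, -1; 0, 1, 0; 1, 0, 0], ![2, 0, 0])] :
        List (Matrix (Fin 3) (Fin 3) ℤ × (Fin 3 → ℤ))), IsUnit p.1.det ∧ ∃ j,
      (baseVertices i).image (intAffine 1 fun k => ((b k : ℕ) : ℤ)) =
        (nineVertices j).image (intAffine p.1 (2 • p.2)) := by
  simp only [Matrix.det_fin_three, Int.isUnit_iff]
  decide +kernel

lemma exists_nineVertices {i : ℕ} (hi : i ≤ 3) {A : Matrix (Fin 3) (Fin 3) ℤ}
    (hA : IsUnit A.det) (b : Fin 3 → ℤ) :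
    ∃ j, ∃ M : Matrix (Fin 3) (Fin 3) ℤ, IsUnit M.det ∧ ∃ d : Fin 3 → ℤ,
      (baseVertices i).image (intAffine A b) =
        (nineVertices j).image (intAffine M (2 • d)) := by
  set s := A⁻¹.mulVec b
  have hb : A.mulVec s = b := by
    simp [s, Matrix.mulVec_mulVec, Matrix.mul_nonsing_inv A hA]
  obtain ⟨⟨U, c⟩, -, hU, j, hj⟩ := exists_nineVertices_of_translate ⟨i, by omega⟩
    fun k => ⟨(s k % 2).toNat, by omega⟩
  set t : Fin 3 → ℤ := fun k => s k / 2
  refine ⟨j, A * U, by rw [Matrix.det_mul]; exact hA.mul hU, A.mulVec (c + t), ?_⟩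
  have hr : (fun k => (((s k % 2).toNat : ℕ) : ℤ)) = s - 2 • t := by
    ext k
    change _ = s k - 2 • (s k / 2)
    rw [nsmul_eq_mul]
    omega
  simp only [hr] at hj
  have key := congrArg (Finset.image (intAffine A (A.mulVec (2 • t)))) hj
  simp only [Finset.image_image, Function.comp_def, intAffine_intAffine] at key
  rw [← Matrix.mulVec_add, ← Matrix.mulVec_add, sub_add_cancel, hb, mul_one, ← smul_add,
    Matrix.mulVec_smul] at key
  exact key

/-! ### Uniqueness -/

instance (v : Fin 3 → ℤ) : Decidable (Even v) :=
  decidable_of_iff (∀ k, Even (v k))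
    ⟨fun h => ⟨fun k => (h k).choose, funext fun k => (h k).choose_spec⟩,
      fun ⟨r, hr⟩ k => ⟨r k, congrFun hr k⟩⟩

/-- The number of points, whether one of them is even, and whether their sum is even. -/
def parityType (V : Finset (Fin 3 → ℤ)) : ℕ × Bool × Bool :=
  (V.card, decide (∃ v ∈ V, Even v), decide (Even (∑ v ∈ V, v)))

lemma parityType_nineVertices_injective :
    Function.Injective fun j => parityType (nineVertices j) := by
  unfold Function.Injective
  decide +kernel

lemma even_intAffine_iff {A : Matrix (Fin 3) (Fin 3) ℤ} (hA : IsUnit A.det) (d v : Fin 3 → ℤ) :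
    Even (intAffine A (2 • d) v) ↔ Even v := by
  rw [intAffine]
  constructor
  · rintro ⟨r, hr⟩
    refine ⟨A⁻¹.mulVec (r - d), ?_⟩
    rw [← Matrix.mulVec_add, show r - d + (r - d) = A.mulVec v by
      rw [eq_sub_of_add_eq hr, two_smul]; abel,
      Matrix.mulVec_mulVec, Matrix.nonsing_inv_mul A hA, Matrix.one_mulVec]
  · rintro ⟨r, rfl⟩
    exact ⟨A.mulVec r + d, by rw [Matrix.mulVec_add, two_smul]; abel⟩

lemma parityType_image {A : Matrix (Fin 3) (Fin 3) ℤ} (hA : IsUnit A.det) (d : Fin 3 → ℤ)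
    (V : Finset (Fin 3 → ℤ)) :
    parityType (V.image (intAffine A (2 • d))) = parityType V := by
  have hinj := intAffine_injective hA (2 • d)
  have hsum : ∑ v ∈ V, intAffine A (2 • d) v =
      intAffine A (2 • (V.card • d)) (∑ v ∈ V, v) := by
    simp only [intAffine, Finset.sum_add_distrib, Finset.sum_const, Matrix.mulVec_sum]
    rw [smul_comm]
  simp only [parityType, Finset.card_image_of_injective V hinj, Finset.exists_mem_image,
    Finset.sum_image hinj.injOn, hsum, even_intAffine_iff hA]

lemma extremePoints_latticeHull_of_subset_cube {V : Finset (Fin 3 → ℤ)} {a : Fin 3 → ℤ}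
    (hV : ∀ v ∈ V, ∀ k, v k = a k ∨ v k = a k + 1) :
    (latticeHull V).extremePoints ℝ = toReal '' V := by
  refine extremePoints_convexHull_subset.antisymm ?_
  have hsub : latticeHull V ⊆ Set.univ.pi fun k => Set.Icc (a k : ℝ) (a k + 1) := by
    refine convexHull_min ?_ (convex_pi fun k _ => convex_Icc _ _)
    rintro _ ⟨v, hv, rfl⟩ k -
    rcases hV v hv k with h | h <;> simp [toReal, h]
  rintro _ ⟨v, hv, rfl⟩
  refine inter_extremePoints_subset_extremePoints_of_subset hsub
    ⟨subset_convexHull ℝ _ ⟨v, hv, rfl⟩, ?_⟩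
  rw [extremePoints_pi]
  intro k _
  beta_reduce
  rw [Set.extremePoints_Icc (by linarith)]
  rcases hV v hv k with h | h <;> simp [toReal, h]

lemma extremePoints_latticeHull_nineVertices (j : Fin 9) :
    (latticeHull (nineVertices j)).extremePoints ℝ = toReal '' nineVertices j := by
  have h : ∀ j, ∃ a ∈ [0, ![1, 1, 0]], ∀ v ∈ nineVertices j, ∀ k, v k = a k ∨ v k = a k + 1 := by
    decide +kernel
  obtain ⟨a, -, ha⟩ := h j
  exact extremePoints_latticeHull_of_subset_cube ha

lemma AffineMap.image_extremePoints_of_injective {E F : Type*} [AddCommGroup E] [Module ℝ E]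
    [AddCommGroup F] [Module ℝ F] {f : E →ᵃ[ℝ] F} (hf : Function.Injective f) (S : Set E) :
    f '' S.extremePoints ℝ = (f '' S).extremePoints ℝ := by
  have key (x : E) : f x ∈ (f '' S).extremePoints ℝ ↔ x ∈ S.extremePoints ℝ := by
    simp only [mem_extremePoints_iff_left, Set.forall_mem_image, ← image_openSegment,
      hf.mem_set_image, hf.eq_iff]
  ext y
  constructor
  · rintro ⟨x, hx, rfl⟩
    exact (key x).2 hx
  · intro hy
    obtain ⟨x, -, rfl⟩ := extremePoints_subset hy
    exact ⟨x, (key x).1 hy, rfl⟩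

lemma realAffine_injective {A : Matrix (Fin 3) (Fin 3) ℤ} (hA : IsUnit A.det) (b : Fin 3 → ℤ) :
    Function.Injective (realAffine A b) := by
  have hdet : IsUnit (A.map (Int.cast : ℤ → ℝ)).det := by
    have := hA.map (Int.castRingHom ℝ)
    rwa [RingHom.map_det] at this
  exact fun _ _ h => Matrix.mulVec_injective_of_isUnit
    ((Matrix.isUnit_iff_isUnit_det _).2 hdet) (add_right_cancel h)

lemma extremePoints_latticeHull_image {A : Matrix (Fin 3) (Fin 3) ℤ} (hA : IsUnit A.det)
    (b : Fin 3 → ℤ) (j : Fin 9) :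
    (latticeHull ((nineVertices j).image (intAffine A b))).extremePoints ℝ =
      toReal '' ((nineVertices j).image (intAffine A b)) := by
  rw [← realAffine_image_latticeHull,
    ← AffineMap.image_extremePoints_of_injective (realAffine_injective hA b),
    extremePoints_latticeHull_nineVertices, Finset.coe_image, Set.image_image, Set.image_image]
  simp only [realAffine_toReal]

lemma eq_of_realAffine_image_eq {A B : Matrix (Fin 3) (Fin 3) ℤ} (hA : IsUnit A.det)
    (hB : IsUnit B.det) {b c : Fin 3 → ℤ} {j l : Fin 9}
    (h : realAffine A b '' nineSimplices j = realAffine B c '' nineSimplices l) : j = l := by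
  rw [realAffine_image_nineSimplices, realAffine_image_nineSimplices] at h
  replace h := congrArg ((2 : ℝ) • ·) h
  simp only [smul_inv_smul₀ (two_ne_zero' ℝ)] at h
  have hV := congrArg (Set.extremePoints ℝ) h
  rw [extremePoints_latticeHull_image hA, extremePoints_latticeHull_image hB,
    toReal_injective.image_injective.eq_iff, Finset.coe_inj] at hV
  refine parityType_nineVertices_injective ?_
  have := congrArg parityType hV
  rwa [parityType_image hA, parityType_image hB] at this

/-- Every half-unimodular simplex in `ℝ³` is the unimodular image of exactly one of the
nine simplices `Δ_0^1, Δ_1^1, Δ_2^1, Δ_3^1, Δ_0^0, Δ_1^0, Δ_2^0, Δ'_2, Δ'_3`. -/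
theorem halfUnimodular_classification (Δ : Set (Fin 3 → ℝ)) (hΔ : IsHalfUnimodular Δ) :
    ∃! j : Fin 9, ∃ f, IsUnimodular f ∧ Δ = f '' nineSimplices j := by
  obtain ⟨i, hi, f, hf, hfΔ⟩ := hΔ
  obtain ⟨A, hA, b, rfl⟩ := hf.exists_eq_realAffine
  obtain ⟨j, M, hM, d, hj⟩ := exists_nineVertices hi hA b
  have hΔ : Δ = realAffine M d '' nineSimplices j := by
    rw [realAffine_image_nineSimplices, ← hj, ← realAffine_image_latticeHull,
      ← baseSimplex_eq_latticeHull, ← hfΔ, inv_smul_smul₀ two_ne_zero]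
  refine ⟨j, ⟨_, isUnimodular_realAffine hM d, hΔ⟩, ?_⟩
  rintro l ⟨g, hg, hl⟩
  obtain ⟨B, hB, c, rfl⟩ := hg.exists_eq_realAffine
  exact eq_of_realAffine_image_eq hB hM (hl.symm.trans hΔ)
end

section
/- Every half-unimodular simplex in ℝ^n contains at most one point of ℤ^n. -/
open Pointwise

theorem baseSimplex_subset_Icc (n i : ℕ) : baseSimplex n i ⊆ Set.Icc 0 1 := by
  refine convexHull_min ?_ (convex_Icc 0 1)
  rintro _ (rfl | ⟨j, -, rfl⟩)
  · exact ⟨le_rfl, zero_le_one⟩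
  · constructor <;> intro k <;> by_cases h : k = j <;> simp [h]

/-- If an invertible integer matrix maps a real vector `w` into `(2ℤ)^n`, then every coordinate
of `w` is an even integer. -/
theorem exists_eq_two_mul_of_mulVec_eq {n : ℕ} {A : Matrix (Fin n) (Fin n) ℤ}
    (hA : IsUnit A.det) {w : Fin n → ℝ} {z : Fin n → ℤ}
    (h : (A.map (Int.cast : ℤ → ℝ)).mulVec w = fun i => 2 * (z i : ℝ)) (j : Fin n) :
    ∃ m : ℤ, w j = 2 * (m : ℝ) := by
  have hinv : (A⁻¹.map (Int.cast : ℤ → ℝ)) * A.map (Int.cast : ℤ → ℝ) = 1 := by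
    have h1 := congrArg (Int.castRingHom ℝ).mapMatrix (Matrix.nonsing_inv_mul A hA)
    rw [map_mul, map_one] at h1
    exact h1
  have hw : w = (A⁻¹.map (Int.cast : ℤ → ℝ)).mulVec (fun i => 2 * (z i : ℝ)) := by
    rw [← h, Matrix.mulVec_mulVec, hinv, Matrix.one_mulVec]
  refine ⟨A⁻¹.mulVec z j, ?_⟩
  rw [hw]
  simp only [Matrix.mulVec, dotProduct, Matrix.map_apply, Int.cast_sum, Int.cast_mul,
    Finset.mul_sum]
  exact Finset.sum_congr rfl fun k _ => by ring

/-- Every half-unimodular simplex in `ℝ^n` contains at most one point of `ℤ^n`. -/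
theorem halfUnimodular_at_most_one_lattice_point
    (n : ℕ) (Δ : Set (Fin n → ℝ)) (hΔ : IsHalfUnimodular Δ) :
    {x : Fin n → ℤ | (fun i => (x i : ℝ)) ∈ Δ}.Subsingleton := by
  obtain ⟨i, -, f, ⟨A, hA, b, hf⟩, hΔ⟩ := hΔ
  intro x hx y hy
  obtain ⟨u, hu, hux⟩ := hΔ.subset (Set.smul_mem_smul_set (a := (2 : ℝ)) hx)
  obtain ⟨v, hv, hvy⟩ := hΔ.subset (Set.smul_mem_smul_set (a := (2 : ℝ)) hy)
  have hdiff : (A.map (Int.cast : ℤ → ℝ)).mulVec (u - v) =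
      fun k => 2 * (((x - y) k : ℤ) : ℝ) := by
    rw [hf] at hux hvy
    funext k
    have h1 := congrFun hux k
    have h2 := congrFun hvy k
    simp only [Pi.add_apply, Pi.smul_apply, smul_eq_mul] at h1 h2
    rw [Matrix.mulVec_sub, Pi.sub_apply, Pi.sub_apply, Int.cast_sub]
    linarith
  have huv : u = v := by
    funext j
    obtain ⟨m, hm⟩ := exists_eq_two_mul_of_mulVec_eq hA hdiff j
    obtain ⟨hu0, hu1⟩ := baseSimplex_subset_Icc n i hu
    obtain ⟨hv0, hv1⟩ := baseSimplex_subset_Icc n i hv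
    have hu0 := hu0 j
    have hu1 := hu1 j
    have hv0 := hv0 j
    have hv1 := hv1 j
    simp only [Pi.zero_apply, Pi.one_apply, Pi.sub_apply] at hu0 hu1 hv0 hv1 hm
    have hlt : m < 1 := by
      have : (m : ℝ) < 1 := by linarith
      exact_mod_cast this
    have hgt : -1 < m := by
      have : (-1 : ℝ) < m := by linarith
      exact_mod_cast this
    obtain rfl : m = 0 := by omega
    simpa [sub_eq_zero] using hm
  funext k
  have h := congrFun (hux.symm.trans (huv ▸ hvy)) k
  simp only [Pi.smul_apply, smul_eq_mul] at h
  have : (x k : ℝ) = y k := by linarith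
  exact_mod_cast this
end
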